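/- arXiv:1510.04613 — 3 statements merged into one kernel-verified Lean document; each statement's English description precedes it below -/
import Mathlib

section
/- For 0 ≤ λ ≤ 1 there exist constants C > 0 and δ > 0, independent of K, ε and t, such that: if ψ is a solution as in the context satisfying the bootstrap bound E_N(ψ)(t) ≤ K²ε² for all t ≥ 0 and Kε ≤ δ, then for every multi-index a with |a| ≤ N−3 and every t ≥ 0, ‖∇∂Γ^a ψ(t,·)‖_{L^∞} ≤ C K ε (1+t)^{−2λ}. -/
noncomputable section
open MeasureTheory Real Set

/-- Euclidean space ℝ³. -/
abbrev E3 : Type := EuclideanSpace ℝ (Fin 3)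
/-- A space-time point (t, x) ∈ ℝ × ℝ³. -/
abbrev Pt : Type := ℝ × E3

/-- Time derivative ∂ₜ. -/
def dt (f : Pt → ℝ) (p : Pt) : ℝ := fderiv ℝ f p (1, 0)
/-- Spatial derivative ∂ᵢ. -/
def dxi (i : Fin 3) (f : Pt → ℝ) (p : Pt) : ℝ := fderiv ℝ f p (0, EuclideanSpace.single i 1)

/-- The vector fields Γ = (∂ₜ, ∂₁, ∂₂, ∂₃, Ω₁, Ω₂, Ω₃, S), where Ω = x ∧ ∇ are the
rotations and S = t∂ₜ + Σ xₖ∂ₖ is the scaling field. -/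
def Gam : Fin 8 → (Pt → ℝ) → Pt → ℝ :=
  ![dt, dxi 0, dxi 1, dxi 2,
    fun f p => p.2 1 * dxi 2 f p - p.2 2 * dxi 1 f p,
    fun f p => p.2 2 * dxi 0 f p - p.2 0 * dxi 2 f p,
    fun f p => p.2 0 * dxi 1 f p - p.2 1 * dxi 0 f p,
    fun f p => p.1 * dt f p + ∑ k, p.2 k * dxi k f p]

/-- The composition Γ^a corresponding to a word `a` in the eight fields. -/
def GamWord : List (Fin 8) → (Pt → ℝ) → Pt → ℝ
  | [], f => f
  | k :: l, f => Gam k (GamWord l f)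

/-- The first-order derivatives ∂ = (∂ₜ, ∂₁, ∂₂, ∂₃). -/
def Dop : Fin 4 → (Pt → ℝ) → Pt → ℝ := ![dt, dxi 0, dxi 1, dxi 2]

/-- The composition ∂^a corresponding to a word `a` in the four derivatives. -/
def DWord : List (Fin 4) → (Pt → ℝ) → Pt → ℝ
  | [], f => f
  | k :: l, f => Dop k (DWord l f)

/-- L² norm in the space variable. -/
def L2norm (f : E3 → ℝ) : ℝ := Real.sqrt (∫ x : E3, (f x) ^ 2)

/-- The d'Alembertian □ = ∂ₜ² - Δ. -/
def box (f : Pt → ℝ) (p : Pt) : ℝ :=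
  dt (fun q => dt f q) p - ∑ i, dxi i (fun q => dxi i f q) p

/-- The square of the sound speed, expressed through ψ:
`c²(ρ) = 1 - (γ-1)[(1+t)^λ ∂ₜψ + λ(1+t)^{λ-1}ψ + μψ + (1+t)^{2λ}|∇ψ|²/2]`. -/
def csq (μ lam γ : ℝ) (ψ : Pt → ℝ) (p : Pt) : ℝ :=
  1 - (γ - 1) * ((1 + p.1) ^ lam * dt ψ p + lam * (1 + p.1) ^ (lam - 1) * ψ p
    + μ * ψ p + (1 + p.1) ^ (2 * lam) * (∑ i, (dxi i ψ p) ^ 2) / 2)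

/-- The quadratic error term `Q(ψ) = (c²(ρ)-1)Δψ - 2(1+t)^λ ∂ₜ∇ψ·∇ψ
- 2λ(1+t)^{λ-1}|∇ψ|² - μ|∇ψ|² - (1+t)^{2λ} Σ (∂ᵢψ)(∂ⱼψ)∂ᵢⱼψ`. -/
def Qpsi (μ lam γ : ℝ) (ψ : Pt → ℝ) (p : Pt) : ℝ :=
  (csq μ lam γ ψ p - 1) * (∑ i, dxi i (fun q => dxi i ψ q) p)
    - 2 * (1 + p.1) ^ lam * ∑ i, dxi i (fun q => dt ψ q) p * dxi i ψ p
    - 2 * lam * (1 + p.1) ^ (lam - 1) * ∑ i, (dxi i ψ p) ^ 2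
    - μ * ∑ i, (dxi i ψ p) ^ 2
    - (1 + p.1) ^ (2 * lam) *
        ∑ i, ∑ j, dxi i ψ p * dxi j ψ p * dxi i (fun q => dxi j ψ q) p

/-- ψ solves `□ψ + (μ/(1+t)^λ)∂ₜψ + (2λ/(1+t))∂ₜψ - (λ(1-λ)/(1+t)²)ψ = Q(ψ)` for `t ≥ 0`. -/
def psiEq (μ lam γ : ℝ) (ψ : Pt → ℝ) : Prop :=
  ∀ p : Pt, 0 ≤ p.1 →
    box ψ p + μ / (1 + p.1) ^ lam * dt ψ p + 2 * lam / (1 + p.1) * dt ψ p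
      - lam * (1 - lam) / (1 + p.1) ^ 2 * ψ p = Qpsi μ lam γ ψ p

/-- The time-weighted energy
`E_N(ψ)(t) = Σ_{|a|≤N} ∫ ((1+t)^{2λ}|∂Γ^aψ|² + |Γ^aψ|²) dx`. -/
def energy (lam : ℝ) (N : ℕ) (ψ : Pt → ℝ) (t : ℝ) : ℝ :=
  ∑ n ∈ Finset.range (N + 1), ∑ a : Fin n → Fin 8,
    ∫ x : E3, ((1 + t) ^ (2 * lam) *
        ∑ α : Fin 4, (Dop α (GamWord (List.ofFn a) ψ) (t, x)) ^ 2
      + (GamWord (List.ofFn a) ψ (t, x)) ^ 2)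

/-- smooth on the open half space -/
def Sm (f : Pt → ℝ) : Prop := ∀ p : Pt, 0 < p.1 → ContDiffAt ℝ (⊤ : ℕ∞) f p

def e4 : Fin 4 → Pt := ![(1, 0), (0, EuclideanSpace.single 0 1), (0, EuclideanSpace.single 1 1),
  (0, EuclideanSpace.single 2 1)]

def y4 : Fin 4 → Pt → ℝ := ![fun p => p.1, fun p => p.2 0, fun p => p.2 1, fun p => p.2 2]

def cc : Fin 8 → Fin 4 → Fin 4 → ℝ :=
  ![0, 0, 0, 0,
    fun g b => if g = 2 ∧ b = 3 then 1 else if g = 3 ∧ b = 2 then -1 else 0,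
    fun g b => if g = 3 ∧ b = 1 then 1 else if g = 1 ∧ b = 3 then -1 else 0,
    fun g b => if g = 1 ∧ b = 2 then 1 else if g = 2 ∧ b = 1 then -1 else 0,
    fun g b => if g = b then 1 else 0]

def cd : Fin 8 → Fin 4 → ℝ :=
  fun k b => if k.val = b.val then 1 else 0

def coef (k : Fin 8) (b : Fin 4) (p : Pt) : ℝ := cd k b + ∑ g, cc k g b * y4 g p

lemma Dop_eq (a : Fin 4) (f : Pt → ℝ) (p : Pt) : Dop a f p = fderiv ℝ f p (e4 a) := by
  fin_cases a <;> rfl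

lemma Gam_eq (k : Fin 8) (f : Pt → ℝ) (p : Pt) :
    Gam k f p = ∑ b, coef k b p * Dop b f p := by
  fin_cases k <;> simp [Gam, Dop, coef, cc, cd, y4, Fin.sum_univ_succ] <;> ring

lemma Sm.diff {f : Pt → ℝ} (hf : Sm f) {p : Pt} (hp : 0 < p.1) : DifferentiableAt ℝ f p :=
  (hf p hp).differentiableAt (by simp)

lemma Sm.add {f g : Pt → ℝ} (hf : Sm f) (hg : Sm g) : Sm (f + g) :=
  fun p hp => (hf p hp).add (hg p hp)
lemma Sm.sub {f g : Pt → ℝ} (hf : Sm f) (hg : Sm g) : Sm (f - g) :=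
  fun p hp => (hf p hp).sub (hg p hp)
lemma Sm.mul {f g : Pt → ℝ} (hf : Sm f) (hg : Sm g) : Sm (f * g) :=
  fun p hp => (hf p hp).mul (hg p hp)
lemma Sm.smul {f : Pt → ℝ} (hf : Sm f) (c : ℝ) : Sm (c • f) :=
  fun p hp => contDiffAt_const.smul (hf p hp)
lemma Sm.zero : Sm 0 := fun _ _ => contDiffAt_const
lemma Sm.sum {ι : Type*} {s : Finset ι} {f : ι → Pt → ℝ} (hf : ∀ i ∈ s, Sm (f i)) :
    Sm (∑ i ∈ s, f i) := by
  classical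
  induction s using Finset.induction_on with
  | empty => simpa using Sm.zero
  | insert a s ha ih =>
    rw [Finset.sum_insert ha]
    exact (hf a (by simp)).add (ih fun i hi => hf i (by simp [hi]))

lemma Sm.Dop {f : Pt → ℝ} (hf : Sm f) (a : Fin 4) : Sm (Dop a f) := by
  intro p hp
  have h : (_root_.Dop a f) = fun q => fderiv ℝ f q (e4 a) := by ext q; exact Dop_eq a f q
  rw [h]
  exact ((hf p hp).fderiv_right (m := (⊤ : ℕ∞)) (by simp)).clm_apply contDiffAt_const

lemma y4_cd (g : Fin 4) : ContDiff ℝ (⊤ : ℕ∞) (y4 g) := by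
  fin_cases g <;> simp only [y4] <;> dsimp <;> fun_prop

lemma Sm.y4 (g : Fin 4) : Sm (y4 g) := fun _ _ => (y4_cd g).contDiffAt

lemma coef_cd (k : Fin 8) (b : Fin 4) : ContDiff ℝ (⊤ : ℕ∞) (coef k b) := by
  unfold coef
  have := y4_cd
  fun_prop

lemma Gam_fun (k : Fin 8) (f : Pt → ℝ) : Gam k f = ∑ b, coef k b * Dop b f := by
  ext p; simp [Gam_eq]

lemma Sm.Gam {f : Pt → ℝ} (hf : Sm f) (k : Fin 8) : Sm (Gam k f) := by
  rw [Gam_fun]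
  exact Sm.sum fun b _ => Sm.mul (fun p _ => (coef_cd k b).contDiffAt) (hf.Dop b)

lemma Sm.GamWord {f : Pt → ℝ} (hf : Sm f) (l : List (Fin 8)) : Sm (GamWord l f) := by
  induction l with
  | nil => exact hf
  | cons k l ih => exact ih.Gam k

lemma GamWord_append (l l' : List (Fin 8)) (f : Pt → ℝ) :
    GamWord (l ++ l') f = GamWord l (GamWord l' f) := by
  induction l with
  | nil => rfl
  | cons k l ih => simp [GamWord, ih]

/-- equality on the half space -/
def EqU (f g : Pt → ℝ) : Prop := ∀ p : Pt, 0 < p.1 → f p = g p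

lemma U_open : IsOpen {p : Pt | 0 < p.1} := isOpen_lt continuous_const continuous_fst

lemma EqU.ev {f g : Pt → ℝ} (h : EqU f g) {p : Pt} (hp : 0 < p.1) : f =ᶠ[nhds p] g := by
  filter_upwards [U_open.mem_nhds hp] with q hq using h q hq

lemma EqU.Dop {f g : Pt → ℝ} (h : EqU f g) (a : Fin 4) : EqU (Dop a f) (Dop a g) := by
  intro p hp
  rw [Dop_eq, Dop_eq, (h.ev hp).fderiv_eq]

lemma EqU.Gam {f g : Pt → ℝ} (h : EqU f g) (k : Fin 8) : EqU (Gam k f) (Gam k g) := by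
  intro p hp
  simp only [Gam_eq, h.Dop _ p hp]

lemma EqU.GamWord {f g : Pt → ℝ} (h : EqU f g) (l : List (Fin 8)) :
    EqU (GamWord l f) (GamWord l g) := by
  induction l with
  | nil => exact h
  | cons k l ih => exact ih.Gam k

lemma Dop_add {f g : Pt → ℝ} (hf : Sm f) (hg : Sm g) (a : Fin 4) :
    EqU (Dop a (f + g)) (Dop a f + Dop a g) := by
  intro p hp
  simp only [Pi.add_apply, Dop_eq]
  rw [fderiv_add (hf.diff hp) (hg.diff hp)]; rfl

lemma Dop_smul {f : Pt → ℝ} (hf : Sm f) (c : ℝ) (a : Fin 4) :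
    EqU (Dop a (c • f)) (c • Dop a f) := by
  intro p hp
  simp only [Pi.smul_apply, Dop_eq]
  rw [fderiv_const_smul (hf.diff hp)]; rfl

lemma Dop_mul {f g : Pt → ℝ} (hf : Sm f) (hg : Sm g) (a : Fin 4) :
    EqU (Dop a (f * g)) (Dop a f * g + f * Dop a g) := by
  intro p hp
  simp only [Pi.add_apply, Pi.mul_apply, Dop_eq]
  rw [fderiv_mul (hf.diff hp) (hg.diff hp)]
  simp; ring

lemma Dop_zero (a : Fin 4) : Dop a 0 = 0 := by
  ext p; rw [Dop_eq]; simp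

lemma Dop_sum {ι : Type*} {s : Finset ι} {f : ι → Pt → ℝ} (hf : ∀ i ∈ s, Sm (f i)) (a : Fin 4) :
    EqU (Dop a (∑ i ∈ s, f i)) (∑ i ∈ s, Dop a (f i)) := by
  classical
  induction s using Finset.induction_on with
  | empty => intro p _; simp [Dop_zero]
  | insert b s hb ih =>
    rw [Finset.sum_insert hb, Finset.sum_insert hb]
    intro p hp
    rw [Dop_add (hf b (by simp)) (Sm.sum fun i hi => hf i (by simp [hi])) a p hp]
    simp only [Pi.add_apply]
    rw [ih (fun i hi => hf i (by simp [hi])) p hp]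

lemma Gam_add {f g : Pt → ℝ} (hf : Sm f) (hg : Sm g) (k : Fin 8) :
    EqU (Gam k (f + g)) (Gam k f + Gam k g) := by
  intro p hp
  simp only [Gam_eq, Pi.add_apply, Dop_add hf hg _ p hp, mul_add, Finset.sum_add_distrib]

lemma Gam_smul {f : Pt → ℝ} (hf : Sm f) (c : ℝ) (k : Fin 8) :
    EqU (Gam k (c • f)) (c • Gam k f) := by
  intro p hp
  simp only [Gam_eq, Pi.smul_apply, Dop_smul hf _ _ p hp, smul_eq_mul, Finset.mul_sum]
  exact Finset.sum_congr rfl fun _ _ => by ring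

lemma Gam_mul {f g : Pt → ℝ} (hf : Sm f) (hg : Sm g) (k : Fin 8) :
    EqU (Gam k (f * g)) (Gam k f * g + f * Gam k g) := by
  intro p hp
  simp only [Gam_eq, Pi.add_apply, Pi.mul_apply, Dop_mul hf hg _ p hp, Finset.mul_sum,
    Finset.sum_mul, ← Finset.sum_add_distrib]
  exact Finset.sum_congr rfl fun _ _ => by ring

lemma GamWord_add {f g : Pt → ℝ} (hf : Sm f) (hg : Sm g) (l : List (Fin 8)) :
    EqU (GamWord l (f + g)) (GamWord l f + GamWord l g) := by
  induction l with
  | nil => intro p _; rfl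
  | cons k l ih =>
    intro p hp
    show Gam k _ p = _
    rw [ih.Gam k p hp, Gam_add (hf.GamWord l) (hg.GamWord l) k p hp]; rfl

lemma GamWord_smul {f : Pt → ℝ} (hf : Sm f) (c : ℝ) (l : List (Fin 8)) :
    EqU (GamWord l (c • f)) (c • GamWord l f) := by
  induction l with
  | nil => intro p _; rfl
  | cons k l ih =>
    intro p hp
    show Gam k _ p = _
    rw [ih.Gam k p hp, Gam_smul (hf.GamWord l) c k p hp]; rfl

lemma Gam_zero (k : Fin 8) : Gam k 0 = 0 := by
  ext p; simp [Gam_eq, Dop_zero]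

lemma GamWord_zero (l : List (Fin 8)) : GamWord l 0 = 0 := by
  induction l with
  | nil => rfl
  | cons k l ih => show Gam k _ = _; rw [ih, Gam_zero]

lemma GamWord_sum {ι : Type*} {s : Finset ι} {f : ι → Pt → ℝ} (hf : ∀ i ∈ s, Sm (f i))
    (l : List (Fin 8)) :
    EqU (GamWord l (∑ i ∈ s, f i)) (∑ i ∈ s, GamWord l (f i)) := by
  classical
  induction s using Finset.induction_on with
  | empty => intro p _; simp [GamWord_zero]
  | insert b s hb ih =>
    rw [Finset.sum_insert hb, Finset.sum_insert hb]
    intro p hp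
    rw [GamWord_add (hf b (by simp)) (Sm.sum fun i hi => hf i (by simp [hi])) l p hp]
    simp only [Pi.add_apply]
    rw [ih (fun i hi => hf i (by simp [hi])) p hp]

lemma Dop_comm {f : Pt → ℝ} (hf : Sm f) (a b : Fin 4) : EqU (Dop a (Dop b f)) (Dop b (Dop a f)) := by
  intro p hp
  have hd : DifferentiableAt ℝ (fderiv ℝ f) p :=
    ((hf p hp).fderiv_right (m := (⊤ : ℕ∞)) (by simp)).differentiableAt (by simp)
  have key : ∀ a b : Fin 4, Dop a (Dop b f) p = fderiv ℝ (fderiv ℝ f) p (e4 a) (e4 b) := by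
    intro a b
    have h : (Dop b f) = fun q => fderiv ℝ f q (e4 b) := by ext q; exact Dop_eq b f q
    rw [Dop_eq, h, fderiv_clm_apply hd (by fun_prop)]
    simp
  rw [key, key]
  refine (hf p hp).isSymmSndFDerivAt ?_ _ _
  simp only [minSmoothness_of_isRCLikeNormedField]
  exact WithTop.coe_le_coe.2 (le_top : (2 : ℕ∞) ≤ ⊤)

lemma Dop_y4 (a g : Fin 4) (p : Pt) : Dop a (y4 g) p = if a = g then 1 else 0 := by
  rw [Dop_eq]
  have h0 : fderiv ℝ (y4 0) p = ContinuousLinearMap.fst ℝ ℝ E3 := 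
    (ContinuousLinearMap.fst ℝ ℝ E3).fderiv
  have hi : ∀ i : Fin 3, fderiv ℝ (fun p : Pt => p.2 i) p =
      (EuclideanSpace.proj i).comp (ContinuousLinearMap.snd ℝ ℝ E3) := fun i =>
    ((EuclideanSpace.proj (𝕜 := ℝ) i).comp (ContinuousLinearMap.snd ℝ ℝ E3)).fderiv
  have h1 : fderiv ℝ (y4 1) p = _ := hi 0
  have h2 : fderiv ℝ (y4 2) p = _ := hi 1
  have h3 : fderiv ℝ (y4 3) p = _ := hi 2
  fin_cases g <;> simp only [Fin.zero_eta, Fin.mk_one, Fin.reduceFinMk, h0, h1, h2, h3] <;>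
    fin_cases a <;> simp [e4]

lemma Dop_coef (a : Fin 4) (k : Fin 8) (b : Fin 4) (p : Pt) (hp : 0 < p.1) :
    Dop a (coef k b) p = cc k a b := by
  have h : EqU (coef k b) ((fun _ => cd k b) + ∑ g, cc k g b • y4 g) := by
    intro p _; simp [coef]
  rw [h.Dop a p hp, Dop_add (fun _ _ => contDiffAt_const)
    (Sm.sum fun g _ => (Sm.y4 g).smul _) a p hp]
  simp only [Pi.add_apply]
  rw [Dop_sum (fun g _ => (Sm.y4 g).smul _) a p hp, Dop_eq a (fun _ => cd k b)]
  simp only [fderiv_fun_const, Finset.sum_apply]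
  have : ∀ g, Dop a (cc k g b • y4 g) p = cc k g b * (if a = g then 1 else 0) := by
    intro g
    rw [Dop_smul (Sm.y4 g) _ a p hp, Pi.smul_apply, Dop_y4]; rfl
  simp [this]

/-- commutator of the fields with the derivatives -/
lemma Gam_Dop {f : Pt → ℝ} (hf : Sm f) (k : Fin 8) (a : Fin 4) (p : Pt) (hp : 0 < p.1) :
    Gam k (Dop a f) p = Dop a (Gam k f) p + ∑ b, (-cc k a b) * Dop b f p := by
  have hs : ∀ b, Sm (coef k b) := fun b p _ => (coef_cd k b).contDiffAt
  rw [Gam_fun k f, Dop_sum (fun b _ => (hs b).mul (hf.Dop b)) a p hp, Gam_eq]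
  simp only [Finset.sum_apply]
  rw [← Finset.sum_add_distrib]
  refine Finset.sum_congr rfl fun b _ => ?_
  rw [Dop_mul (hs b) (hf.Dop b) a p hp]
  simp only [Pi.add_apply, Pi.mul_apply]
  rw [Dop_coef a k b p hp, Dop_comm hf a b p hp]
  ring

def words (m : ℕ) : Finset (List (Fin 8)) :=
  (Finset.range (m + 1)).biUnion fun n =>
    (Finset.univ : Finset (Fin n → Fin 8)).image List.ofFn

lemma mem_words {m : ℕ} {l : List (Fin 8)} : l ∈ words m ↔ l.length ≤ m := by
  simp only [words, Finset.mem_biUnion, Finset.mem_range, Finset.mem_image, Finset.mem_univ,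
    true_and]
  constructor
  · rintro ⟨n, hn, a, rfl⟩; simp; omega
  · intro h; exact ⟨l.length, by omega, l.get, List.ofFn_get l⟩

def J (m : ℕ) (f : Pt → ℝ) (p : Pt) : ℝ := ∑ l ∈ words m, |GamWord l f p|

lemma J_nonneg (m : ℕ) (f : Pt → ℝ) (p : Pt) : 0 ≤ J m f p :=
  Finset.sum_nonneg fun _ _ => abs_nonneg _

lemma le_J {m : ℕ} {l : List (Fin 8)} (h : l.length ≤ m) (f : Pt → ℝ) (p : Pt) :
    |GamWord l f p| ≤ J m f p :=
  Finset.single_le_sum (f := fun l => |GamWord l f p|) (fun _ _ => abs_nonneg _) (mem_words.2 h)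

lemma J_le {m : ℕ} {f : Pt → ℝ} {p : Pt} {B : ℝ}
    (h : ∀ l : List (Fin 8), l.length ≤ m → |GamWord l f p| ≤ B) :
    J m f p ≤ (words m).card * B := by
  have := Finset.sum_le_card_nsmul (words m) (fun l => |GamWord l f p|) B
    (fun l hl => h l (mem_words.1 hl))
  simpa [J] using this

lemma J_mono {m n : ℕ} (h : m ≤ n) (f : Pt → ℝ) (p : Pt) : J m f p ≤ J n f p :=
  Finset.sum_le_sum_of_subset_of_nonneg
    (fun _ hl => mem_words.2 ((mem_words.1 hl).trans h)) fun _ _ _ => abs_nonneg _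

lemma J_congr {m : ℕ} {f g : Pt → ℝ} (h : EqU f g) {p : Pt} (hp : 0 < p.1) : J m f p = J m g p :=
  Finset.sum_congr rfl fun l _ => by rw [h.GamWord l p hp]

lemma J_zero (f : Pt → ℝ) (p : Pt) : |f p| ≤ J 0 f p := le_J (l := []) (by simp) f p

lemma abs_le_J (m : ℕ) (f : Pt → ℝ) (p : Pt) : |f p| ≤ J m f p := le_J (l := []) (by simp) f p

lemma J_add {m : ℕ} {f g : Pt → ℝ} (hf : Sm f) (hg : Sm g) {p : Pt} (hp : 0 < p.1) :
    J m (f + g) p ≤ J m f p + J m g p := by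
  unfold J
  rw [← Finset.sum_add_distrib]
  refine Finset.sum_le_sum fun l _ => ?_
  rw [GamWord_add hf hg l p hp]
  exact abs_add_le _ _

lemma J_smul {m : ℕ} {f : Pt → ℝ} (hf : Sm f) (c : ℝ) {p : Pt} (hp : 0 < p.1) :
    J m (c • f) p = |c| * J m f p := by
  unfold J
  rw [Finset.mul_sum]
  refine Finset.sum_congr rfl fun l _ => ?_
  rw [GamWord_smul hf c l p hp]
  simp [abs_mul]

lemma GamWord_snoc (l : List (Fin 8)) (k : Fin 8) (f : Pt → ℝ) :
    GamWord (l ++ [k]) f = GamWord l (Gam k f) := GamWord_append l [k] f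

/-- Leibniz rule, as a bound -/
lemma leibniz (l : List (Fin 8)) : ∀ {f g : Pt → ℝ}, Sm f → Sm g → ∀ {p : Pt}, 0 < p.1 →
    ∀ B : ℝ, (∀ a b : List (Fin 8), a.length + b.length = l.length →
      |GamWord a f p| * |GamWord b g p| ≤ B) → |GamWord l (f * g) p| ≤ 2 ^ l.length * B := by
  induction l using List.reverseRecOn with
  | nil =>
    intro f g hf hg p hp B h
    have := h [] [] rfl
    simpa [GamWord, abs_mul] using this
  | append_singleton l k ih =>
    intro f g hf hg p hp B h
    rw [GamWord_snoc, (Gam_mul hf hg k).GamWord l p hp,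
      GamWord_add ((hf.Gam k).mul hg) (hf.mul (hg.Gam k)) l p hp]
    have h1 := ih (hf.Gam k) hg hp B fun a b hab => by
      rw [← GamWord_snoc]; apply h; simp; omega
    have h2 := ih hf (hg.Gam k) hp B fun a b hab => by
      rw [← GamWord_snoc]; apply h; simp; omega
    refine (abs_add_le _ _).trans ?_
    simp only [List.length_append, List.length_singleton, pow_succ]
    linarith

lemma leibniz1 (m : ℕ) : ∃ C : ℝ, 0 < C ∧ ∀ f g : Pt → ℝ, Sm f → Sm g → ∀ p : Pt, 0 < p.1 →
    J m (f * g) p ≤ C * (J m f p * J m g p) := by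
  refine ⟨((words m).card + 1) * 2 ^ m, by positivity, fun f g hf hg p hp => ?_⟩
  have hB : 0 ≤ J m f p * J m g p := mul_nonneg (J_nonneg _ _ _) (J_nonneg _ _ _)
  have : J m (f * g) p ≤ (words m).card * (2 ^ m * (J m f p * J m g p)) := by
    refine J_le fun l hl => ?_
    refine (leibniz l hf hg hp (J m f p * J m g p) fun a b hab => ?_).trans ?_
    · exact mul_le_mul (le_J (by omega) _ _) (le_J (by omega) _ _) (abs_nonneg _) (J_nonneg _ _ _)
    · gcongr; norm_num
  refine this.trans ?_
  have : 0 ≤ 2 ^ m * (J m f p * J m g p) := by positivity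
  nlinarith

lemma leibniz2 (m : ℕ) : ∃ C : ℝ, 0 < C ∧ ∀ f g : Pt → ℝ, Sm f → Sm g → ∀ p : Pt, 0 < p.1 →
    J (m + 1) (f * g) p ≤ C * (J m f p * J (m + 1) g p + J (m + 1) f p * J 0 g p) := by
  refine ⟨((words (m + 1)).card + 1) * 2 ^ (m + 1), by positivity, fun f g hf hg p hp => ?_⟩
  have h1 : 0 ≤ J m f p * J (m + 1) g p := mul_nonneg (J_nonneg _ _ _) (J_nonneg _ _ _)
  have h2 : 0 ≤ J (m + 1) f p * J 0 g p := mul_nonneg (J_nonneg _ _ _) (J_nonneg _ _ _)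
  set B := J m f p * J (m + 1) g p + J (m + 1) f p * J 0 g p with hBdef
  have hB : 0 ≤ B := add_nonneg h1 h2
  have : J (m + 1) (f * g) p ≤ (words (m + 1)).card * (2 ^ (m + 1) * B) := by
    refine J_le fun l hl => ?_
    refine (leibniz l hf hg hp B fun a b hab => ?_).trans ?_
    · by_cases ha : a.length ≤ m
      · have : |GamWord a f p| * |GamWord b g p| ≤ J m f p * J (m + 1) g p :=
          mul_le_mul (le_J ha _ _) (le_J (by omega) _ _) (abs_nonneg _) (J_nonneg _ _ _)
        linarith
      · have : |GamWord a f p| * |GamWord b g p| ≤ J (m + 1) f p * J 0 g p :=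
          mul_le_mul (le_J (by omega) _ _) (le_J (by omega) _ _) (abs_nonneg _) (J_nonneg _ _ _)
        linarith
    · gcongr; norm_num
  refine this.trans ?_
  have : 0 ≤ 2 ^ (m + 1) * B := by positivity
  nlinarith

/-- families of operators stable under commutation with the fields -/
structure Fam {ι : Type} [Fintype ι] (D : ι → (Pt → ℝ) → Pt → ℝ) : Prop where
  sm : ∀ j f, Sm f → Sm (D j f)
  comm : ∃ c : Fin 8 → ι → ι → ℝ, ∀ k j f, Sm f → ∀ p : Pt, 0 < p.1 →
    Gam k (D j f) p = D j (Gam k f) p + ∑ i, c k j i * D i f p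

lemma Fam.bd {ι : Type} [Fintype ι] {D : ι → (Pt → ℝ) → Pt → ℝ} (hD : Fam D) :
    ∃ c0 : ℝ, 0 ≤ c0 ∧ ∃ c : Fin 8 → ι → ι → ℝ, (∀ k j i, |c k j i| ≤ c0) ∧
    ∀ k j f, Sm f → 
    EqU (Gam k (D j f)) (D j (Gam k f) + ∑ i, c k j i • D i f) := by
  obtain ⟨c, hc⟩ := hD.comm
  refine ⟨∑ k, ∑ j, ∑ i, |c k j i|, by positivity, c, fun k j i => ?_, fun k j f hf p hp => ?_⟩
  · calc |c k j i| ≤ ∑ i, |c k j i| :=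
        Finset.single_le_sum (f := fun i => |c k j i|) (fun _ _ => abs_nonneg _) (Finset.mem_univ i)
      _ ≤ ∑ j, ∑ i, |c k j i| :=
        Finset.single_le_sum (f := fun j => ∑ i, |c k j i|) (fun _ _ => by positivity)
          (Finset.mem_univ j)
      _ ≤ _ := Finset.single_le_sum (f := fun k => ∑ j, ∑ i, |c k j i|) (fun _ _ => by positivity)
          (Finset.mem_univ k)
  · rw [hc k j f hf p hp]; simp

def BD {ι : Type} [Fintype ι] (D : ι → (Pt → ℝ) → Pt → ℝ) (m : ℕ) (f : Pt → ℝ) (p : Pt) : ℝ :=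
  ∑ j, ∑ l ∈ words m, |D j (GamWord l f) p|

lemma BD_nonneg {ι : Type} [Fintype ι] (D : ι → (Pt → ℝ) → Pt → ℝ) (m : ℕ) (f : Pt → ℝ) (p : Pt) :
    0 ≤ BD D m f p := Finset.sum_nonneg fun _ _ => Finset.sum_nonneg fun _ _ => abs_nonneg _

lemma le_BD {ι : Type} [Fintype ι] (D : ι → (Pt → ℝ) → Pt → ℝ) {m : ℕ} {l : List (Fin 8)}
    (hl : l.length ≤ m) (j : ι) (f : Pt → ℝ) (p : Pt) : |D j (GamWord l f) p| ≤ BD D m f p :=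
  (Finset.single_le_sum (f := fun l => |D j (GamWord l f) p|) (fun _ _ => abs_nonneg _)
    (mem_words.2 hl)).trans
  (Finset.single_le_sum (f := fun j => ∑ l ∈ words m, |D j (GamWord l f) p|)
    (fun _ _ => by positivity) (Finset.mem_univ j))

lemma BD_le {ι : Type} [Fintype ι] (D : ι → (Pt → ℝ) → Pt → ℝ) {m : ℕ} {f : Pt → ℝ} {p : Pt}
    {B : ℝ} (h : ∀ l : List (Fin 8), l.length ≤ m → ∀ j, |D j (GamWord l f) p| ≤ B) :
    BD D m f p ≤ (Fintype.card ι * (words m).card) * B := by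
  have h1 : ∀ j ∈ (Finset.univ : Finset ι), ∑ l ∈ words m, |D j (GamWord l f) p|
      ≤ (words m).card * B := by
    intro j _
    have := Finset.sum_le_card_nsmul (words m) (fun l => |D j (GamWord l f) p|) B
      (fun l hl => h l (mem_words.1 hl) j)
    simpa using this
  have := Finset.sum_le_card_nsmul _ _ _ h1
  simpa [BD, mul_assoc] using this

lemma BD_word {ι : Type} [Fintype ι] (D : ι → (Pt → ℝ) → Pt → ℝ) (m : ℕ) (w : List (Fin 8))
    (f : Pt → ℝ) (p : Pt) : BD D m (GamWord w f) p ≤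
      (Fintype.card ι * (words m).card) * BD D (m + w.length) f p := by
  refine BD_le D fun l hl j => ?_
  rw [← GamWord_append]
  exact le_BD D (by simp; omega) j f p

lemma famA {ι : Type} [Fintype ι] {D : ι → (Pt → ℝ) → Pt → ℝ} (hD : Fam D) (m : ℕ) :
    ∃ C : ℝ, 0 ≤ C ∧ ∀ f, Sm f → ∀ p : Pt, 0 < p.1 → ∀ j, ∀ l : List (Fin 8), l.length ≤ m →
      |GamWord l (D j f) p| ≤ C * BD D m f p := by
  obtain ⟨c0, hc0, c, hcb, hc⟩ := hD.bd
  induction m with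
  | zero =>
    refine ⟨1, zero_le_one, fun f hf p hp j l hl => ?_⟩
    have : l = [] := by simpa using hl
    subst this
    rw [one_mul]
    exact le_BD D (l := []) le_rfl j f p
  | succ m ih =>
    obtain ⟨C, hC, ih⟩ := ih
    set Kc : ℝ := Fintype.card ι * (words m).card
    have hK : 0 ≤ Kc := by positivity
    refine ⟨C * Kc + C + (Fintype.card ι * c0) * C, by positivity, fun f hf p hp j l hl => ?_⟩
    have hBm : BD D m f p ≤ BD D (m + 1) f p := by
      refine Finset.sum_le_sum fun j _ => Finset.sum_le_sum_of_subset_of_nonneg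
        (fun _ hl => mem_words.2 ((mem_words.1 hl).trans (by omega))) fun _ _ _ => abs_nonneg _
    have hB0 := BD_nonneg D m f p
    rcases List.eq_nil_or_concat l with rfl | ⟨l', k, rfl⟩
    · have := ih f hf p hp j [] (by simp)
      have h3 : 0 ≤ (C * Kc + (Fintype.card ι * c0) * C) * BD D (m + 1) f p :=
        mul_nonneg (by positivity) (BD_nonneg _ _ _ _)
      nlinarith
    · have hl' : l'.length ≤ m := by simpa using hl
      rw [List.concat_eq_append, GamWord_snoc, (hc k j f hf).GamWord l' p hp,
        GamWord_add (hD.sm j _ (hf.Gam k)) (Sm.sum fun i _ => (hD.sm i f hf).smul _) l' p hp,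
        Pi.add_apply, GamWord_sum (fun i _ => (hD.sm i f hf).smul _) l' p hp, Finset.sum_apply]
      have h1 := ih (Gam k f) (hf.Gam k) p hp j l' hl'
      have h2 : BD D m (Gam k f) p ≤ Kc * BD D (m + 1) f p := BD_word D m [k] f p
      have h3 : |∑ i, GamWord l' (c k j i • D i f) p| ≤ (Fintype.card ι * c0) * (C * BD D m f p) := by
        refine (Finset.abs_sum_le_sum_abs _ _).trans ?_
        have : ∀ i ∈ (Finset.univ : Finset ι), |GamWord l' (c k j i • D i f) p|
            ≤ c0 * (C * BD D m f p) := by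
          intro i _
          rw [GamWord_smul (hD.sm i f hf) _ l' p hp, Pi.smul_apply, smul_eq_mul, abs_mul]
          exact mul_le_mul (hcb k j i) (ih f hf p hp i l' hl') (abs_nonneg _) hc0
        have := Finset.sum_le_card_nsmul _ _ _ this
        simpa [mul_assoc] using this
      refine (abs_add_le _ _).trans ?_
      have h4 : C * BD D m (Gam k f) p ≤ C * (Kc * BD D (m + 1) f p) := by gcongr
      have h5 : (Fintype.card ι * c0) * (C * BD D m f p)
          ≤ (Fintype.card ι * c0) * (C * BD D (m + 1) f p) := by gcongr
      have h6 : 0 ≤ C * BD D (m + 1) f p := mul_nonneg hC (BD_nonneg _ _ _ _)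
      nlinarith

lemma famA' {ι : Type} [Fintype ι] {D : ι → (Pt → ℝ) → Pt → ℝ} (hD : Fam D) (m : ℕ) :
    ∃ C : ℝ, 0 ≤ C ∧ ∀ f, Sm f → ∀ p : Pt, 0 < p.1 → ∀ j,
      J m (D j f) p ≤ C * BD D m f p := by
  obtain ⟨C, hC, h⟩ := famA hD m
  refine ⟨(words m).card * C, by positivity, fun f hf p hp j => ?_⟩
  rw [mul_assoc]
  exact J_le fun l hl => h f hf p hp j l hl

lemma famB {ι : Type} [Fintype ι] {D : ι → (Pt → ℝ) → Pt → ℝ} (hD : Fam D) (n : ℕ) :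
    ∃ C : ℝ, 0 ≤ C ∧ ∀ f, Sm f → ∀ p : Pt, 0 < p.1 → ∀ j, ∀ l w : List (Fin 8), l.length ≤ n →
      |GamWord w (D j (GamWord l f)) p| ≤ C * ∑ i, J (w.length + n) (D i f) p := by
  obtain ⟨c0, hc0, c, hcb, hc⟩ := hD.bd
  induction n with
  | zero =>
    refine ⟨1, zero_le_one, fun f hf p hp j l w hl => ?_⟩
    have : l = [] := by simpa using hl
    subst this
    rw [one_mul]
    exact (le_J (by simp) (D j f) p).trans
      (Finset.single_le_sum (f := fun i => J (w.length + 0) (D i f) p)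
        (fun _ _ => J_nonneg _ _ _) (Finset.mem_univ j))
  | succ n ih =>
    obtain ⟨C, hC, ih⟩ := ih
    refine ⟨C + (Fintype.card ι * c0) * C, by positivity, fun f hf p hp j l w hl => ?_⟩
    have hJ0 : 0 ≤ ∑ i, J (w.length + (n + 1)) (D i f) p :=
      Finset.sum_nonneg fun _ _ => J_nonneg _ _ _
    have hJm : ∑ i, J (w.length + n) (D i f) p ≤ ∑ i, J (w.length + (n + 1)) (D i f) p :=
      Finset.sum_le_sum fun i _ => J_mono (by omega) _ _
    have hx : 0 ≤ (Fintype.card ι * c0) * C * ∑ i, J (w.length + (n + 1)) (D i f) p := by positivity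
    cases l with
    | nil =>
      have h1 := ih f hf p hp j [] w (by simp)
      have : C * ∑ i, J (w.length + n) (D i f) p ≤ C * ∑ i, J (w.length + (n + 1)) (D i f) p := by
        gcongr
      nlinarith
    | cons k l =>
      have hl' : l.length ≤ n := by simpa using hl
      have hφ := hf.GamWord l
      set φ := GamWord l f with hφdef
      have heq : EqU (D j (Gam k φ)) (Gam k (D j φ) + (-1 : ℝ) • ∑ i, c k j i • D i φ) := by
        intro q hq
        have := hc k j φ hφ q hq
        simp only [Pi.add_apply, Pi.smul_apply, smul_eq_mul] at this ⊢
        linarith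
      have hss : Sm (∑ i, c k j i • D i φ) := Sm.sum fun i _ => (hD.sm i φ hφ).smul _
      show |GamWord w (D j (Gam k φ)) p| ≤ _
      rw [heq.GamWord w p hp, GamWord_add ((hD.sm j φ hφ).Gam k) (hss.smul _) w p hp,
        Pi.add_apply, GamWord_smul hss _ w p hp, Pi.smul_apply,
        GamWord_sum (fun i _ => (hD.sm i φ hφ).smul _) w p hp, Finset.sum_apply, ← GamWord_snoc]
      have h1 := ih f hf p hp j l (w ++ [k]) hl'
      have e1 : (w ++ [k]).length + n = w.length + (n + 1) := by simp; omega
      rw [e1] at h1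
      have h3 : |∑ i, GamWord w (c k j i • D i φ) p|
          ≤ (Fintype.card ι * c0) * (C * ∑ i, J (w.length + n) (D i f) p) := by
        refine (Finset.abs_sum_le_sum_abs _ _).trans ?_
        have : ∀ i ∈ (Finset.univ : Finset ι), |GamWord w (c k j i • D i φ) p|
            ≤ c0 * (C * ∑ i, J (w.length + n) (D i f) p) := by
          intro i _
          rw [GamWord_smul (hD.sm i φ hφ) _ w p hp, Pi.smul_apply, smul_eq_mul, abs_mul]
          exact mul_le_mul (hcb k j i) (ih f hf p hp i l w hl') (abs_nonneg _) hc0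
        have := Finset.sum_le_card_nsmul _ _ _ this
        simpa [mul_assoc] using this
      refine (abs_add_le _ _).trans ?_
      rw [smul_eq_mul, neg_one_mul, abs_neg]
      have h5 : (Fintype.card ι * c0) * (C * ∑ i, J (w.length + n) (D i f) p)
          ≤ (Fintype.card ι * c0) * (C * ∑ i, J (w.length + (n + 1)) (D i f) p) := by gcongr
      nlinarith

lemma fam_Dop : Fam Dop where
  sm j f hf := hf.Dop j
  comm := ⟨fun k a b => -cc k a b, fun k a _ hf p hp => Gam_Dop hf k a p hp⟩

lemma Gam_Dop2 {f : Pt → ℝ} (hf : Sm f) (k : Fin 8) (a b : Fin 4) (p : Pt) (hp : 0 < p.1) :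
    Gam k (Dop a (Dop b f)) p = Dop a (Dop b (Gam k f)) p
      + ∑ c, (-cc k b c) * Dop a (Dop c f) p + ∑ c, (-cc k a c) * Dop c (Dop b f) p := by
  rw [Gam_Dop (hf.Dop b) k a p hp]
  have h : EqU (Gam k (Dop b f)) (Dop b (Gam k f) + ∑ c, (-cc k b c) • Dop c f) := by
    intro q hq; rw [Gam_Dop hf k b q hq]; simp
  have hs : ∀ c ∈ (Finset.univ : Finset (Fin 4)), Sm ((-cc k b c) • Dop c f) :=
    fun c _ => (hf.Dop c).smul _
  rw [h.Dop a p hp, Dop_add ((hf.Gam k).Dop b) (Sm.sum hs) a p hp, Pi.add_apply,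
    Dop_sum hs a p hp, Finset.sum_apply]
  congr 2
  refine Finset.sum_congr rfl fun c _ => ?_
  rw [Dop_smul (hf.Dop c) _ a p hp]; rfl

def DD (ij : Fin 3 × Fin 4) (f : Pt → ℝ) : Pt → ℝ := Dop ij.1.succ (Dop ij.2 f)

lemma cc_succ_zero (k : Fin 8) (i : Fin 3) : cc k i.succ 0 = 0 := by
  fin_cases k <;> fin_cases i <;> simp [cc]

lemma fam_DD : Fam DD where
  sm j f hf := (hf.Dop _).Dop _
  comm := by
    refine ⟨fun k j i => (if j.2 = i.2 then -cc k j.1.succ i.1.succ else 0) +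
      (if j.1 = i.1 then -cc k j.2 i.2 else 0), ?_⟩
    rintro k ⟨i, a⟩ f hf p hp
    unfold DD
    rw [Gam_Dop2 hf k i.succ a p hp, add_assoc]
    congr 1
    rw [Fintype.sum_prod_type]
    simp only [add_mul, Finset.sum_add_distrib, ite_mul, zero_mul, Finset.sum_ite_eq,
      Finset.mem_univ, if_true]
    rw [add_comm]
    congr 1
    · rw [Fin.sum_univ_succ, cc_succ_zero]; simp
    · rw [Finset.sum_comm]; simp

lemma box_eq (f : Pt → ℝ) : box f = Dop 0 (Dop 0 f) + (-1 : ℝ) • ∑ i : Fin 3, DD (i, i.succ) f := by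
  ext p
  simp only [box, Pi.add_apply, Pi.smul_apply, Finset.sum_apply, Fin.sum_univ_three, smul_eq_mul, DD]
  show dt (dt f) p - (dxi 0 (dxi 0 f) p + dxi 1 (dxi 1 f) p + dxi 2 (dxi 2 f) p) =
    dt (dt f) p + -1 * (dxi 0 (dxi 0 f) p + dxi 1 (dxi 1 f) p + dxi 2 (dxi 2 f) p)
  ring

lemma Sm.DD {f : Pt → ℝ} (hf : Sm f) (ij) : Sm (DD ij f) := (hf.Dop _).Dop _

lemma Sm.box {f : Pt → ℝ} (hf : Sm f) : Sm (box f) := by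
  rw [box_eq]
  exact ((hf.Dop 0).Dop 0).add ((Sm.sum fun i _ => hf.DD _).smul _)

lemma Gam_box {f : Pt → ℝ} (hf : Sm f) (k : Fin 8) (p : Pt) (hp : 0 < p.1) :
    Gam k (box f) p = box (Gam k f) p + (if k = 7 then -2 else 0) * box f p := by
  have hs : Sm (∑ i : Fin 3, DD (i, i.succ) f) := Sm.sum fun i _ => hf.DD _
  have h1 : Gam k (box f) p = Gam k (Dop 0 (Dop 0 f)) p
      - ∑ i : Fin 3, Gam k (DD (i, i.succ) f) p := by
    rw [box_eq, Gam_add ((hf.Dop 0).Dop 0) (hs.smul _) k p hp, Pi.add_apply,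
      Gam_smul hs _ k p hp]
    have := GamWord_sum (s := Finset.univ) (f := fun i : Fin 3 => DD (i, i.succ) f)
      (fun i _ => hf.DD _) [k] p hp
    simp only [GamWord, Finset.sum_apply] at this
    rw [Pi.smul_apply, this, smul_eq_mul]; ring
  rw [h1]
  rw [box_eq f, box_eq (Gam k f)]
  have c01 := Dop_comm hf 0 1 p hp
  have c12 := Dop_comm hf 1 2 p hp
  have c13 := Dop_comm hf 1 3 p hp
  have c23 := Dop_comm hf 2 3 p hp
  simp only [DD, Gam_Dop2 hf k _ _ p hp, Pi.add_apply, Pi.smul_apply, Finset.sum_apply,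
    Fin.sum_univ_three, Fin.sum_univ_four, smul_eq_mul]
  have s0 : (0 : Fin 3).succ = 1 := rfl
  have s1 : (1 : Fin 3).succ = 2 := rfl
  have s2 : (2 : Fin 3).succ = 3 := rfl
  rw [s0, s1, s2]
  fin_cases k <;> simp [cc] <;> linarith

lemma fam_box : Fam (fun _ : Unit => box) where
  sm _ f hf := hf.box
  comm := ⟨fun k _ _ => if k = 7 then -2 else 0, fun k _ _ hf p hp => by
    rw [Gam_box hf k p hp]; simp⟩

/-- powers of `1+t` -/
def as (s : ℝ) (p : Pt) : ℝ := (1 + p.1) ^ s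

lemma Sm.as (s : ℝ) : Sm (as s) := by
  intro p hp
  unfold _root_.as
  exact (contDiffAt_const.add contDiffAt_fst).rpow_const_of_ne (by linarith)

lemma Dop_as (s : ℝ) (a : Fin 4) (p : Pt) (hp : 0 < p.1) :
    Dop a (as s) p = if a = 0 then s * as (s - 1) p else 0 := by
  have h : HasFDerivAt (as s) ((s * (1 + p.1) ^ (s - 1)) • ContinuousLinearMap.fst ℝ ℝ E3) p := by
    have h1 : HasFDerivAt (fun q : Pt => 1 + q.1) (ContinuousLinearMap.fst ℝ ℝ E3) p :=
      (ContinuousLinearMap.fst ℝ ℝ E3).hasFDerivAt.const_add 1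
    exact h1.rpow_const (Or.inl (by linarith))
  rw [Dop_eq, h.fderiv]
  fin_cases a <;> simp [e4, as]

lemma Gam_as (s : ℝ) (k : Fin 8) : ∃ u v : ℝ, EqU (Gam k (as s)) (u • as s + v • as (s - 1)) := by
  have key : ∀ p : Pt, 0 < p.1 → Gam k (as s) p = coef k 0 p * (s * as (s - 1) p) := by
    intro p hp
    rw [Gam_eq]
    simp [Dop_as s _ p hp]
  have h7 : ∀ p : Pt, 0 < p.1 → p.1 * as (s - 1) p = as s p - as (s - 1) p := by
    intro p hp
    have : as s p = (1 + p.1) * as (s - 1) p := by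
      unfold as
      rw [rpow_sub_one (by linarith)]
      field_simp
    rw [this]; ring
  have hz : ∀ p : Pt, coef k 0 p = if k = 0 then 1 else if k = 7 then p.1 else 0 := by
    intro p
    fin_cases k <;> simp [coef, cc, cd, y4, Fin.sum_univ_four]
  by_cases h0 : k = 0
  · refine ⟨0, s, fun p hp => ?_⟩
    rw [key p hp, hz]; simp [h0]
  by_cases h1 : k = 7
  · refine ⟨s, -s, fun p hp => ?_⟩
    rw [key p hp, hz]; simp [h1]
    linear_combination s * h7 p hp
  · refine ⟨0, 0, fun p hp => ?_⟩
    rw [key p hp, hz]; simp [h0, h1]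

lemma as_pos (s : ℝ) {p : Pt} (hp : 0 < p.1) : 0 < as s p := rpow_pos_of_pos (by linarith) _

lemma as_mono {s s' : ℝ} (h : s ≤ s') {p : Pt} (hp : 0 < p.1) : as s p ≤ as s' p :=
  rpow_le_rpow_of_exponent_le (by linarith) h

lemma word_as (l : List (Fin 8)) : ∀ s : ℝ, ∃ C : ℝ, 0 ≤ C ∧ ∀ p : Pt, 0 < p.1 →
    |GamWord l (as s) p| ≤ C * as s p := by
  induction l using List.reverseRecOn with
  | nil =>
    intro s
    refine ⟨1, zero_le_one, fun p hp => ?_⟩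
    show |as s p| ≤ _
    rw [abs_of_pos (as_pos s hp), one_mul]
  | append_singleton l k ih =>
    intro s
    obtain ⟨u, v, huv⟩ := Gam_as s k
    obtain ⟨C, hC, h⟩ := ih s
    obtain ⟨C', hC', h'⟩ := ih (s - 1)
    refine ⟨|u| * C + |v| * C', by positivity, fun p hp => ?_⟩
    rw [GamWord_snoc, huv.GamWord l p hp,
      GamWord_add ((Sm.as s).smul u) ((Sm.as (s-1)).smul v) l p hp, Pi.add_apply,
      GamWord_smul (Sm.as s) u l p hp, GamWord_smul (Sm.as (s-1)) v l p hp]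
    refine (abs_add_le _ _).trans ?_
    simp only [Pi.smul_apply, smul_eq_mul, abs_mul]
    have h1 := mul_le_mul_of_nonneg_left (h p hp) (abs_nonneg u)
    have h2 := mul_le_mul_of_nonneg_left (h' p hp) (abs_nonneg v)
    have h3 : |v| * (C' * as (s - 1) p) ≤ |v| * (C' * as s p) := by
      have := as_mono (show s - 1 ≤ s by linarith) hp
      gcongr
    linarith

lemma J_as (m : ℕ) (s : ℝ) : ∃ C : ℝ, 0 ≤ C ∧ ∀ p : Pt, 0 < p.1 → J m (as s) p ≤ C * as s p := by
  choose C hC h using fun l => word_as l s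
  refine ⟨∑ l ∈ words m, C l, Finset.sum_nonneg fun l _ => hC l, fun p hp => ?_⟩
  rw [Finset.sum_mul]
  exact Finset.sum_le_sum fun l _ => h l p hp

lemma J_as_mul (m : ℕ) (s : ℝ) : ∃ C : ℝ, 0 ≤ C ∧ ∀ f, Sm f → ∀ p : Pt, 0 < p.1 →
    J m (as s * f) p ≤ C * (as s p * J m f p) := by
  obtain ⟨C1, h1, h⟩ := leibniz1 m
  obtain ⟨C2, h2, h'⟩ := J_as m s
  refine ⟨C1 * C2, by positivity, fun f hf p hp => ?_⟩
  refine (h _ _ (Sm.as s) hf p hp).trans ?_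
  have := mul_le_mul_of_nonneg_right (h' p hp) (J_nonneg m f p)
  nlinarith

def EE (lam : ℝ) (m : ℕ) (f : Pt → ℝ) (p : Pt) : ℝ :=
  J m f p + as lam p * ∑ a, J m (Dop a f) p

def GG (m : ℕ) (f : Pt → ℝ) (p : Pt) : ℝ := ∑ ij, J m (DD ij f) p

lemma EE_nonneg (lam : ℝ) (m : ℕ) (f : Pt → ℝ) {p : Pt} (hp : 0 < p.1) : 0 ≤ EE lam m f p :=
  add_nonneg (J_nonneg _ _ _) (mul_nonneg (as_pos _ hp).le
    (Finset.sum_nonneg fun _ _ => J_nonneg _ _ _))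

lemma GG_nonneg (m : ℕ) (f : Pt → ℝ) (p : Pt) : 0 ≤ GG m f p :=
  Finset.sum_nonneg fun _ _ => J_nonneg _ _ _

lemma J_le_EE (lam : ℝ) (m : ℕ) (f : Pt → ℝ) {p : Pt} (hp : 0 < p.1) : J m f p ≤ EE lam m f p :=
  le_add_of_nonneg_right (mul_nonneg (as_pos _ hp).le
    (Finset.sum_nonneg fun _ _ => J_nonneg _ _ _))

lemma JD_le_EE (lam : ℝ) (m : ℕ) (f : Pt → ℝ) {p : Pt} (hp : 0 < p.1) (a : Fin 4) :
    as lam p * J m (Dop a f) p ≤ EE lam m f p := by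
  have : J m (Dop a f) p ≤ ∑ a, J m (Dop a f) p :=
    Finset.single_le_sum (f := fun a => J m (Dop a f) p) (fun _ _ => J_nonneg _ _ _)
      (Finset.mem_univ a)
  have h2 := mul_le_mul_of_nonneg_left this (as_pos lam hp).le
  have := J_nonneg m f p
  unfold EE; linarith

lemma JDD_le_GG (m : ℕ) (f : Pt → ℝ) (p : Pt) (ij) : J m (DD ij f) p ≤ GG m f p :=
  Finset.single_le_sum (f := fun a => J m (DD a f) p) (fun _ _ => J_nonneg _ _ _)
      (Finset.mem_univ ij)

def ET (lam : ℝ) (m : ℕ) (F : (Pt → ℝ) → Pt → ℝ) : Prop :=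
  (∀ f, Sm f → Sm (F f)) ∧ ∃ c : ℝ, 0 ≤ c ∧ ∀ f, Sm f → ∀ p : Pt, 0 < p.1 → EE lam m f p ≤ 1 →
    J m (F f) p ≤ c * EE lam m f p ∧ J (m + 1) (F f) p ≤ c * EE lam (m + 1) f p

def qq (lam : ℝ) (m : ℕ) (f : Pt → ℝ) (p : Pt) : ℝ :=
  as (-(2 * lam)) p * EE lam (m + 1) f p + EE lam m f p * GG (m + 1) f p
    + EE lam (m + 1) f p * GG 0 f p

def QT (lam : ℝ) (m : ℕ) (F : (Pt → ℝ) → Pt → ℝ) : Prop :=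
  (∀ f, Sm f → Sm (F f)) ∧ ∃ c : ℝ, 0 ≤ c ∧ ∀ f, Sm f → ∀ p : Pt, 0 < p.1 → EE lam m f p ≤ 1 →
    J (m + 1) (F f) p ≤ c * qq lam m f p

lemma ET.psi (lam : ℝ) (m : ℕ) : ET lam m (fun f => f) :=
  ⟨fun _ h => h, 1, zero_le_one, fun f _ p hp _ => by
    simp only [one_mul]; exact ⟨J_le_EE _ _ _ hp, J_le_EE _ _ _ hp⟩⟩

lemma ET.h (lam : ℝ) (m : ℕ) (a : Fin 4) : ET lam m (fun f => as lam * Dop a f) := by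
  obtain ⟨C, hC, h⟩ := J_as_mul m lam
  obtain ⟨C', hC', h'⟩ := J_as_mul (m + 1) lam
  refine ⟨fun f hf => (Sm.as _).mul (hf.Dop a), C + C', by positivity, fun f hf p hp _ => ?_⟩
  have h1 := h _ (hf.Dop a) p hp
  have h2 := h' _ (hf.Dop a) p hp
  have h3 := mul_le_mul_of_nonneg_left (JD_le_EE lam m f hp a) hC
  have h4 := mul_le_mul_of_nonneg_left (JD_le_EE lam (m + 1) f hp a) hC'
  have h5 := EE_nonneg lam m f hp
  have h6 := EE_nonneg lam (m + 1) f hp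
  constructor <;> nlinarith [mul_nonneg hC h5, mul_nonneg hC' h5, mul_nonneg hC h6, mul_nonneg hC' h6]

lemma ET.add {lam : ℝ} {m : ℕ} {F G} (hF : ET lam m F) (hG : ET lam m G) :
    ET lam m (fun f => F f + G f) := by
  obtain ⟨sF, c, hc, h⟩ := hF
  obtain ⟨sG, c', hc', h'⟩ := hG
  refine ⟨fun f hf => (sF f hf).add (sG f hf), c + c', by positivity, fun f hf p hp hE => ?_⟩
  obtain ⟨h1, h2⟩ := h f hf p hp hE
  obtain ⟨h3, h4⟩ := h' f hf p hp hE
  have := J_add (m := m) (sF f hf) (sG f hf) hp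
  have := J_add (m := m + 1) (sF f hf) (sG f hf) hp
  constructor <;> linarith

lemma ET.smul {lam : ℝ} {m : ℕ} {F} (hF : ET lam m F) (u : ℝ) :
    ET lam m (fun f => u • F f) := by
  obtain ⟨sF, c, hc, h⟩ := hF
  refine ⟨fun f hf => (sF f hf).smul u, |u| * c, by positivity, fun f hf p hp hE => ?_⟩
  obtain ⟨h1, h2⟩ := h f hf p hp hE
  rw [J_smul (sF f hf) u hp, J_smul (sF f hf) u hp, mul_assoc, mul_assoc]
  exact ⟨mul_le_mul_of_nonneg_left h1 (abs_nonneg _), mul_le_mul_of_nonneg_left h2 (abs_nonneg _)⟩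

lemma ET.mul {lam : ℝ} {m : ℕ} {F G} (hF : ET lam m F) (hG : ET lam m G) :
    ET lam m (fun f => F f * G f) := by
  obtain ⟨sF, c, hc, h⟩ := hF
  obtain ⟨sG, c', hc', h'⟩ := hG
  obtain ⟨C1, hC1, l1⟩ := leibniz1 m
  obtain ⟨C2, hC2, l2⟩ := leibniz2 m
  refine ⟨fun f hf => (sF f hf).mul (sG f hf), C1 * (c * c') + C2 * (2 * (c * c')), by positivity,
    fun f hf p hp hE => ?_⟩
  obtain ⟨h1, h2⟩ := h f hf p hp hE
  obtain ⟨h3, h4⟩ := h' f hf p hp hE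
  have k1 := l1 _ _ (sF f hf) (sG f hf) p hp
  have k2 := l2 _ _ (sF f hf) (sG f hf) p hp
  have e0 := EE_nonneg lam m f hp
  have e1 := EE_nonneg lam (m + 1) f hp
  have h0 : J 0 (G f) p ≤ c' * EE lam m f p := (J_mono (Nat.zero_le m) _ _).trans h3
  have m1 : J m (F f) p * J m (G f) p ≤ (c * c') * EE lam m f p := by
    calc _ ≤ (c * EE lam m f p) * (c' * EE lam m f p) :=
          mul_le_mul h1 h3 (J_nonneg _ _ _) (by positivity)
      _ = (c * c') * EE lam m f p * EE lam m f p := by ring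
      _ ≤ (c * c') * EE lam m f p * 1 := by gcongr
      _ = _ := by ring
  have m2 : J m (F f) p * J (m + 1) (G f) p ≤ (c * c') * EE lam (m + 1) f p := by
    calc _ ≤ (c * EE lam m f p) * (c' * EE lam (m + 1) f p) :=
          mul_le_mul h1 h4 (J_nonneg _ _ _) (by positivity)
      _ = (c * c') * EE lam (m + 1) f p * EE lam m f p := by ring
      _ ≤ (c * c') * EE lam (m + 1) f p * 1 := by gcongr
      _ = _ := by ring
  have m3 : J (m + 1) (F f) p * J 0 (G f) p ≤ (c * c') * EE lam (m + 1) f p := by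
    calc _ ≤ (c * EE lam (m + 1) f p) * (c' * EE lam m f p) :=
          mul_le_mul h2 h0 (J_nonneg _ _ _) (by positivity)
      _ = (c * c') * EE lam (m + 1) f p * EE lam m f p := by ring
      _ ≤ (c * c') * EE lam (m + 1) f p * 1 := by gcongr
      _ = _ := by ring
  constructor
  · calc _ ≤ C1 * ((c * c') * EE lam m f p) := k1.trans (by gcongr)
      _ ≤ _ := by
        have : 0 ≤ C2 * (2 * (c * c')) * EE lam m f p := by positivity
        nlinarith
  · calc _ ≤ C2 * ((c * c') * EE lam (m + 1) f p + (c * c') * EE lam (m + 1) f p) :=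
          k2.trans (by gcongr)
      _ ≤ _ := by
        have : 0 ≤ C1 * (c * c') * EE lam (m + 1) f p := by positivity
        nlinarith

lemma ET.as {lam : ℝ} {m : ℕ} {F} (hF : ET lam m F) {s : ℝ} (hs : s ≤ 0) :
    ET lam m (fun f => as s * F f) := by
  obtain ⟨sF, c, hc, h⟩ := hF
  obtain ⟨C, hC, l1⟩ := J_as_mul m s
  obtain ⟨C', hC', l2⟩ := J_as_mul (m + 1) s
  refine ⟨fun f hf => (Sm.as s).mul (sF f hf), (C + C') * c, by positivity, fun f hf p hp hE => ?_⟩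
  obtain ⟨h1, h2⟩ := h f hf p hp hE
  have k1 := l1 _ (sF f hf) p hp
  have k2 := l2 _ (sF f hf) p hp
  have a1 : _root_.as s p ≤ 1 := by
    have := as_mono hs hp
    simpa [_root_.as] using this
  have e0 := EE_nonneg lam m f hp
  have e1 := EE_nonneg lam (m + 1) f hp
  have q1 : _root_.as s p * J m (F f) p ≤ 1 * (c * EE lam m f p) :=
    mul_le_mul a1 h1 (J_nonneg _ _ _) zero_le_one
  have q2 : _root_.as s p * J (m + 1) (F f) p ≤ 1 * (c * EE lam (m + 1) f p) :=
    mul_le_mul a1 h2 (J_nonneg _ _ _) zero_le_one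
  have r1 := mul_le_mul_of_nonneg_left q1 hC
  have r2 := mul_le_mul_of_nonneg_left q2 hC'
  have z1 : 0 ≤ C' * (c * EE lam m f p) := by positivity
  have z2 : 0 ≤ C * (c * EE lam (m + 1) f p) := by positivity
  constructor <;> nlinarith

lemma qq_nonneg (lam : ℝ) (m : ℕ) (f : Pt → ℝ) {p : Pt} (hp : 0 < p.1) : 0 ≤ qq lam m f p := by
  have e0 := EE_nonneg lam m f hp
  have e1 := EE_nonneg lam (m + 1) f hp
  have g0 := GG_nonneg 0 f p
  have g1 := GG_nonneg (m + 1) f p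
  have := as_pos (-(2 * lam)) hp
  unfold qq; positivity

lemma QT.add {lam : ℝ} {m : ℕ} {F G} (hF : QT lam m F) (hG : QT lam m G) :
    QT lam m (fun f => F f + G f) := by
  obtain ⟨sF, c, hc, h⟩ := hF
  obtain ⟨sG, c', hc', h'⟩ := hG
  refine ⟨fun f hf => (sF f hf).add (sG f hf), c + c', by positivity, fun f hf p hp hE => ?_⟩
  have h2 := h f hf p hp hE
  have h4 := h' f hf p hp hE
  have := J_add (m := m + 1) (sF f hf) (sG f hf) hp
  linarith

lemma QT.smul {lam : ℝ} {m : ℕ} {F} (hF : QT lam m F) (u : ℝ) :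
    QT lam m (fun f => u • F f) := by
  obtain ⟨sF, c, hc, h⟩ := hF
  refine ⟨fun f hf => (sF f hf).smul u, |u| * c, by positivity, fun f hf p hp hE => ?_⟩
  have h2 := h f hf p hp hE
  rw [J_smul (sF f hf) u hp, mul_assoc]
  exact mul_le_mul_of_nonneg_left h2 (abs_nonneg _)

lemma ET.toQT {lam : ℝ} {m : ℕ} {F} (hF : ET lam m F) {s : ℝ} (hs : s ≤ -(2 * lam)) :
    QT lam m (fun f => _root_.as s * F f) := by
  obtain ⟨sF, c, hc, h⟩ := hF
  obtain ⟨C', hC', l2⟩ := J_as_mul (m + 1) s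
  refine ⟨fun f hf => (Sm.as s).mul (sF f hf), C' * c, by positivity, fun f hf p hp hE => ?_⟩
  obtain ⟨h1, h2⟩ := h f hf p hp hE
  have k2 := l2 _ (sF f hf) p hp
  have a1 := as_mono hs hp
  have e0 := EE_nonneg lam m f hp
  have e1 := EE_nonneg lam (m + 1) f hp
  have g0 := GG_nonneg 0 f p
  have g1 := GG_nonneg (m + 1) f p
  have q2 : _root_.as s p * J (m + 1) (F f) p
      ≤ _root_.as (-(2 * lam)) p * (c * EE lam (m + 1) f p) :=
    mul_le_mul a1 h2 (J_nonneg _ _ _) (as_pos _ hp).le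
  have r2 := mul_le_mul_of_nonneg_left q2 hC'
  have z : 0 ≤ C' * c * (EE lam m f p * GG (m + 1) f p + EE lam (m + 1) f p * GG 0 f p) := by
    positivity
  unfold qq
  nlinarith

lemma ET.mulDD {lam : ℝ} {m : ℕ} {F} (hF : ET lam m F) (ij : Fin 3 × Fin 4) :
    QT lam m (fun f => F f * DD ij f) := by
  obtain ⟨sF, c, hc, h⟩ := hF
  obtain ⟨C2, hC2, l2⟩ := leibniz2 m
  refine ⟨fun f hf => (sF f hf).mul (hf.DD ij), C2 * c, by positivity, fun f hf p hp hE => ?_⟩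
  obtain ⟨h1, h2⟩ := h f hf p hp hE
  have k2 := l2 _ _ (sF f hf) (hf.DD ij) p hp
  have e0 := EE_nonneg lam m f hp
  have e1 := EE_nonneg lam (m + 1) f hp
  have m2 : J m (F f) p * J (m + 1) (DD ij f) p ≤ (c * EE lam m f p) * GG (m + 1) f p :=
    mul_le_mul h1 (JDD_le_GG _ _ _ _) (J_nonneg _ _ _) (by positivity)
  have m3 : J (m + 1) (F f) p * J 0 (DD ij f) p ≤ (c * EE lam (m + 1) f p) * GG 0 f p :=
    mul_le_mul h2 (JDD_le_GG _ _ _ _) (J_nonneg _ _ _) (by positivity)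
  have z : 0 ≤ C2 * c * (_root_.as (-(2 * lam)) p * EE lam (m + 1) f p) := by
    have := as_pos (-(2 * lam)) hp
    positivity
  have r := mul_le_mul_of_nonneg_left (add_le_add m2 m3) hC2.le
  unfold qq
  nlinarith

lemma QT.sum3 {lam : ℝ} {m : ℕ} {F : Fin 3 → (Pt → ℝ) → Pt → ℝ} (hF : ∀ i, QT lam m (F i)) :
    QT lam m (fun f => F 0 f + F 1 f + F 2 f) := ((hF 0).add (hF 1)).add (hF 2)

lemma ET.sum3 {lam : ℝ} {m : ℕ} {F : Fin 3 → (Pt → ℝ) → Pt → ℝ} (hF : ∀ i, ET lam m (F i)) :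
    ET lam m (fun f => F 0 f + F 1 f + F 2 f) := ((hF 0).add (hF 1)).add (hF 2)

/-- pointwise bound of the commuted wave operator -/
lemma box_bound (μ lam γ : ℝ) (hlam0 : 0 ≤ lam) (hlam1 : lam ≤ 1) (m : ℕ) :
    ∃ c : ℝ, 0 ≤ c ∧ ∀ f, Sm f → psiEq μ lam γ f → ∀ p : Pt, 0 < p.1 → EE lam m f p ≤ 1 →
      J (m + 1) (box f) p ≤ c * qq lam m f p := by
  let hh : Fin 4 → (Pt → ℝ) → Pt → ℝ := fun a f => as lam * Dop a f
  have eh : ∀ a, ET lam m (hh a) := fun a => ET.h lam m a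
  have eh2 : ∀ i : Fin 3, ET lam m (fun f => hh i.succ f * hh i.succ f) := fun i =>
    (eh _).mul (eh _)
  have eV := ((((eh 0).add (((ET.psi lam m).as (s := lam - 1) (by linarith)).smul lam)).add
    ((ET.psi lam m).smul μ)).add ((ET.sum3 eh2).smul (1 / 2))).smul (-(γ - 1))
  have t1 := ((eh 0).toQT (s := -(2 * lam)) le_rfl).smul (-μ)
  have t2 := ((eh 0).toQT (s := -1 - lam) (by linarith)).smul (-2 * lam)
  have t3 := ((ET.psi lam m).toQT (s := -2) (by linarith)).smul (lam * (1 - lam))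
  have t4 := QT.sum3 fun i : Fin 3 => eV.mulDD (i, i.succ)
  have t5 := (QT.sum3 fun i : Fin 3 => (eh i.succ).mulDD (i, 0)).smul (-2)
  have t6 := (QT.sum3 fun i : Fin 3 => (eh2 i).toQT (s := -1 - lam) (by linarith)).smul (-2 * lam)
  have t7 := (QT.sum3 fun i : Fin 3 => (eh2 i).toQT (s := -(2 * lam)) le_rfl).smul (-μ)
  have t8 := (QT.sum3 fun i : Fin 3 => QT.sum3 fun j : Fin 3 =>
    ((eh i.succ).mul (eh j.succ)).mulDD (i, j.succ)).smul (-1)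
  obtain ⟨-, c, hc, H⟩ := ((((((t1.add t2).add t3).add t4).add t5).add t6).add t7).add t8
  refine ⟨c, hc, fun f hf hpsi p hp hE => ?_⟩
  refine le_trans (le_of_eq ?_) (H f hf p hp hE)
  refine J_congr (fun q hq => ?_) hp
  have hq1 : 0 < 1 + q.1 := by linarith
  have h := hpsi q hq.le
  have X0 : (1 + q.1) ^ lam ≠ 0 := (rpow_pos_of_pos hq1 _).ne'
  have r1 : as (-(2 * lam)) q = ((1 + q.1) ^ lam * (1 + q.1) ^ lam)⁻¹ := by
    unfold as; rw [rpow_neg hq1.le, two_mul, rpow_add hq1]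
  have r2 : as (-1 - lam) q = ((1 + q.1) * (1 + q.1) ^ lam)⁻¹ := by
    unfold as; rw [show -1 - lam = -(1 + lam) by ring, rpow_neg hq1.le, rpow_add hq1, rpow_one]
  have r3 : as (-2) q = ((1 + q.1) ^ 2)⁻¹ := by
    unfold as; rw [rpow_neg hq1.le]; norm_cast
  have r4 : (1 + q.1) ^ (lam - 1) = (1 + q.1) ^ lam / (1 + q.1) := rpow_sub_one hq1.ne' _
  have r5 : (1 + q.1) ^ (2 * lam) = (1 + q.1) ^ lam * (1 + q.1) ^ lam := by
    rw [two_mul, rpow_add hq1]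
  have r6 : as (lam - 1) q = (1 + q.1) ^ lam / (1 + q.1) := r4
  have r7 : as lam q = (1 + q.1) ^ lam := rfl
  have s0 : (0 : Fin 3).succ = 1 := rfl
  have s1 : (1 : Fin 3).succ = 2 := rfl
  have s2 : (2 : Fin 3).succ = 3 := rfl
  have d0 : ∀ g : Pt → ℝ, Dop 0 g = dt g := fun _ => rfl
  have d1 : ∀ g : Pt → ℝ, Dop 1 g = dxi 0 g := fun _ => rfl
  have d2 : ∀ g : Pt → ℝ, Dop 2 g = dxi 1 g := fun _ => rfl
  have d3 : ∀ g : Pt → ℝ, Dop 3 g = dxi 2 g := fun _ => rfl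
  simp only [Qpsi, csq, Fin.sum_univ_three, r4, r5] at h
  simp only [hh, DD, Pi.add_apply, Pi.mul_apply, Pi.smul_apply, smul_eq_mul, r1, r2, r3, r6, r7, s0,
    s1, s2, d0, d1, d2, d3]
  have hb : box f q = Qpsi μ lam γ f q - μ / (1 + q.1) ^ lam * dt f q
      - 2 * lam / (1 + q.1) * dt f q + lam * (1 - lam) / (1 + q.1) ^ 2 * f q := by
    have := hpsi q hq.le; linarith
  rw [hb]
  simp only [Qpsi, csq, Fin.sum_univ_three, r4, r5]
  generalize (1 + q.1) ^ lam = X at *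
  generalize 1 + q.1 = T at *
  field_simp
  ring

lemma oneD {F F1 F2 H : ℝ → ℝ} (h1 : ∀ s, HasDerivAt F (F1 s) s) (h2 : ∀ s, HasDerivAt F1 (F2 s) s)
    (c2 : Continuous F2) (cH : Continuous H)
    (b0 : ∀ s ∈ Icc (0:ℝ) 1, |F s| ≤ H s) (b1 : ∀ s ∈ Icc (0:ℝ) 1, |F1 s| ≤ H s)
    (b2 : ∀ s ∈ Icc (0:ℝ) 1, |F2 s| ≤ H s) :
    (F 0)^2 ≤ 49 * ∫ s in (0:ℝ)..1, s^2 * (H s)^2 := by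
  have cF : Continuous F := continuous_iff_continuousAt.2 fun s => (h1 s).continuousAt
  have cF1 : Continuous F1 := continuous_iff_continuousAt.2 fun s => (h2 s).continuousAt
  set G2 : ℝ → ℝ := fun s => s * (2 * F s - 4 * (1 - s) * F1 s + (1-s)^2 * F2 s) with hG2
  have hW : ∀ s, HasDerivAt (fun s => s * (-(2 * (1 - s)) * F s + (1-s)^2 * F1 s) - (1-s)^2 * F s) (G2 s) s := by
    intro s
    have hs : HasDerivAt (fun s : ℝ => 1 - s) (-1) s := by simpa using (hasDerivAt_id s).const_sub 1
    have := ((hasDerivAt_id s).mul ((((hs.const_mul 2).neg).mul (h1 s)).add ((hs.pow 2).mul (h2 s)))).sub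
      ((hs.pow 2).mul (h1 s))
    refine HasDerivAt.congr_deriv this ?_
    simp only [hG2, Pi.add_apply, Pi.mul_apply, Pi.pow_apply, Pi.neg_apply, id]
    push_cast
    ring
  have cG : Continuous G2 := by fun_prop
  have hI := intervalIntegral.integral_eq_sub_of_hasDerivAt (a := 0) (b := 1) (fun s _ => hW s)
    (cG.intervalIntegrable _ _)
  have hF0 : F 0 = ∫ s in (0:ℝ)..1, G2 s := by rw [hI]; simp
  set c := F 0
  have hcs : 0 ≤ ∫ s in (0:ℝ)..1, (G2 s - c)^2 :=
    intervalIntegral.integral_nonneg (by norm_num) (fun s _ => sq_nonneg _)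
  have hexp : ∫ s in (0:ℝ)..1, (G2 s - c)^2 = (∫ s in (0:ℝ)..1, (G2 s)^2) - 2 * c * c + c^2 := by
    have : ∀ s, (G2 s - c)^2 = (G2 s)^2 - (2*c) * G2 s + c^2 := fun s => by ring
    simp_rw [this]
    rw [intervalIntegral.integral_add, intervalIntegral.integral_sub, intervalIntegral.integral_const_mul, ← hF0]
    · simp
    all_goals exact Continuous.intervalIntegrable (by fun_prop) _ _
  have hle : ∫ s in (0:ℝ)..1, (G2 s)^2 ≤ ∫ s in (0:ℝ)..1, 49 * (s^2 * (H s)^2) := by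
    apply intervalIntegral.integral_mono_on (by norm_num)
    · exact Continuous.intervalIntegrable (by fun_prop) _ _
    · exact Continuous.intervalIntegrable (by fun_prop) _ _
    intro s hs
    have hH : 0 ≤ H s := (abs_nonneg _).trans (b0 s hs)
    have : |2 * F s - 4 * (1 - s) * F1 s + (1-s)^2 * F2 s| ≤ 7 * H s := by
      have e0 := b0 s hs; have e1 := b1 s hs; have e2 := b2 s hs
      have i1 : |2 * F s| ≤ 2 * H s := by rw [abs_mul]; norm_num; linarith
      have i2 : |4 * (1 - s) * F1 s| ≤ 4 * H s := by
        rw [abs_mul, abs_of_nonneg (by linarith [hs.2])]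
        exact mul_le_mul (by linarith [hs.1]) e1 (abs_nonneg _) (by norm_num)
      have i3 : |(1 - s)^2 * F2 s| ≤ 1 * H s := by
        rw [abs_mul, abs_of_nonneg (sq_nonneg _)]
        exact mul_le_mul (by nlinarith [hs.1, hs.2]) e2 (abs_nonneg _) (by norm_num)
      calc _ ≤ |2 * F s - 4 * (1 - s) * F1 s| + |(1-s)^2 * F2 s| := abs_add_le _ _
        _ ≤ |2 * F s| + |4 * (1 - s) * F1 s| + |(1-s)^2 * F2 s| := by gcongr; exact abs_sub _ _
        _ ≤ _ := by linarith
    have h3 : (2 * F s - 4 * (1 - s) * F1 s + (1-s)^2 * F2 s)^2 ≤ (7 * H s)^2 := sq_le_sq.2 (by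
      rw [abs_of_nonneg (by positivity : 0 ≤ 7 * H s)]; exact this)
    simp only [hG2]
    calc _ = s^2 * (2 * F s - 4 * (1 - s) * F1 s + (1-s)^2 * F2 s)^2 := by ring
      _ ≤ s^2 * (7 * H s)^2 := by gcongr
      _ = _ := by ring
  rw [intervalIntegral.integral_const_mul] at hle
  nlinarith

lemma oneD' {F F1 F2 H : ℝ → ℝ} (h1 : ∀ s, HasDerivAt F (F1 s) s) (h2 : ∀ s, HasDerivAt F1 (F2 s) s)
    (c2 : Continuous F2) (cH : Continuous H)
    (b0 : ∀ s ∈ Icc (0:ℝ) 1, |F s| ≤ H s) (b1 : ∀ s ∈ Icc (0:ℝ) 1, |F1 s| ≤ H s)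
    (b2 : ∀ s ∈ Icc (0:ℝ) 1, |F2 s| ≤ H s) :
    ENNReal.ofReal ((F 0)^2) ≤ ∫⁻ s in Ioo (0:ℝ) 1, ENNReal.ofReal (s^2) * ENNReal.ofReal (49 * (H s)^2) := by
  have h := oneD h1 h2 c2 cH b0 b1 b2
  rw [← intervalIntegral.integral_const_mul, intervalIntegral.integral_of_le (by norm_num),
    integral_Ioc_eq_integral_Ioo] at h
  refine (ENNReal.ofReal_le_ofReal h).trans ?_
  rw [ofReal_integral_eq_lintegral_ofReal]
  · apply le_of_eq
    congr 1; ext s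
    rw [← ENNReal.ofReal_mul (sq_nonneg s)]; congr 1; ring
  · have : Continuous fun s => 49 * (s^2 * (H s)^2) := by fun_prop
    exact (this.integrableOn_Icc (a := 0) (b := 1)).mono_set Ioo_subset_Icc_self
  · exact Filter.Eventually.of_forall fun s => by positivity

lemma ray {c : ENNReal} {k : ℝ × ℝ → ENNReal} (hk : Measurable k)
    (h : ∀ η ∈ Ioo (π/6) (5*π/6), c ≤ ∫⁻ s in Ioo (0:ℝ) 1, ENNReal.ofReal (s^2) * k (s * cos η, s * sin η)) :
    c ≤ ∫⁻ y in {y : ℝ × ℝ | 0 < y.2 ∧ y.1^2 + y.2^2 < 1}, ENNReal.ofReal y.2 * k y := by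
  have hms : MeasurableSet {y : ℝ × ℝ | 0 < y.2 ∧ y.1^2 + y.2^2 < 1} := by
    apply MeasurableSet.inter
    · exact measurableSet_lt measurable_const measurable_snd
    · exact measurableSet_lt (f := fun y : ℝ × ℝ => y.1^2 + y.2^2) (by fun_prop) measurable_const
  rw [← lintegral_indicator hms, ← lintegral_comp_polarCoord_symm]
  have hsub : (Ioo (0:ℝ) 1 ×ˢ Ioo (π/6) (5*π/6)) ⊆ polarCoord.target := by
    rintro ⟨s, η⟩ ⟨⟨h1, h2⟩, h3, h4⟩
    rw [polarCoord_target]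
    have := pi_pos
    exact ⟨h1, by constructor <;> simp at * <;> linarith⟩
  refine le_trans ?_ (lintegral_mono_set hsub)
  calc c ≤ ∫⁻ η in Ioo (π/6) (5*π/6), ENNReal.ofReal (1/2) * c := by
        simp only [lintegral_const, Measure.restrict_apply MeasurableSet.univ, univ_inter, Real.volume_Ioo]
        rw [mul_right_comm, ← ENNReal.ofReal_mul (by norm_num)]
        nth_rewrite 1 [← one_mul c]
        gcongr
        rw [← ENNReal.ofReal_one]
        apply ENNReal.ofReal_le_ofReal
        linarith [pi_gt_three]
    _ ≤ ∫⁻ η in Ioo (π/6) (5*π/6), ENNReal.ofReal (1/2) * ∫⁻ s in Ioo (0:ℝ) 1, ENNReal.ofReal (s^2) * k (s * cos η, s * sin η) := by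
        apply setLIntegral_mono' measurableSet_Ioo
        intro η hη
        gcongr
        exact h η hη
    _ = ∫⁻ p in (Ioo (0:ℝ) 1 ×ˢ Ioo (π/6) (5*π/6)), ENNReal.ofReal (1/2) * (ENNReal.ofReal (p.1^2) * k (p.1 * cos p.2, p.1 * sin p.2)) := by
        rw [Measure.volume_eq_prod, ← Measure.prod_restrict, lintegral_prod_symm]
        · congr 1; ext η
          rw [lintegral_const_mul]
          fun_prop
        · apply Measurable.aemeasurable; fun_prop
    _ ≤ _ := by
        apply setLIntegral_mono' (measurableSet_Ioo.prod measurableSet_Ioo)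
        rintro ⟨s, η⟩ ⟨⟨h1, h2⟩, h3, h4⟩
        simp only at h1 h2 h3 h4
        have hsin : 1/2 ≤ sin η := by
          have hp := pi_pos
          rw [← sin_pi_div_six]
          rcases le_total η (π/2) with h | h
          · exact sin_le_sin_of_le_of_le_pi_div_two (by linarith) h h3.le
          · rw [← sin_pi_sub η]
            exact sin_le_sin_of_le_of_le_pi_div_two (by linarith) (by linarith) (by linarith)
        have hmem : (s * cos η, s * sin η) ∈ {y : ℝ × ℝ | 0 < y.2 ∧ y.1^2 + y.2^2 < 1} := by
          refine ⟨by positivity, ?_⟩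
          have : (s * cos η)^2 + (s * sin η)^2 = s^2 := by
            have := sin_sq_add_cos_sq η; linear_combination s^2 * this
          simp only [this]; nlinarith
        simp only [polarCoord_symm_apply, indicator_of_mem hmem, smul_eq_mul]
        rw [← mul_assoc, ← mul_assoc, ← ENNReal.ofReal_mul (by norm_num), ← ENNReal.ofReal_mul h1.le]
        refine mul_le_mul' (ENNReal.ofReal_le_ofReal ?_) le_rfl
        nlinarith [sq_nonneg s]

lemma meas3 : Measurable fun q : ℝ × ℝ × ℝ => (!₂[q.1, q.2.1, q.2.2] : E3) := by
  refine (EuclideanSpace.volume_preserving_symm_measurableEquiv_toLp (Fin 3)).symm.measurable.comp ?_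
  refine measurable_pi_lambda _ fun i => ?_
  fin_cases i <;> simp <;> fun_prop

lemma fub3 {k : E3 → ENNReal} (hk : Measurable k) :
    ∫⁻ x, k x = ∫⁻ X : ℝ, ∫⁻ q : ℝ × ℝ, k !₂[X, q.1, q.2] := by
  have h1 := (EuclideanSpace.volume_preserving_symm_measurableEquiv_toLp (Fin 3)).symm.lintegral_comp_emb
    (MeasurableEquiv.measurableEmbedding _) k
  rw [← h1]
  have h2 := (volume_preserving_piFinSuccAbove (fun _ : Fin 3 => ℝ) 0).symm
  rw [← h2.lintegral_comp_emb (MeasurableEquiv.measurableEmbedding _)]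
  have h3 := (volume_preserving_finTwoArrow ℝ).symm
  rw [Measure.volume_eq_prod, lintegral_prod]
  · congr 1; ext X
    rw [← h3.lintegral_comp_emb (MeasurableEquiv.measurableEmbedding _)]
    congr 1; ext q
    congr 1
    ext i; fin_cases i <;> rfl
  · exact ((hk.comp (MeasurableEquiv.measurable _)).comp (MeasurableEquiv.measurable _)).aemeasurable

lemma cyl {k : E3 → ENNReal} (hk : Measurable k) :
    ∫⁻ β in Ioo (-π) π, ∫⁻ y in {y : ℝ × ℝ | 0 < y.2}, ENNReal.ofReal y.2 * k !₂[y.1, y.2 * cos β, y.2 * sin β]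
      = ∫⁻ x, k x := by
  rw [fub3 hk]
  have hset : {y : ℝ × ℝ | 0 < y.2} = univ ×ˢ Ioi 0 := by ext; simp
  have h3 := hk.comp meas3
  have h4 : Measurable fun z : ℝ × ℝ × ℝ => ENNReal.ofReal z.2.1 * k !₂[z.1, z.2.1 * cos z.2.2, z.2.1 * sin z.2.2] := by
    have : Measurable fun z : ℝ × ℝ × ℝ => (z.1, z.2.1 * cos z.2.2, z.2.1 * sin z.2.2) := by fun_prop
    exact (by fun_prop : Measurable fun z : ℝ × ℝ × ℝ => ENNReal.ofReal z.2.1).mul (h3.comp this)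
  have hL : ∀ β, ∫⁻ y in {y : ℝ × ℝ | 0 < y.2}, ENNReal.ofReal y.2 * k !₂[y.1, y.2 * cos β, y.2 * sin β]
     = ∫⁻ X : ℝ, ∫⁻ r in Ioi (0:ℝ), ENNReal.ofReal r * k !₂[X, r * cos β, r * sin β] := by
    intro β
    rw [hset, Measure.volume_eq_prod, ← Measure.prod_restrict, Measure.restrict_univ, lintegral_prod]
    have : Measurable fun y : ℝ × ℝ => (y.1, y.2, β) := by fun_prop
    exact (h4.comp this).aemeasurable
  simp_rw [hL]
  have hR : ∀ X : ℝ, ∫⁻ q : ℝ × ℝ, k !₂[X, q.1, q.2]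
     = ∫⁻ β in Ioo (-π) π, ∫⁻ r in Ioi (0:ℝ), ENNReal.ofReal r * k !₂[X, r * cos β, r * sin β] := by
    intro X
    rw [← lintegral_comp_polarCoord_symm, polarCoord_target, Measure.volume_eq_prod, ← Measure.prod_restrict,
      lintegral_prod_symm]
    · simp only [polarCoord_symm_apply, smul_eq_mul]
    · have : Measurable fun y : ℝ × ℝ => (X, y.1, y.2) := by fun_prop
      exact (h4.comp this).aemeasurable
  simp_rw [hR]
  rw [lintegral_lintegral_swap]
  apply Measurable.aemeasurable
  have := Measurable.lintegral_prod_right' (ν := volume.restrict (Ioi (0:ℝ)))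
    (f := fun z : (ℝ × ℝ) × ℝ => ENNReal.ofReal z.2 * k !₂[z.1.2, z.2 * cos z.1.1, z.2 * sin z.1.1]) (by
      have : Measurable fun z : (ℝ × ℝ) × ℝ => (z.1.2, z.2, z.1.1) := by fun_prop
      exact h4.comp this)
  exact this

lemma cyl' {k : E3 → ENNReal} (hk : Measurable k) (x0 : E3) (A : E3 ≃ₗᵢ[ℝ] E3) :
    ∫⁻ β in Ioo (-π) π, ∫⁻ y in {y : ℝ × ℝ | 0 < y.2}, ENNReal.ofReal y.2 * k (x0 + A !₂[y.1, y.2 * cos β, y.2 * sin β])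
      = ∫⁻ x, k x := by
  rw [cyl (k := fun x => k (x0 + A x))]
  · have h1 := A.measurePreserving.lintegral_comp (f := fun x => k (x0 + x)) (by fun_prop)
    rw [h1]
    exact lintegral_add_left_eq_self k x0
  · exact hk.comp (A.continuous.measurable.const_add x0)

lemma exA (x0 : E3) : ∃ A : E3 ≃ₗᵢ[ℝ] E3, x0 = A (!₂[‖x0‖, 0, 0]) := by
  by_cases h0 : x0 = 0
  · refine ⟨LinearIsometryEquiv.refl ℝ _, ?_⟩
    subst h0; ext i; fin_cases i <;> simp
  set v : Fin 3 → E3 := fun _ => (‖x0‖)⁻¹ • x0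
  have hv : Orthonormal ℝ (({0} : Set (Fin 3)).domRestrict v) := by
    constructor
    · rintro ⟨i, hi⟩
      simp [v, norm_smul, h0, Set.domRestrict]
    · rintro ⟨i, hi⟩ ⟨j, hj⟩ hij
      simp at hi hj; subst hi hj; simp at hij
  obtain ⟨b, hb⟩ := hv.exists_orthonormalBasis_extension_of_card_eq (by simp)
  refine ⟨b.repr.symm, ?_⟩
  have h1 := hb 0 (by simp)
  have : (!₂[‖x0‖, 0, 0] : E3) = ‖x0‖ • EuclideanSpace.single 0 1 := by
    ext i; fin_cases i <;> simp
  rw [this, map_smul, OrthonormalBasis.repr_symm_single, h1]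
  simp [v, smul_smul, h0]

lemma Sm.contx {f : Pt → ℝ} (hf : Sm f) {t : ℝ} (ht : 0 < t) : Continuous fun x : E3 => f (t, x) :=
  continuous_iff_continuousAt.2 fun x =>
    ((hf (t, x) ht).continuousAt).comp (f := fun x : E3 => ((t, x) : Pt)) (by fun_prop)

lemma Sm.contJ {f : Pt → ℝ} (hf : Sm f) (m : ℕ) {t : ℝ} (ht : 0 < t) :
    Continuous fun x : E3 => J m f (t, x) := by
  unfold J
  exact continuous_finsetSum _ fun l _ => ((hf.GamWord l).contx ht).abs

lemma curve {t : ℝ} (ht : 0 < t) {f : Pt → ℝ} (hf : Sm f) {Φ Φ' : ℝ → E3} {c c' : Fin 8 → ℝ → ℝ}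
    (hc : ∀ k s, HasDerivAt (c k) (c' k s) s) (cc' : ∀ k, Continuous (c' k))
    (bc : ∀ k s, |c k s| ≤ 2) (bc' : ∀ k s, |c' k s| ≤ 2)
    (hΦ : ∀ s, HasDerivAt Φ (Φ' s) s)
    (hv : ∀ s, ((0, Φ' s) : Pt) = ∑ k, c k s • ∑ b, coef k b (t, Φ s) • e4 b) :
    ENNReal.ofReal ((f (t, Φ 0))^2) ≤
      ∫⁻ s in Ioo (0:ℝ) 1, ENNReal.ofReal (s^2) * ENNReal.ofReal (49 * (272 * J 2 f (t, Φ s))^2) := by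
  have hd : ∀ g, Sm g → ∀ s, HasDerivAt (fun s => g (t, Φ s)) (∑ k, c k s * Gam k g (t, Φ s)) s := by
    intro g hg s
    have h1 : HasDerivAt (fun s => ((t, Φ s) : Pt)) (0, Φ' s) s := (hasDerivAt_const s t).prodMk (hΦ s)
    have h2 := (hg.diff (p := (t, Φ s)) ht).hasFDerivAt.comp_hasDerivAt s h1
    refine HasDerivAt.congr_deriv h2 ?_
    rw [hv, map_sum]
    refine Finset.sum_congr rfl fun k _ => ?_
    rw [map_smul, map_sum, Gam_eq, smul_eq_mul]
    congr 1
    refine Finset.sum_congr rfl fun b _ => ?_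
    rw [map_smul, Dop_eq, smul_eq_mul]
  have cΦ : Continuous Φ := continuous_iff_continuousAt.2 fun s => (hΦ s).continuousAt
  have ccc : ∀ k, Continuous (c k) := fun k => continuous_iff_continuousAt.2 fun s => (hc k s).continuousAt
  have cg : ∀ g, Sm g → Continuous fun s => g (t, Φ s) := fun g hg => (hg.contx ht).comp cΦ
  have hw1 : ∀ k s, |Gam k f (t, Φ s)| ≤ J 2 f (t, Φ s) := fun k s =>
    le_J (l := [k]) (by simp) f _
  have hw2 : ∀ j k s, |Gam j (Gam k f) (t, Φ s)| ≤ J 2 f (t, Φ s) := fun j k s =>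
    le_J (l := [j, k]) (by simp) f _
  refine oneD' (F := fun s => f (t, Φ s)) (F1 := fun s => ∑ k, c k s * Gam k f (t, Φ s))
    (F2 := fun s => ∑ k, (c' k s * Gam k f (t, Φ s) + c k s * ∑ j, c j s * Gam j (Gam k f) (t, Φ s)))
    (H := fun s => 272 * J 2 f (t, Φ s)) (hd f hf) ?_ ?_ ?_ ?_ ?_ ?_
  · intro s
    exact HasDerivAt.fun_sum fun k _ => (hc k s).mul (hd _ (hf.Gam k) s)
  · refine continuous_finsetSum _ fun k _ => ?_
    refine ((cc' k).mul (cg _ (hf.Gam k))).add ((ccc k).mul ?_)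
    exact continuous_finsetSum _ fun j _ => (ccc j).mul (cg _ ((hf.Gam k).Gam j))
  · exact continuous_const.mul ((hf.contJ 2 ht).comp cΦ)
  · intro s _
    have := abs_le_J 2 f (t, Φ s); have := J_nonneg 2 f (t, Φ s); linarith
  · intro s _
    have h0 := J_nonneg 2 f (t, Φ s)
    calc |∑ k, c k s * Gam k f (t, Φ s)| ≤ ∑ k, |c k s * Gam k f (t, Φ s)| := Finset.abs_sum_le_sum_abs _ _
      _ ≤ ∑ k : Fin 8, 2 * J 2 f (t, Φ s) := by
        refine Finset.sum_le_sum fun k _ => ?_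
        rw [abs_mul]; exact mul_le_mul (bc k s) (hw1 k s) (abs_nonneg _) (by norm_num)
      _ ≤ _ := by simp; linarith
  · intro s _
    have h0 := J_nonneg 2 f (t, Φ s)
    refine (Finset.abs_sum_le_sum_abs _ _).trans ?_
    calc _ ≤ ∑ k : Fin 8, (2 * J 2 f (t, Φ s) + 2 * ∑ j : Fin 8, 2 * J 2 f (t, Φ s)) := by
          refine Finset.sum_le_sum fun k _ => (abs_add_le _ _).trans (add_le_add ?_ ?_)
          · rw [abs_mul]; exact mul_le_mul (bc' k s) (hw1 k s) (abs_nonneg _) (by norm_num)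
          · rw [abs_mul]
            refine mul_le_mul (bc k s) ?_ (abs_nonneg _) (by norm_num)
            refine (Finset.abs_sum_le_sum_abs _ _).trans (Finset.sum_le_sum fun j _ => ?_)
            rw [abs_mul]; exact mul_le_mul (bc j s) (hw2 j k s) (abs_nonneg _) (by norm_num)
      _ ≤ _ := by simp; linarith

lemma coord_le (x : E3) (i : Fin 3) : |x i| ≤ ‖x‖ := by
  simpa using PiLp.norm_apply_le x i

lemma pt_ext {p q : Pt} (h0 : p.1 = q.1) (h : ∀ i, p.2 i = q.2 i) : p = q :=
  Prod.ext h0 (by ext i; exact h i)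

lemma curve1 {t : ℝ} (ht : 0 < t) {f : Pt → ℝ} (hf : Sm f) (x0 v : E3) (hv : ‖v‖ = 1) :
    ENNReal.ofReal ((f (t, x0))^2) ≤
      ∫⁻ s in Ioo (0:ℝ) 1, ENNReal.ofReal (s^2) * ENNReal.ofReal (49 * (272 * J 2 f (t, x0 + s • v))^2) := by
  have hb : ∀ i, |v i| ≤ 2 := fun i => (coord_le v i).trans (by linarith)
  have := curve ht hf (Φ := fun s => x0 + s • v) (Φ' := fun s => v)
    (c := ![fun _ => 0, fun _ => v 0, fun _ => v 1, fun _ => v 2, fun _ => 0, fun _ => 0, fun _ => 0, fun _ => 0])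
    (c' := fun _ _ => 0) (by intro k s; fin_cases k <;> exact hasDerivAt_const _ _)
    (fun _ => continuous_const) (by intro k s; fin_cases k <;> simp [hb]) (by simp)
    (by
      intro s
      have := ((hasDerivAt_id s).smul_const v).const_add x0
      simpa using this)
    (by
      intro s
      refine pt_ext ?_ ?_
      · simp [Fin.sum_univ_succ, coef, cd, cc, e4]
      · intro i; fin_cases i <;> simp [Fin.sum_univ_succ, coef, cd, cc, e4])
  simpa using this

lemma curve2 {t : ℝ} (ht : 0 < t) {f : Pt → ℝ} (hf : Sm f) (R η : ℝ) (e m : E3)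
    (he : e 0 ^2 + e 1 ^2 + e 2 ^2 = 1) (hm : m 0 ^2 + m 1 ^2 + m 2 ^2 = 1)
    (hem : e 0 * m 0 + e 1 * m 1 + e 2 * m 2 = 0) :
    ENNReal.ofReal ((f (t, R • e))^2) ≤
      ∫⁻ s in Ioo (0:ℝ) 1, ENNReal.ofReal (s^2) * ENNReal.ofReal (49 * (272 * J 2 f (t,
        (R + s * cos η) • (cos (s * sin η) • e + sin (s * sin η) • m)))^2) := by
  have hbe : ∀ i, |e i| ≤ 1 := by
    intro i; rw [abs_le_one_iff_mul_self_le_one]; fin_cases i <;> simp <;> nlinarith [sq_nonneg (e 0), sq_nonneg (e 1), sq_nonneg (e 2)]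
  have hbm : ∀ i, |m i| ≤ 1 := by
    intro i; rw [abs_le_one_iff_mul_self_le_one]; fin_cases i <;> simp <;> nlinarith [sq_nonneg (m 0), sq_nonneg (m 1), sq_nonneg (m 2)]
  have mul1 : ∀ {a b : ℝ}, |a| ≤ 1 → |b| ≤ 1 → |a * b| ≤ 1 := by
    intro a b ha hb; rw [abs_mul]; exact mul_le_one₀ ha (abs_nonneg _) hb
  have hcs := abs_cos_le_one
  have hsn := abs_sin_le_one
  have hb1 : ∀ s i, |cos η * (cos (s * sin η) * e i + sin (s * sin η) * m i)| ≤ 2 := by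
    intro s i
    rw [mul_add]
    exact (abs_add_le _ _).trans (by linarith [mul1 (hcs η) (mul1 (hcs (s * sin η)) (hbe i)), mul1 (hcs η) (mul1 (hsn (s * sin η)) (hbm i))])
  have hb2 : ∀ s i, |cos η * sin η * (-sin (s * sin η) * e i + cos (s * sin η) * m i)| ≤ 2 := by
    intro s i
    rw [mul_add]
    have h1 : |-sin (s * sin η)| ≤ 1 := by rw [abs_neg]; exact hsn _
    exact (abs_add_le _ _).trans (by linarith [mul1 (mul1 (hcs η) (hsn η)) (mul1 h1 (hbe i)), mul1 (mul1 (hcs η) (hsn η)) (mul1 (hcs (s * sin η)) (hbm i))])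
  have hb3 : ∀ i j, |sin η * (e i * m j - e j * m i)| ≤ 2 := by
    intro i j
    rw [mul_sub]
    exact (abs_sub _ _).trans (by linarith [mul1 (hsn η) (mul1 (hbe i) (hbm j)), mul1 (hsn η) (mul1 (hbe j) (hbm i))])
  have hθ : ∀ s, HasDerivAt (fun s : ℝ => s * sin η) (sin η) s := fun s => by
    simpa using (hasDerivAt_id s).mul_const (sin η)
  have hcd : ∀ i s, HasDerivAt (fun s => cos η * (cos (s * sin η) * e i + sin (s * sin η) * m i))
      (cos η * sin η * (-sin (s * sin η) * e i + cos (s * sin η) * m i)) s := by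
    intro i s
    refine HasDerivAt.congr_deriv ((((hθ s).cos.mul_const (e i)).add ((hθ s).sin.mul_const (m i))).const_mul (cos η)) ?_
    ring
  have := curve ht hf (Φ := fun s => (R + s * cos η) • (cos (s * sin η) • e + sin (s * sin η) • m))
    (Φ' := fun s => (cos η) • (cos (s * sin η) • e + sin (s * sin η) • m) +
      (R + s * cos η) • ((-sin (s * sin η) * sin η) • e + (cos (s * sin η) * sin η) • m))
    (c := ![fun _ => 0, fun s => cos η * (cos (s * sin η) * e 0 + sin (s * sin η) * m 0),
      fun s => cos η * (cos (s * sin η) * e 1 + sin (s * sin η) * m 1),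
      fun s => cos η * (cos (s * sin η) * e 2 + sin (s * sin η) * m 2),
      fun _ => sin η * (e 1 * m 2 - e 2 * m 1), fun _ => sin η * (e 2 * m 0 - e 0 * m 2),
      fun _ => sin η * (e 0 * m 1 - e 1 * m 0), fun _ => 0])
    (c' := ![fun _ => 0, fun s => cos η * sin η * (-sin (s * sin η) * e 0 + cos (s * sin η) * m 0),
      fun s => cos η * sin η * (-sin (s * sin η) * e 1 + cos (s * sin η) * m 1),
      fun s => cos η * sin η * (-sin (s * sin η) * e 2 + cos (s * sin η) * m 2),
      fun _ => 0, fun _ => 0, fun _ => 0, fun _ => 0])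
    (by intro k s; fin_cases k <;> first | exact hasDerivAt_const _ _ | exact hcd _ s)
    (by intro k; fin_cases k <;> simp <;> fun_prop)
    (by intro k s; fin_cases k <;> first | exact hb1 _ _ | exact hb3 _ _ | simp)
    (by intro k s; fin_cases k <;> first | exact hb2 _ _ | simp)
    (by
      intro s
      have h1 : HasDerivAt (fun s => R + s * cos η) (cos η) s := by
        simpa using ((hasDerivAt_id s).mul_const (cos η)).const_add R
      have := h1.smul (((hθ s).cos.smul_const e).add ((hθ s).sin.smul_const m))
      refine HasDerivAt.congr_deriv this ?_
      simp only [Pi.add_apply]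
      rw [add_comm])
    (by
      intro s
      refine pt_ext ?_ ?_
      · simp [Fin.sum_univ_succ, coef, cd, cc, e4]
      · intro i
        set C := cos (s * sin η)
        set S := sin (s * sin η)
        fin_cases i <;> simp [Fin.sum_univ_succ, coef, cd, cc, e4, y4]
        · linear_combination (-((R + s * cos η) * sin η * C * m 0)) * he + ((R + s * cos η) * sin η * S * e 0) * hm + ((R + s * cos η) * sin η * (C * e 0 - S * m 0)) * hem
        · linear_combination (-((R + s * cos η) * sin η * C * m 1)) * he + ((R + s * cos η) * sin η * S * e 1) * hm + ((R + s * cos η) * sin η * (C * e 1 - S * m 1)) * hem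
        · linear_combination (-((R + s * cos η) * sin η * C * m 2)) * he + ((R + s * cos η) * sin η * S * e 2) * hm + ((R + s * cos η) * sin η * (C * e 2 - S * m 2)) * hem)
  simpa using this

def kJ (t : ℝ) (f : Pt → ℝ) (x : E3) : ENNReal := ENNReal.ofReal (49 * (272 * J 2 f (t, x))^2)

lemma kJ_meas {t : ℝ} (ht : 0 < t) {f : Pt → ℝ} (hf : Sm f) : Measurable (kJ t f) := by
  have : Continuous fun x : E3 => 49 * (272 * J 2 f (t, x))^2 := by
    have := hf.contJ 2 ht
    fun_prop
  exact this.measurable.ennreal_ofReal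

lemma avg {c : ENNReal} {g : ℝ → ENNReal} (h : ∀ β, c ≤ g β) : c ≤ ∫⁻ β in Ioo (-π) π, g β := by
  calc c ≤ ∫⁻ β in Ioo (-π) π, c := by
        simp only [lintegral_const, Measure.restrict_apply MeasurableSet.univ, univ_inter, Real.volume_Ioo]
        nth_rewrite 1 [← mul_one c]
        gcongr
        rw [← ENNReal.ofReal_one]
        apply ENNReal.ofReal_le_ofReal
        linarith [pi_gt_three]
    _ ≤ _ := lintegral_mono h

lemma cosin (β : ℝ) : cos β ^ 2 + sin β ^ 2 = 1 := cos_sq_add_sin_sq β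

lemma sob1 {t : ℝ} (ht : 0 < t) {f : Pt → ℝ} (hf : Sm f) (x0 : E3) :
    ENNReal.ofReal ((f (t, x0))^2) ≤ ∫⁻ x, kJ t f x := by
  rw [← cyl' (kJ_meas ht hf) x0 (LinearIsometryEquiv.refl ℝ _)]
  refine avg fun β => ?_
  have hm : Measurable fun y : ℝ × ℝ => kJ t f (x0 + !₂[y.1, y.2 * cos β, y.2 * sin β]) := by
    refine (kJ_meas ht hf).comp (Measurable.const_add ?_ x0)
    exact meas3.comp (by fun_prop : Measurable fun y : ℝ × ℝ => (y.1, y.2 * cos β, y.2 * sin β))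
  refine (ray hm ?_).trans (lintegral_mono_set fun y hy => hy.1)
  intro η _
  have hv : ‖(!₂[cos η, sin η * cos β, sin η * sin β] : E3)‖ = 1 := by
    rw [EuclideanSpace.norm_eq, Real.sqrt_eq_one]
    simp [Fin.sum_univ_succ, -cos_sq_add_sin_sq, -sin_sq_add_cos_sq]
    linear_combination (sin η)^2 * cosin β + cosin η
  refine (curve1 ht hf x0 _ hv).trans (le_of_eq ?_)
  congr 1; ext s
  have : s • (!₂[cos η, sin η * cos β, sin η * sin β] : E3) = !₂[s * cos η, s * sin η * cos β, s * sin η * sin β] := by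
    ext i; fin_cases i <;> simp [mul_assoc]
  unfold kJ
  rw [this]

lemma sob2 {t : ℝ} (ht : 0 < t) {f : Pt → ℝ} (hf : Sm f) (x0 : E3) (hR : 2 ≤ ‖x0‖) :
    ENNReal.ofReal ((f (t, x0))^2) ≤ ENNReal.ofReal (8 / ‖x0‖^2) * ∫⁻ x, kJ t f x := by
  obtain ⟨A, hA⟩ := exA x0
  set R := ‖x0‖
  rw [← cyl' (kJ_meas ht hf) 0 A, ← lintegral_const_mul' _ _ ENNReal.ofReal_ne_top]
  refine avg fun β => ?_
  set e := A !₂[1, 0, 0] with he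
  set m := A !₂[0, cos β, sin β] with hm
  have hin : ∀ x y : E3, A x 0 * A y 0 + A x 1 * A y 1 + A x 2 * A y 2 = x 0 * y 0 + x 1 * y 1 + x 2 * y 2 := by
    intro x y
    have := A.inner_map_map x y
    simp only [PiLp.inner_apply, Fin.sum_univ_three, RCLike.inner_apply, conj_trivial] at this
    linarith
  have hlin : ∀ a b : ℝ, a • e + b • m = A !₂[a, b * cos β, b * sin β] := by
    intro a b
    rw [he, hm, ← map_smul, ← map_smul, ← map_add]
    congr 1; ext i; fin_cases i <;> simp
  have hx0 : R • e = x0 := by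
    rw [hA]; have := hlin R 0; simpa using this
  have hm2 : Measurable fun y : ℝ × ℝ => kJ t f ((R + y.1) • (cos y.2 • e + sin y.2 • m)) := by
    refine (kJ_meas ht hf).comp ?_
    fun_prop
  have h1 := ray (c := ENNReal.ofReal ((f (t, x0))^2)) hm2 ?_
  · refine h1.trans ?_
    have hms : MeasurableSet {y : ℝ × ℝ | 0 < y.2 ∧ y.1^2 + y.2^2 < 1} := by
      apply MeasurableSet.inter
      · exact measurableSet_lt measurable_const measurable_snd
      · exact measurableSet_lt (f := fun y : ℝ × ℝ => y.1^2 + y.2^2) (by fun_prop) measurable_const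
    have hms2 : MeasurableSet {y : ℝ × ℝ | 0 < y.2} := measurableSet_lt measurable_const measurable_snd
    conv_rhs => rw [← lintegral_indicator hms2, ← lintegral_comp_polarCoord_symm,
      ← lintegral_const_mul' _ _ ENNReal.ofReal_ne_top,
      ← lintegral_indicator polarCoord.open_target.measurableSet,
      ← lintegral_add_left_eq_self _ ((R, 0) : ℝ × ℝ)]
    rw [← lintegral_indicator hms]
    refine lintegral_mono fun y => ?_
    by_cases hy : y ∈ {y : ℝ × ℝ | 0 < y.2 ∧ y.1^2 + y.2^2 < 1}
    · rw [indicator_of_mem hy]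
      obtain ⟨hy1, hy2⟩ := hy
      have hy3 : y.2 < 1 := by nlinarith [sq_nonneg y.1]
      have hy4 : -1 < y.1 := by nlinarith [sq_nonneg y.2]
      have hpos : 0 < R + y.1 := by linarith
      have hs : y.2 ≤ 2 * sin y.2 := by
        have := mul_le_sin hy1.le (by linarith [pi_gt_three])
        have h2 : (1:ℝ)/2 ≤ 2/π := by
          rw [div_le_div_iff₀ (by norm_num) pi_pos]; linarith [pi_le_four]
        nlinarith
      have hsp : 0 < sin y.2 := by linarith
      have hmem : ((R, 0) + y : ℝ × ℝ) ∈ polarCoord.target := by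
        rw [polarCoord_target]
        have := pi_gt_three
        exact ⟨by simpa using hpos, by constructor <;> simp <;> linarith⟩
      rw [indicator_of_mem hmem]
      have hmem2 : polarCoord.symm ((R, 0) + y) ∈ {y : ℝ × ℝ | 0 < y.2} := by
        simp [polarCoord_symm_apply]; positivity
      rw [indicator_of_mem hmem2, hlin, ← map_smul]
      have hveq : (R + y.1) • (!₂[cos y.2, sin y.2 * cos β, sin y.2 * sin β] : E3) = !₂[(R + y.1) * cos y.2, (R + y.1) * sin y.2 * cos β, (R + y.1) * sin y.2 * sin β] := by
        ext i; fin_cases i <;> simp [mul_assoc]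
      simp only [polarCoord_symm_apply, Prod.fst_add, Prod.snd_add, zero_add, smul_eq_mul, hveq]
      rw [← mul_assoc, ← mul_assoc, ← ENNReal.ofReal_mul (by positivity), ← ENNReal.ofReal_mul (by positivity)]
      refine mul_le_mul' (ENNReal.ofReal_le_ofReal ?_) le_rfl
      have hR0 : 0 < R := by linarith
      have : R^2 / 4 ≤ (R + y.1)^2 := by nlinarith
      calc y.2 ≤ 2 * sin y.2 := hs
        _ = 8 / R^2 * (R^2/4) * sin y.2 := by field_simp; ring
        _ ≤ 8 / R^2 * (R + y.1)^2 * sin y.2 := by gcongr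
        _ = _ := by ring
    · rw [indicator_of_notMem hy]; exact zero_le
  · intro η _
    rw [← hx0]
    have := curve2 ht hf R η e m ?_ ?_ ?_
    · exact this
    · have := hin !₂[1,0,0] !₂[1,0,0]; simp at this; rw [he]; linarith
    · have := hin !₂[0,cos β,sin β] !₂[0,cos β,sin β]; simp at this; rw [hm]; nlinarith [cosin β]
    · have := hin !₂[1,0,0] !₂[0,cos β,sin β]; simp at this; rw [he, hm]; linarith

lemma sob {t : ℝ} (ht : 0 < t) {f : Pt → ℝ} (hf : Sm f) (hi : Integrable fun x : E3 => (J 2 f (t, x))^2) (x0 : E3) :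
    (1 + ‖x0‖)^2 * (f (t, x0))^2 ≤ 32 * (49 * 272^2) * ∫ x : E3, (J 2 f (t, x))^2 := by
  have hk : ∫⁻ x, kJ t f x = ENNReal.ofReal ((49 * 272^2) * ∫ x : E3, (J 2 f (t, x))^2) := by
    rw [← integral_const_mul, ofReal_integral_eq_lintegral_ofReal (hi.const_mul _)
      (Filter.Eventually.of_forall fun x => by positivity)]
    congr 1; ext x; unfold kJ; congr 1; ring
  have hpos : 0 ≤ (49 * 272^2) * ∫ x : E3, (J 2 f (t, x))^2 := by
    have : 0 ≤ ∫ x : E3, (J 2 f (t, x))^2 := integral_nonneg fun x => sq_nonneg _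
    positivity
  set I := (49 * 272^2) * ∫ x : E3, (J 2 f (t, x))^2
  have goal : (1 + ‖x0‖)^2 * (f (t, x0))^2 ≤ 32 * I := by
    rcases le_total ‖x0‖ 2 with h | h
    · have := sob1 ht hf x0
      rw [hk, ENNReal.ofReal_le_ofReal_iff hpos] at this
      have h9 : (1 + ‖x0‖)^2 ≤ 9 := by nlinarith [norm_nonneg x0]
      nlinarith [sq_nonneg (f (t, x0))]
    · have := sob2 ht hf x0 h
      rw [hk, ← ENNReal.ofReal_mul (by positivity), ENNReal.ofReal_le_ofReal_iff (by positivity)] at this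
      have hR : 0 < ‖x0‖^2 := by positivity
      have h2 : ‖x0‖^2 * (f (t, x0))^2 ≤ 8 * I := by
        rw [div_mul_eq_mul_div, le_div_iff₀ hR] at this; linarith
      have h9 : (1 + ‖x0‖)^2 ≤ 4 * ‖x0‖^2 := by nlinarith
      nlinarith [sq_nonneg (f (t, x0))]
  linarith

def ww (p : Pt) : ℝ := p.1^2 - (p.2 0^2 + p.2 1^2 + p.2 2^2)
def sg (i : Fin 4) : ℝ := if i = 0 then 1 else -1

lemma ww_norm (p : Pt) : ww p = p.1^2 - ‖p.2‖^2 := by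
  rw [EuclideanSpace.norm_sq_eq]; simp [ww, Fin.sum_univ_succ]; ring

lemma ww_eq : ww = ∑ i, sg i • (y4 i * y4 i) := by
  ext p; simp [ww, Fin.sum_univ_succ, sg, y4]; ring

lemma Sm.ww : Sm ww := by
  rw [ww_eq]; exact Sm.sum fun i _ => ((Sm.y4 i).mul (Sm.y4 i)).smul _

lemma Dop_ww (a : Fin 4) (p : Pt) (hp : 0 < p.1) : Dop a ww p = 2 * sg a * y4 a p := by
  rw [ww_eq, Dop_sum (fun i _ => ((Sm.y4 i).mul (Sm.y4 i)).smul _) a p hp]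
  simp only [Finset.sum_apply]
  have : ∀ i, Dop a (sg i • (y4 i * y4 i)) p = if a = i then 2 * sg a * y4 a p else 0 := by
    intro i
    rw [Dop_smul ((Sm.y4 i).mul (Sm.y4 i)) _ a p hp]
    simp only [Pi.smul_apply, smul_eq_mul]
    rw [Dop_mul (Sm.y4 i) (Sm.y4 i) a p hp]
    simp only [Pi.add_apply, Pi.mul_apply, Dop_y4]
    split_ifs with h
    · subst h; ring
    · ring
  simp [this]

def LL (a : ℝ) (b : Fin 4 → ℝ) (c : ℝ) (p : Pt) : ℝ := a * ww p + ∑ g, b g * y4 g p + c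

lemma Gam_LL (k : Fin 8) (a : ℝ) (b : Fin 4 → ℝ) (c : ℝ) : ∃ a' b' c', EqU (Gam k (LL a b c)) (LL a' b' c') := by
  refine ⟨if k = 7 then 2 * a else 0, fun g => ∑ d, cc k g d * b d + 2 * a * sg g * cd k g, ∑ d, cd k d * b d, ?_⟩
  intro p hp
  have h1 : ∀ i, Dop i (LL a b c) p = 2 * a * sg i * y4 i p + b i := by
    intro i
    have e : LL a b c = a • ww + ∑ g, b g • y4 g + (fun _ => c) := by
      ext p; simp [LL]
    have s1 : Sm (∑ g, b g • y4 g) := Sm.sum fun g _ => (Sm.y4 g).smul _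
    have s2 : Sm (fun _ => c) := fun _ _ => contDiffAt_const
    rw [e, Dop_add ((Sm.ww.smul a).add s1) s2 i p hp, Pi.add_apply, Dop_add (Sm.ww.smul a) s1 i p hp, Pi.add_apply,
      Dop_smul Sm.ww a i p hp, Dop_sum (fun g _ => (Sm.y4 g).smul _) i p hp]
    have h3 : Dop i (fun _ => c) p = 0 := by rw [Dop_eq]; simp
    have h4 : ∀ g, Dop i (b g • y4 g) p = if i = g then b i else 0 := by
      intro g
      rw [Dop_smul (Sm.y4 g) _ i p hp]
      simp only [Pi.smul_apply, smul_eq_mul, Dop_y4]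
      split_ifs with h
      · subst h; ring
      · ring
    simp only [Finset.sum_apply, Pi.smul_apply, smul_eq_mul, Dop_ww i p hp, h3, h4]
    simp; ring
  rw [Gam_eq]
  simp only [h1]
  fin_cases k <;> simp [LL, coef, cc, cd, Fin.sum_univ_succ, sg, y4, ww] <;> ring

lemma word_LL (l : List (Fin 8)) (a : ℝ) (b : Fin 4 → ℝ) (c : ℝ) : ∃ a' b' c', EqU (GamWord l (LL a b c)) (LL a' b' c') := by
  induction l with
  | nil => exact ⟨a, b, c, fun p _ => rfl⟩
  | cons k l ih =>
    obtain ⟨a1, b1, c1, h1⟩ := ih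
    obtain ⟨a2, b2, c2, h2⟩ := Gam_LL k a1 b1 c1
    exact ⟨a2, b2, c2, fun p hp => ((h1.Gam k) p hp).trans (h2 p hp)⟩

lemma J_ww (m : ℕ) : ∃ C : ℝ, 0 ≤ C ∧ ∀ p : Pt, 0 < p.1 → J m ww p ≤ C * (|ww p| + (1 + p.1 + ‖p.2‖)) := by
  have hww : ww = LL 1 0 0 := by ext p; simp [LL]
  have : ∀ l : List (Fin 8), ∃ C : ℝ, 0 ≤ C ∧ ∀ p : Pt, 0 < p.1 → |GamWord l ww p| ≤ C * (|ww p| + (1 + p.1 + ‖p.2‖)) := by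
    intro l
    obtain ⟨a, b, c, h⟩ := word_LL l 1 0 0
    refine ⟨|a| + ∑ g, |b g| + |c|, by positivity, fun p hp => ?_⟩
    rw [hww, h p hp, ← hww]
    have hy : ∀ g, |y4 g p| ≤ 1 + p.1 + ‖p.2‖ := by
      intro g
      have := norm_nonneg p.2
      have := coord_le p.2
      fin_cases g <;> simp [y4]
      · rw [abs_of_pos hp]; linarith
      all_goals linarith [this 0, this 1, this 2]
    set Y := 1 + p.1 + ‖p.2‖
    have hY : 1 ≤ Y := by have := norm_nonneg p.2; simp only [Y]; linarith
    have hW := abs_nonneg (ww p)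
    calc |LL a b c p| ≤ |a * ww p| + |∑ g, b g * y4 g p| + |c| := by
          unfold LL; exact (abs_add_le _ _).trans (by gcongr; exact abs_add_le _ _)
      _ ≤ |a| * (|ww p| + Y) + (∑ g, |b g|) * (|ww p| + Y) + |c| * (|ww p| + Y) := by
          refine add_le_add (add_le_add ?_ ?_) ?_
          · rw [abs_mul]; gcongr; linarith
          · refine (Finset.abs_sum_le_sum_abs _ _).trans ?_
            rw [Finset.sum_mul]
            refine Finset.sum_le_sum fun g _ => ?_
            rw [abs_mul]; gcongr; linarith [hy g]
          · nth_rewrite 1 [← mul_one |c|]; gcongr; linarith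
      _ = _ := by ring
  choose C hC hC2 using this
  refine ⟨∑ l ∈ words m, C l, Finset.sum_nonneg fun l _ => hC l, fun p hp => ?_⟩
  unfold J
  rw [Finset.sum_mul]
  exact Finset.sum_le_sum fun l _ => hC2 l p hp

/-- support property -/
def Sp (M : ℝ) (f : Pt → ℝ) : Prop := ∀ p : Pt, 0 < p.1 → p.1 + M < ‖p.2‖ → f p = 0

lemma Sp.Dop {M : ℝ} {f : Pt → ℝ} (hf : Sp M f) (a : Fin 4) : Sp M (Dop a f) := by
  intro p hp hp2
  have ho : IsOpen {p : Pt | 0 < p.1 ∧ p.1 + M < ‖p.2‖} :=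
    (isOpen_lt continuous_const continuous_fst).inter (isOpen_lt (f := fun p : Pt => p.1 + M) (g := fun p : Pt => ‖p.2‖) (by fun_prop) (by fun_prop))
  have : f =ᶠ[nhds p] 0 := by
    filter_upwards [ho.mem_nhds ⟨hp, hp2⟩] with q hq using hf q hq.1 hq.2
  rw [Dop_eq, this.fderiv_eq]; simp

lemma Sp.Gam {M : ℝ} {f : Pt → ℝ} (hf : Sp M f) (k : Fin 8) : Sp M (Gam k f) := by
  intro p hp hp2
  rw [Gam_eq]
  exact Finset.sum_eq_zero fun b _ => by rw [hf.Dop b p hp hp2, mul_zero]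

lemma Sp.GamWord {M : ℝ} {f : Pt → ℝ} (hf : Sp M f) (l : List (Fin 8)) : Sp M (GamWord l f) := by
  induction l with
  | nil => exact hf
  | cons k l ih => exact ih.Gam k

lemma Sp.J {M : ℝ} {f : Pt → ℝ} (hf : Sp M f) (m : ℕ) : Sp M (J m f) := by
  intro p hp hp2
  exact Finset.sum_eq_zero fun l _ => by rw [hf.GamWord l p hp hp2, abs_zero]

lemma Sp.mulL {M : ℝ} {f : Pt → ℝ} (hf : Sp M f) (g : Pt → ℝ) : Sp M (g * f) := by
  intro p hp hp2; simp [hf p hp hp2]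

lemma int_supp {g : E3 → ℝ} (hg : Continuous g) {B : ℝ} (h : ∀ x, B < ‖x‖ → g x = 0) : Integrable g := by
  refine hg.integrable_of_hasCompactSupport (HasCompactSupport.intro (isCompact_closedBall 0 B) fun x hx => h x ?_)
  simpa using hx

lemma Sp.intJ {M : ℝ} {f : Pt → ℝ} (hs : Sp M f) (hf : Sm f) (m : ℕ) {t : ℝ} (ht : 0 < t) (g : E3 → ℝ) (hg : Continuous g) :
    Integrable fun x : E3 => g x * (_root_.J m f (t, x))^2 := by
  refine int_supp (B := t + M) (hg.mul ((hf.contJ m ht).pow 2)) fun x hx => ?_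
  rw [hs.J m (t, x) ht hx]; simp

/-- weight -/
def W (t : ℝ) (x : E3) : ℝ := 1 + (ww (t, x) / (1 + t))^2

lemma W_cont (t : ℝ) : Continuous (W t) := by unfold W ww; fun_prop
lemma W_one (t : ℝ) (x : E3) : 1 ≤ W t x := by unfold W; nlinarith [sq_nonneg (ww (t, x) / (1 + t))]

lemma wsob (M : ℝ) (hM : 0 < M) : ∃ C : ℝ, 0 ≤ C ∧ ∀ f, Sm f → Sp M f → ∀ t, 0 < t → ∀ x : E3,
    (1 + t)^2 * (f (t, x))^2 ≤ C * ∫ x : E3, W t x * (J 2 f (t, x))^2 := by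
  obtain ⟨C1, hC1, h1⟩ := leibniz1 2
  obtain ⟨C2, hC2, h2⟩ := J_ww 2
  set C0 : ℝ := 32 * (49 * 272^2) with hC0
  refine ⟨8 * (C0 + C0 * (2 * (C1 * C2 * (2 + M))^2)), by positivity, fun f hf hs t ht x => ?_⟩
  set I := ∫ x : E3, W t x * (J 2 f (t, x))^2
  have hT : 0 < 1 + t := by linarith
  have i1 : Integrable fun x : E3 => (J 2 f (t, x))^2 := by simpa using hs.intJ hf 2 ht (fun _ => 1) continuous_const
  have iW : Integrable fun x : E3 => W t x * (J 2 f (t, x))^2 := hs.intJ hf 2 ht _ (W_cont t)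
  have i2 : Integrable fun x : E3 => (J 2 (ww * f) (t, x))^2 := by
    simpa using (hs.mulL ww).intJ (Sm.ww.mul hf) 2 ht (fun _ => 1) continuous_const
  have a1 : (1 + ‖x‖)^2 * (f (t, x))^2 ≤ C0 * I := by
    refine (sob ht hf i1 x).trans ?_
    refine mul_le_mul_of_nonneg_left ?_ (by positivity)
    refine integral_mono i1 iW fun x => ?_
    have := W_one t x
    nlinarith [sq_nonneg (J 2 f (t, x))]
  have a2 : (ww (t, x))^2 * (f (t, x))^2 ≤ (1 + t)^2 * (C0 * (2 * (C1 * C2 * (2 + M))^2) * I) := by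
    have b := sob ht (Sm.ww.mul hf) i2 x
    have b1 : ((ww * f) (t, x))^2 ≤ (1 + ‖x‖)^2 * ((ww * f) (t, x))^2 := by
      have : 1 ≤ (1 + ‖x‖)^2 := by nlinarith [norm_nonneg x]
      nlinarith [sq_nonneg ((ww * f) (t, x))]
    have b2 : ∫ x : E3, (J 2 (ww * f) (t, x))^2 ≤ ∫ x : E3, ((1 + t)^2 * (2 * (C1 * C2 * (2 + M))^2)) * (W t x * (J 2 f (t, x))^2) := by
      refine integral_mono i2 (iW.const_mul _) fun x => ?_
      by_cases hx : t + M < ‖x‖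
      · simp only
        rw [(hs.mulL ww).J 2 (t, x) ht hx, hs.J 2 (t, x) ht hx]; simp
      have hJ := J_nonneg 2 f (t, x)
      have q1 : J 2 (ww * f) (t, x) ≤ C1 * (C2 * (2 + M)) * (|ww (t, x)| + (1 + t)) * J 2 f (t, x) := by
        refine (h1 ww f Sm.ww hf (t, x) ht).trans ?_
        have := h2 (t, x) ht
        have h3 : J 2 ww (t, x) ≤ (C2 * (2 + M)) * (|ww (t, x)| + (1 + t)) := by
          refine this.trans ?_
          rw [mul_assoc]
          refine mul_le_mul_of_nonneg_left ?_ hC2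
          simp only
          push Not at hx
          nlinarith [abs_nonneg (ww (t, x))]
        calc _ ≤ C1 * ((C2 * (2 + M)) * (|ww (t, x)| + (1 + t)) * J 2 f (t, x)) := by gcongr
          _ = _ := by ring
      have hJ2 := J_nonneg 2 (ww * f) (t, x)
      have q2 := pow_le_pow_left₀ hJ2 q1 2
      refine q2.trans ?_
      have e1 : (1+t)^2 * W t x = (1+t)^2 + (ww (t, x))^2 := by unfold W; field_simp
      have e2 : (|ww (t, x)| + (1 + t))^2 ≤ 2 * ((1+t)^2 * W t x) := by
        rw [e1, ← sq_abs (ww (t, x))]; nlinarith [sq_nonneg (|ww (t, x)| - (1 + t))]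
      calc _ = (C1 * C2 * (2 + M))^2 * (J 2 f (t, x))^2 * (|ww (t, x)| + (1 + t))^2 := by ring
        _ ≤ (C1 * C2 * (2 + M))^2 * (J 2 f (t, x))^2 * (2 * ((1+t)^2 * W t x)) := by gcongr
        _ = _ := by ring
    rw [integral_const_mul] at b2
    calc _ = ((ww * f) (t, x))^2 := by simp; ring
      _ ≤ C0 * ∫ x : E3, (J 2 (ww * f) (t, x))^2 := b1.trans b
      _ ≤ C0 * (((1 + t)^2 * (2 * (C1 * C2 * (2 + M))^2)) * I) := by gcongr
      _ = _ := by ring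
  have key : (1+t)^2 * (1+t)^2 ≤ 8 * ((1+t)^2 * (1 + ‖x‖)^2 + (ww (t, x))^2) := by
    rw [ww_norm]
    simp only
    have hx := norm_nonneg x
    rcases le_total ‖x‖ (t/2) with h | h
    · have : 3/4 * t^2 ≤ t^2 - ‖x‖^2 := by nlinarith
      have h5 : (3/4 * t^2)^2 ≤ (t^2 - ‖x‖^2)^2 := by gcongr
      have h6 : 1 ≤ (1 + ‖x‖)^2 := by nlinarith
      have h7 : (1+t)^2 ≤ (1+t)^2 * (1 + ‖x‖)^2 := by nlinarith [sq_nonneg (1+t)]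
      have h8 : 8 * ((1+t)^2 + (3/4 * t^2)^2) - (1+t)^2*(1+t)^2 ≥ 0 := by nlinarith [sq_nonneg (t^2 - 1), sq_nonneg (t^2-t), sq_nonneg t, sq_nonneg (t-1)]
      linarith
    · have : ((1+t)/2)^2 ≤ (1 + ‖x‖)^2 := by gcongr; linarith
      nlinarith [sq_nonneg (1+t), sq_nonneg (t^2 - ‖x‖^2), mul_nonneg (sq_nonneg (1+t)) (sub_nonneg.2 this)]
  have fin : (1+t)^2 * ((1+t)^2 * (f (t, x))^2) ≤ (1+t)^2 * (8 * (C0 + C0 * (2 * (C1 * C2 * (2 + M))^2)) * I) := by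
    have := mul_le_mul_of_nonneg_right key (sq_nonneg (f (t, x)))
    nlinarith [mul_le_mul_of_nonneg_left a1 (sq_nonneg (1+t))]
  exact le_of_mul_le_mul_left fin (by positivity)

def GD (u : Pt → ℝ) (p : Pt) : ℝ := ∑ k, ∑ a, |Gam k (Dop a u) p|

lemma le_GD (u : Pt → ℝ) (p : Pt) (k : Fin 8) (a : Fin 4) : |Gam k (Dop a u) p| ≤ GD u p :=
  (Finset.single_le_sum (f := fun a => |Gam k (Dop a u) p|) (fun _ _ => abs_nonneg _) (Finset.mem_univ a)).trans
    (Finset.single_le_sum (f := fun k => ∑ a, |Gam k (Dop a u) p|)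
      (fun _ _ => Finset.sum_nonneg fun _ _ => abs_nonneg _) (Finset.mem_univ k))

lemma GD_nonneg (u : Pt → ℝ) (p : Pt) : 0 ≤ GD u p := (abs_nonneg _).trans (le_GD u p 0 0)

lemma ks_id {u : Pt → ℝ} (hu : Sm u) {p : Pt} (hp : 0 < p.1) :
    (ww p * DD (0, 0) u p = p.1 * p.2 0 * box u p + p.1 * Gam 7 (Dop 1 u) p + p.1 * Gam 6 (Dop 2 u) p
      - p.1 * Gam 5 (Dop 3 u) p - p.2 0 * Gam 7 (Dop 0 u) p + p.2 1 * Gam 6 (Dop 0 u) p - p.2 2 * Gam 5 (Dop 0 u) p) ∧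
    (ww p * DD (1, 0) u p = p.1 * p.2 1 * box u p + p.1 * Gam 7 (Dop 2 u) p - p.1 * Gam 6 (Dop 1 u) p
      + p.1 * Gam 4 (Dop 3 u) p - p.2 1 * Gam 7 (Dop 0 u) p - p.2 0 * Gam 6 (Dop 0 u) p + p.2 2 * Gam 4 (Dop 0 u) p) ∧
    (ww p * DD (2, 0) u p = p.1 * p.2 2 * box u p + p.1 * Gam 7 (Dop 3 u) p + p.1 * Gam 5 (Dop 1 u) p
      - p.1 * Gam 4 (Dop 2 u) p - p.2 2 * Gam 7 (Dop 0 u) p + p.2 0 * Gam 5 (Dop 0 u) p - p.2 1 * Gam 4 (Dop 0 u) p) ∧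
    (ww p * (∑ i : Fin 3, DD (i, i.succ) u p) = -(p.1 * p.1 * box u p) + p.1 * Gam 7 (Dop 0 u) p
      - p.2 0 * Gam 7 (Dop 1 u) p - p.2 1 * Gam 7 (Dop 2 u) p - p.2 2 * Gam 7 (Dop 3 u) p
      + p.2 1 * Gam 6 (Dop 1 u) p - p.2 2 * Gam 5 (Dop 1 u) p - p.2 0 * Gam 6 (Dop 2 u) p + p.2 2 * Gam 4 (Dop 2 u) p
      + p.2 0 * Gam 5 (Dop 3 u) p - p.2 1 * Gam 4 (Dop 3 u) p) := by
  have h10 := Dop_comm hu 1 0 p hp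
  have h20 := Dop_comm hu 2 0 p hp
  have h30 := Dop_comm hu 3 0 p hp
  have h21 := Dop_comm hu 2 1 p hp
  have h31 := Dop_comm hu 3 1 p hp
  have h32 := Dop_comm hu 3 2 p hp
  have s1 : (Fin.succ (0 : Fin 3)) = (1 : Fin 4) := rfl
  have s2 : (Fin.succ (1 : Fin 3)) = (2 : Fin 4) := rfl
  have s3 : (Fin.succ (2 : Fin 3)) = (3 : Fin 4) := rfl
  have hb : box u p = Dop 0 (Dop 0 u) p - Dop 1 (Dop 1 u) p - Dop 2 (Dop 2 u) p - Dop 3 (Dop 3 u) p := by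
    rw [box_eq]; simp [Fin.sum_univ_three, DD, s1, s2, s3]; ring
  refine ⟨?_, ?_, ?_, ?_⟩ <;>
  · simp [Gam_eq, hb, DD, coef, cc, cd, Fin.sum_univ_succ, y4, s1, s2, s3, ww, h10, h20, h30, h21, h31, h32]
    ring

lemma mul_bd {c g A G : ℝ} (hc : |c| ≤ A) (hg : |g| ≤ G) : -(A * G) ≤ c * g ∧ c * g ≤ A * G := by
  rw [← abs_le, abs_mul]; exact mul_le_mul hc hg (abs_nonneg _) ((abs_nonneg _).trans hc)

lemma ks_bd {M : ℝ} (hM : 0 < M) {u : Pt → ℝ} (hu : Sm u) {p : Pt} (hp : 0 < p.1) (hs : ‖p.2‖ ≤ p.1 + M) :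
    (∀ i : Fin 3, |ww p * DD (i, 0) u p| ≤ 10 * (1 + M)^2 * ((1 + p.1)^2 * |box u p| + (1 + p.1) * GD u p)) ∧
    |ww p * ∑ i : Fin 3, DD (i, i.succ) u p| ≤ 10 * (1 + M)^2 * ((1 + p.1)^2 * |box u p| + (1 + p.1) * GD u p) := by
  obtain ⟨k0, k1, k2, k3⟩ := ks_id hu hp
  set A := (1 + M) * (1 + p.1) with hA
  have hA0 : 0 ≤ A := by positivity
  have ht : |p.1| ≤ A := by rw [abs_of_pos hp]; nlinarith
  have hx : ∀ i, |p.2 i| ≤ A := fun i => (coord_le _ i).trans (by nlinarith)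
  have hm : ∀ {a b : ℝ}, |a| ≤ A → |b| ≤ A → |a * b| ≤ A * A := fun ha hb => by
    rw [abs_mul]; exact mul_le_mul ha hb (abs_nonneg _) hA0
  have gd := le_GD u p
  have hG := GD_nonneg u p
  have hfin : A * A * |box u p| + 10 * (A * GD u p) ≤ 10 * (1 + M)^2 * ((1 + p.1)^2 * |box u p| + (1 + p.1) * GD u p) := by
    have e1 : A * A * |box u p| = (1 + M)^2 * ((1 + p.1)^2 * |box u p|) := by rw [hA]; ring
    have e2 : 10 * (A * GD u p) = 10 * ((1 + M) * ((1 + p.1) * GD u p)) := by rw [hA]; ring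
    have e3 : (1 + M) ≤ (1+M)^2 := by nlinarith
    have e4 : 0 ≤ (1 + p.1) * GD u p := by positivity
    have e5 : 0 ≤ (1 + M)^2 * ((1 + p.1)^2 * |box u p|) := by positivity
    rw [e1, e2]; nlinarith [mul_le_mul_of_nonneg_right e3 e4]
  have hAG : 0 ≤ A * GD u p := by positivity
  refine ⟨fun i => ?_, ?_⟩
  · refine le_trans ?_ hfin
    fin_cases i
    · show |ww p * DD (0, 0) u p| ≤ _
      rw [k0, abs_le]
      have b0 := mul_bd (hm ht (hx 0)) le_rfl (g := box u p)
      have b1 := mul_bd ht (gd 7 1); have b2 := mul_bd ht (gd 6 2); have b3 := mul_bd ht (gd 5 3)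
      have b4 := mul_bd (hx 0) (gd 7 0); have b5 := mul_bd (hx 1) (gd 6 0); have b6 := mul_bd (hx 2) (gd 5 0)
      constructor <;> linarith [b0.1, b0.2, b1.1, b1.2, b2.1, b2.2, b3.1, b3.2, b4.1, b4.2, b5.1, b5.2, b6.1, b6.2]
    · show |ww p * DD (1, 0) u p| ≤ _
      rw [k1, abs_le]
      have b0 := mul_bd (hm ht (hx 1)) le_rfl (g := box u p)
      have b1 := mul_bd ht (gd 7 2); have b2 := mul_bd ht (gd 6 1); have b3 := mul_bd ht (gd 4 3)
      have b4 := mul_bd (hx 1) (gd 7 0); have b5 := mul_bd (hx 0) (gd 6 0); have b6 := mul_bd (hx 2) (gd 4 0)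
      constructor <;> linarith [b0.1, b0.2, b1.1, b1.2, b2.1, b2.2, b3.1, b3.2, b4.1, b4.2, b5.1, b5.2, b6.1, b6.2]
    · show |ww p * DD (2, 0) u p| ≤ _
      rw [k2, abs_le]
      have b0 := mul_bd (hm ht (hx 2)) le_rfl (g := box u p)
      have b1 := mul_bd ht (gd 7 3); have b2 := mul_bd ht (gd 5 1); have b3 := mul_bd ht (gd 4 2)
      have b4 := mul_bd (hx 2) (gd 7 0); have b5 := mul_bd (hx 0) (gd 5 0); have b6 := mul_bd (hx 1) (gd 4 0)
      constructor <;> linarith [b0.1, b0.2, b1.1, b1.2, b2.1, b2.2, b3.1, b3.2, b4.1, b4.2, b5.1, b5.2, b6.1, b6.2]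
  · refine le_trans ?_ hfin
    rw [k3, abs_le]
    have b0 := mul_bd (hm ht ht) le_rfl (g := box u p)
    have b1 := mul_bd ht (gd 7 0)
    have b2 := mul_bd (hx 0) (gd 7 1); have b3 := mul_bd (hx 1) (gd 7 2); have b4 := mul_bd (hx 2) (gd 7 3)
    have b5 := mul_bd (hx 1) (gd 6 1); have b6 := mul_bd (hx 2) (gd 5 1); have b7 := mul_bd (hx 0) (gd 6 2)
    have b8 := mul_bd (hx 2) (gd 4 2); have b9 := mul_bd (hx 0) (gd 5 3); have b10 := mul_bd (hx 1) (gd 4 3)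
    constructor <;> linarith [b0.1, b0.2, b1.1, b1.2, b2.1, b2.2, b3.1, b3.2, b4.1, b4.2, b5.1, b5.2, b6.1, b6.2, b7.1, b7.2, b8.1, b8.2, b9.1, b9.2, b10.1, b10.2]

lemma e4_succ (i : Fin 3) : e4 i.succ = (0, EuclideanSpace.single i 1) := by fin_cases i <;> rfl

lemma slice_hd {f : Pt → ℝ} (hf : Sm f) {t : ℝ} (ht : 0 < t) (x : E3) :
    HasFDerivAt (fun x : E3 => f (t, x)) ((fderiv ℝ f (t, x)).comp (ContinuousLinearMap.inr ℝ ℝ E3)) x := by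
  have h1 : HasFDerivAt (fun x : E3 => ((t, x) : Pt)) (ContinuousLinearMap.inr ℝ ℝ E3) x := by
    exact hasFDerivAt_prodMk_right t x
  exact (hf.diff (p := (t, x)) ht).hasFDerivAt.comp x h1

lemma slice_fd {f : Pt → ℝ} (hf : Sm f) {t : ℝ} (ht : 0 < t) (x : E3) (i : Fin 3) :
    fderiv ℝ (fun x : E3 => f (t, x)) x (EuclideanSpace.single i 1) = Dop i.succ f (t, x) := by
  rw [(slice_hd hf ht x).fderiv, Dop_eq, e4_succ]; rfl

lemma Sp.int_mul {M : ℝ} {f g : Pt → ℝ} (hs : Sp M f) (hf : Sm f) (hg : Sm g) {t : ℝ} (ht : 0 < t) :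
    Integrable fun x : E3 => f (t, x) * g (t, x) := by
  refine int_supp (B := t + M) ((hf.contx ht).mul (hg.contx ht)) fun x hx => ?_
  rw [hs (t, x) ht hx, zero_mul]

lemma ibp {M : ℝ} {f g : Pt → ℝ} (hs : Sp M f) (hf : Sm f) (hg : Sm g) {t : ℝ} (ht : 0 < t) (i : Fin 3) :
    ∫ x : E3, f (t, x) * Dop i.succ g (t, x) = - ∫ x : E3, Dop i.succ f (t, x) * g (t, x) := by
  have := integral_mul_fderiv_eq_neg_fderiv_mul_of_integrable (μ := (volume : Measure E3))
    (f := fun x => f (t, x)) (g := fun x => g (t, x)) (v := EuclideanSpace.single i (1:ℝ)) ?_ ?_ ?_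
    (fun x _ => (slice_hd hf ht x).differentiableAt) (fun x _ => (slice_hd hg ht x).differentiableAt)
  · simpa only [slice_fd hf ht, slice_fd hg ht] using this
  · simpa only [slice_fd hf ht] using (hs.Dop i.succ).int_mul (hf.Dop _) hg ht
  · simpa only [slice_fd hg ht] using hs.int_mul hf (hg.Dop _) ht
  · exact hs.int_mul hf hg ht

lemma hess1 {M : ℝ} {z : Pt → ℝ} (hs : Sp M z) (hz : Sm z) {t : ℝ} (ht : 0 < t) (i j : Fin 3) :
    ∫ x : E3, (DD (i, j.succ) z (t, x))^2 = ∫ x : E3, DD (i, i.succ) z (t, x) * DD (j, j.succ) z (t, x) := by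
  have h1 := ibp (hs.Dop j.succ) (hz.Dop j.succ) ((hz.Dop j.succ).Dop i.succ) ht i
  have h2 := ibp (hs.Dop j.succ) (hz.Dop j.succ) ((hz.Dop i.succ).Dop i.succ) ht j
  have h3 : ∀ x : E3, Dop i.succ (Dop i.succ (Dop j.succ z)) (t, x) = Dop j.succ (Dop i.succ (Dop i.succ z)) (t, x) := by
    intro x
    rw [(EqU.Dop (Dop_comm hz i.succ j.succ) i.succ) (t, x) ht]
    exact Dop_comm (hz.Dop i.succ) i.succ j.succ (t, x) ht
  simp only [h3] at h1
  rw [h1] at h2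
  have h4 := neg_injective h2
  simp only [DD, sq]
  rw [h4]
  congr 1; ext x; ring

lemma Sp.DD {M : ℝ} {z : Pt → ℝ} (hs : Sp M z) (ij) : Sp M (DD ij z) := (hs.Dop _).Dop _

lemma hess {M : ℝ} {z : Pt → ℝ} (hs : Sp M z) (hz : Sm z) {t : ℝ} (ht : 0 < t) (i j : Fin 3) :
    ∫ x : E3, (DD (i, j.succ) z (t, x))^2 ≤ ∫ x : E3, (∑ i : Fin 3, DD (i, i.succ) z (t, x))^2 := by
  have h : ∫ x : E3, (∑ i : Fin 3, DD (i, i.succ) z (t, x))^2 = ∑ i : Fin 3, ∑ j : Fin 3, ∫ x : E3, (DD (i, j.succ) z (t, x))^2 := by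
    simp_rw [hess1 hs hz ht]
    have hi : ∀ i j : Fin 3, Integrable fun x : E3 => DD (i, i.succ) z (t, x) * DD (j, j.succ) z (t, x) :=
      fun i j => (hs.DD _).int_mul (hz.DD _) (hz.DD _) ht
    simp_rw [← integral_finsetSum _ (fun j _ => hi _ j)]
    rw [← integral_finsetSum _ (fun i _ => integrable_finsetSum _ fun j _ => hi i j)]
    congr 1; ext x
    rw [sq, Finset.sum_mul_sum]
  rw [h]
  have hn : ∀ i j : Fin 3, 0 ≤ ∫ x : E3, (DD (i, j.succ) z (t, x))^2 := fun i j => integral_nonneg fun x => sq_nonneg _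
  exact (Finset.single_le_sum (f := fun j : Fin 3 => ∫ x : E3, (DD (i, j.succ) z (t, x))^2) (fun j _ => hn i j) (Finset.mem_univ j)).trans
    (Finset.single_le_sum (f := fun i : Fin 3 => ∑ j : Fin 3, ∫ x : E3, (DD (i, j.succ) z (t, x))^2)
      (fun i _ => Finset.sum_nonneg fun j _ => hn i j) (Finset.mem_univ i))

lemma DD_wu {u : Pt → ℝ} (hu : Sm u) {p : Pt} (hp : 0 < p.1) (i j : Fin 3) :
    DD (i, j.succ) (ww * u) p = ww p * DD (i, j.succ) u p - 2 * p.2 i * Dop j.succ u p - 2 * p.2 j * Dop i.succ u p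
      - (if i = j then 2 * u p else 0) := by
  have hw : ∀ j : Fin 3, EqU (Dop j.succ ww) ((-2 : ℝ) • y4 j.succ) := by
    intro j q hq
    rw [Dop_ww _ q hq]
    simp [sg, Fin.succ_ne_zero]
  have h1 : EqU (Dop j.succ (ww * u)) (((-2 : ℝ) • y4 j.succ) * u + ww * Dop j.succ u) := by
    intro q hq
    rw [Dop_mul Sm.ww hu j.succ q hq]
    simp only [Pi.add_apply, Pi.mul_apply, hw j q hq]
  have sy := (Sm.y4 j.succ).smul (-2 : ℝ)
  have yv : ∀ j : Fin 3, y4 j.succ p = p.2 j := by intro j; fin_cases j <;> rfl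
  unfold DD
  simp only
  rw [h1.Dop i.succ p hp, Dop_add (sy.mul hu) (Sm.ww.mul (hu.Dop _)) i.succ p hp, Pi.add_apply,
    Dop_mul sy hu i.succ p hp, Dop_mul Sm.ww (hu.Dop _) i.succ p hp]
  simp only [Pi.add_apply, Pi.mul_apply, hw i p hp]
  rw [Dop_smul (Sm.y4 j.succ) _ i.succ p hp]
  simp only [Pi.smul_apply, Dop_y4, smul_eq_mul, Fin.succ_inj, yv]
  split_ifs <;> ring

lemma imono {f g : E3 → ℝ} (hf : ∀ x, 0 ≤ f x) (hg : Integrable g) (h : ∀ x, f x ≤ g x) :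
    ∫ x, f x ≤ ∫ x, g x :=
  integral_mono_of_nonneg (Filter.Eventually.of_forall hf) hg (Filter.Eventually.of_forall h)

lemma EE_cont {f : Pt → ℝ} (hf : Sm f) (lam : ℝ) (m : ℕ) {t : ℝ} (ht : 0 < t) :
    Continuous fun x : E3 => EE lam m f (t, x) := by
  unfold EE as
  have h1 := hf.contJ m ht
  have h2 : Continuous fun x : E3 => ∑ a, J m (Dop a f) (t, x) := continuous_finsetSum _ fun a _ => (hf.Dop a).contJ m ht
  exact h1.add (h2.const_mul ((1 + t) ^ lam))

lemma GG_cont {f : Pt → ℝ} (hf : Sm f) (m : ℕ) {t : ℝ} (ht : 0 < t) :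
    Continuous fun x : E3 => GG m f (t, x) := by
  unfold GG
  exact continuous_finsetSum _ fun a _ => (hf.DD a).contJ m ht

lemma Sp.EE {M : ℝ} {f : Pt → ℝ} (hf : Sp M f) (lam : ℝ) (m : ℕ) : Sp M (EE lam m f) := by
  intro p hp hp2
  unfold _root_.EE
  rw [hf.J m p hp hp2, Finset.sum_eq_zero fun a _ => (hf.Dop a).J m p hp hp2]; simp

lemma Sp.GG {M : ℝ} {f : Pt → ℝ} (hf : Sp M f) (m : ℕ) : Sp M (GG m f) := by
  intro p hp hp2
  exact Finset.sum_eq_zero fun a _ => (hf.DD a).J m p hp hp2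

lemma Sp.intE {M : ℝ} {f : Pt → ℝ} (hs : Sp M f) (hf : Sm f) (lam : ℝ) (m : ℕ) {t : ℝ} (ht : 0 < t) (g : E3 → ℝ) (hg : Continuous g) :
    Integrable fun x : E3 => g x * (_root_.EE lam m f (t, x))^2 := by
  refine int_supp (B := t + M) (hg.mul ((EE_cont hf lam m ht).pow 2)) fun x hx => ?_
  rw [hs.EE lam m (t, x) ht hx]; simp

lemma Sp.intG {M : ℝ} {f : Pt → ℝ} (hs : Sp M f) (hf : Sm f) (m : ℕ) {t : ℝ} (ht : 0 < t) (g : E3 → ℝ) (hg : Continuous g) :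
    Integrable fun x : E3 => g x * (_root_.GG m f (t, x))^2 := by
  refine int_supp (B := t + M) (hg.mul ((GG_cont hf m ht).pow 2)) fun x hx => ?_
  rw [hs.GG m (t, x) ht hx]; simp

def dens (lam : ℝ) (l : List (Fin 8)) (f : Pt → ℝ) (p : Pt) : ℝ :=
  (1 + p.1) ^ (2 * lam) * ∑ α : Fin 4, (Dop α (GamWord l f) p) ^ 2 + (GamWord l f p) ^ 2

lemma dens_int {M : ℝ} {f : Pt → ℝ} (hs : Sp M f) (hf : Sm f) (lam : ℝ) (l : List (Fin 8)) {t : ℝ} (ht : 0 < t) :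
    Integrable fun x : E3 => dens lam l f (t, x) := by
  refine int_supp (B := t + M) ?_ fun x hx => ?_
  · unfold dens
    have h2 : Continuous fun x : E3 => ∑ a, (Dop a (GamWord l f) (t, x))^2 :=
      continuous_finsetSum _ fun a _ => (((hf.GamWord l).Dop a).contx ht).pow 2
    exact (h2.const_mul ((1 + t) ^ (2 * lam))).add (((hf.GamWord l).contx ht).pow 2)
  · unfold dens
    rw [hs.GamWord l (t, x) ht hx, Finset.sum_eq_zero fun a _ => by rw [(hs.GamWord l).Dop a (t, x) ht hx]; simp]
    simp

lemma dens_nonneg (lam : ℝ) (l : List (Fin 8)) (f : Pt → ℝ) {p : Pt} (hp : 0 < p.1) : 0 ≤ dens lam l f p := by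
  unfold dens
  have : 0 ≤ (1 + p.1) ^ (2 * lam) := rpow_nonneg (by linarith) _
  have h2 : 0 ≤ ∑ α : Fin 4, (Dop α (GamWord l f) p) ^ 2 := Finset.sum_nonneg fun _ _ => sq_nonneg _
  positivity

lemma dens_le (lam : ℝ) {N : ℕ} {l : List (Fin 8)} (hl : l.length ≤ N) (f : Pt → ℝ) {t : ℝ} (ht : 0 < t) :
    ∫ x : E3, dens lam l f (t, x) ≤ energy lam N f t := by
  have h0 : ∀ n (a : Fin n → Fin 8), 0 ≤ ∫ x : E3, dens lam (List.ofFn a) f (t, x) :=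
    fun n a => integral_nonneg fun x => dens_nonneg lam _ f ht
  have h1 := Finset.single_le_sum (f := fun a : Fin l.length → Fin 8 => ∫ x : E3, dens lam (List.ofFn a) f (t, x))
    (fun a _ => h0 _ a) (Finset.mem_univ l.get)
  have h2 := Finset.single_le_sum (f := fun n => ∑ a : Fin n → Fin 8, ∫ x : E3, dens lam (List.ofFn a) f (t, x))
    (fun n _ => Finset.sum_nonneg fun a _ => h0 n a) (Finset.mem_range.2 (show l.length < N + 1 by omega))
  simp only [List.ofFn_get] at h1
  exact h1.trans h2

lemma as_sq (lam : ℝ) {p : Pt} (hp : 0 < p.1) : (as lam p)^2 = (1 + p.1)^(2 * lam) := by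
  unfold as
  rw [← rpow_natCast, ← rpow_mul (by linarith)]; congr 1; push_cast; ring

lemma enL2 (lam : ℝ) (N : ℕ) : ∃ C : ℝ, 0 ≤ C ∧ ∀ (M : ℝ) (f : Pt → ℝ), Sm f → Sp M f → ∀ t, 0 < t →
    ∀ D2, energy lam N f t ≤ D2 → ∫ x : E3, (EE lam N f (t, x))^2 ≤ C * D2 := by
  obtain ⟨C, hC, h⟩ := famA' fam_Dop N
  refine ⟨(1 + 4 * C)^2 * ((words N).card * (5 * (words N).card)), by positivity, fun M f hf hs t ht D2 hD => ?_⟩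
  have hpt : ∀ x : E3, (EE lam N f (t, x))^2 ≤ (1 + 4 * C)^2 * ((words N).card * ∑ l ∈ words N, 5 * dens lam l f (t, x)) := by
    intro x
    have hp : (0:ℝ) < ((t, x) : Pt).1 := ht
    have ha := (as_pos lam hp).le
    set s : List (Fin 8) → ℝ := fun l => |GamWord l f (t, x)| + as lam (t, x) * ∑ a, |Dop a (GamWord l f) (t, x)| with hs'
    have e1 : EE lam N f (t, x) ≤ (1 + 4 * C) * ∑ l ∈ words N, s l := by
      have e2 : ∑ l ∈ words N, s l = J N f (t, x) + as lam (t, x) * BD Dop N f (t, x) := by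
        rw [hs', Finset.sum_add_distrib, ← Finset.mul_sum]
        unfold BD J
        rw [Finset.sum_comm]
      have e3 : ∑ a, J N (Dop a f) (t, x) ≤ 4 * (C * BD Dop N f (t, x)) := by
        refine (Finset.sum_le_card_nsmul _ _ (C * BD Dop N f (t, x)) fun a _ => h f hf _ hp a).trans ?_
        simp
      have e4 := mul_le_mul_of_nonneg_left e3 ha
      have j0 := J_nonneg N f (t, x)
      have b0 := BD_nonneg Dop N f (t, x)
      rw [e2]; unfold EE
      nlinarith [mul_nonneg ha b0, mul_nonneg hC j0]
    have e0 := EE_nonneg lam N f hp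
    refine (pow_le_pow_left₀ e0 e1 2).trans ?_
    rw [mul_pow]
    refine mul_le_mul_of_nonneg_left ?_ (sq_nonneg _)
    refine sq_sum_le_card_mul_sum_sq.trans ?_
    refine mul_le_mul_of_nonneg_left (Finset.sum_le_sum fun l _ => ?_) (by positivity)
    rw [hs']
    unfold dens
    rw [← as_sq lam hp]
    have c1 : (∑ a, |Dop a (GamWord l f) (t, x)|)^2 ≤ 4 * ∑ a, (Dop a (GamWord l f) (t, x))^2 := by
      have := sq_sum_le_card_mul_sum_sq (s := Finset.univ) (f := fun a : Fin 4 => |Dop a (GamWord l f) (t, x)|)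
      simpa using this
    have c2 := mul_le_mul_of_nonneg_left c1 (sq_nonneg (as lam (t, x)))
    have c3 := sq_abs (GamWord l f (t, x))
    dsimp only
    nlinarith [sq_nonneg (as lam (t, x) * (∑ a, |Dop a (GamWord l f) (t, x)|) - 4 * |GamWord l f (t, x)|)]
  have hi : Integrable fun x : E3 => (1 + 4 * C)^2 * ((words N).card * ∑ l ∈ words N, 5 * dens lam l f (t, x)) :=
    ((integrable_finsetSum _ fun l _ => (dens_int hs hf lam l ht).const_mul 5).const_mul _).const_mul _
  refine (imono (fun x => sq_nonneg _) hi hpt).trans ?_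
  rw [integral_const_mul, integral_const_mul, integral_finsetSum _ fun l _ => (dens_int hs hf lam l ht).const_mul 5, mul_assoc, mul_assoc]
  refine mul_le_mul_of_nonneg_left (mul_le_mul_of_nonneg_left ?_ (by positivity)) (by positivity)
  refine (Finset.sum_le_card_nsmul _ _ (5 * D2) fun l hl => ?_).trans ?_
  · rw [integral_const_mul]
    have := (dens_le lam (mem_words.1 hl) f ht).trans hD
    linarith
  · rw [nsmul_eq_mul]; apply le_of_eq; ring

lemma J2_word {m : ℕ} {l : List (Fin 8)} (hl : l.length ≤ m) (g : Pt → ℝ) (p : Pt) :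
    J 2 (GamWord l g) p ≤ (words 2).card * J (m + 2) g p := by
  refine J_le fun w hw => ?_
  rw [← GamWord_append]
  exact le_J (by simp; omega) g p

lemma supJ (m : ℕ) : ∃ C : ℝ, 0 ≤ C ∧ ∀ (M : ℝ) (f : Pt → ℝ), Sm f → Sp M f → ∀ t, 0 < t → ∀ x : E3,
    (1 + ‖x‖)^2 * (J m f (t, x))^2 ≤ C * ∫ x : E3, (J (m + 2) f (t, x))^2 := by
  refine ⟨(words m).card * ((words m).card * (32 * (49 * 272^2) * ((words 2).card : ℝ)^2)), by positivity, fun M f hf hs t ht x => ?_⟩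
  set I := ∫ x : E3, (J (m + 2) f (t, x))^2 with hI
  have i0 : Integrable fun x : E3 => (J (m + 2) f (t, x))^2 := by simpa using hs.intJ hf (m + 2) ht (fun _ => 1) continuous_const
  have h1 : ∀ l ∈ words m, (1 + ‖x‖)^2 * |GamWord l f (t, x)|^2 ≤ 32 * (49 * 272^2) * ((words 2).card : ℝ)^2 * I := by
    intro l hl
    have i1 : Integrable fun x : E3 => (J 2 (GamWord l f) (t, x))^2 := by
      simpa using (hs.GamWord l).intJ (hf.GamWord l) 2 ht (fun _ => 1) continuous_const
    have := sob ht (hf.GamWord l) i1 x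
    rw [sq_abs, mul_assoc]
    refine this.trans (mul_le_mul_of_nonneg_left ?_ (by positivity))
    rw [hI, ← integral_const_mul]
    refine integral_mono i1 (i0.const_mul _) fun x => ?_
    have := pow_le_pow_left₀ (J_nonneg _ _ _) (J2_word (mem_words.1 hl) f (t, x)) 2
    simpa [mul_pow] using this
  have h2 : (J m f (t, x))^2 ≤ (words m).card * ∑ l ∈ words m, |GamWord l f (t, x)|^2 := by
    unfold J; exact sq_sum_le_card_mul_sum_sq
  have h3 : ∑ l ∈ words m, (1 + ‖x‖)^2 * |GamWord l f (t, x)|^2 ≤ (words m).card * (32 * (49 * 272^2) * ((words 2).card : ℝ)^2 * I) := by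
    have := Finset.sum_le_card_nsmul _ _ _ h1
    rwa [nsmul_eq_mul] at this
  rw [← Finset.mul_sum] at h3
  calc _ ≤ (1 + ‖x‖)^2 * ((words m).card * ∑ l ∈ words m, |GamWord l f (t, x)|^2) := by gcongr
    _ = (words m).card * ((1 + ‖x‖)^2 * ∑ l ∈ words m, |GamWord l f (t, x)|^2) := by ring
    _ ≤ (words m).card * ((words m).card * (32 * (49 * 272^2) * ((words 2).card : ℝ)^2 * I)) := by gcongr
    _ = _ := by ring

lemma supE (lam : ℝ) (m : ℕ) : ∃ C : ℝ, 0 ≤ C ∧ ∀ (M : ℝ) (f : Pt → ℝ), Sm f → Sp M f → ∀ t, 0 < t → ∀ x : E3,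
    (1 + ‖x‖)^2 * (EE lam m f (t, x))^2 ≤ C * ∫ x : E3, (EE lam (m + 2) f (t, x))^2 := by
  obtain ⟨C, hC, h⟩ := supJ m
  refine ⟨34 * C, by positivity, fun M f hf hs t ht x => ?_⟩
  set I := ∫ x : E3, (EE lam (m + 2) f (t, x))^2 with hI
  have iE : Integrable fun x : E3 => (EE lam (m + 2) f (t, x))^2 := by
    simpa using hs.intE hf lam (m + 2) ht (fun _ => 1) continuous_const
  have hA : 0 < as lam (t, x) := as_pos lam ht
  have hAA : ∀ y : E3, as lam (t, y) = as lam (t, x) := fun y => rfl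
  have a1 : (1 + ‖x‖)^2 * (J m f (t, x))^2 ≤ C * I := by
    refine (h M f hf hs t ht x).trans (mul_le_mul_of_nonneg_left ?_ hC)
    exact imono (fun _ => sq_nonneg _) iE fun y => pow_le_pow_left₀ (J_nonneg _ _ _) (J_le_EE lam _ f ht) 2
  have a2 : ∀ a ∈ (Finset.univ : Finset (Fin 4)), (1 + ‖x‖)^2 * (as lam (t, x))^2 * (J m (Dop a f) (t, x))^2 ≤ C * I := by
    intro a _
    have := h M _ (hf.Dop a) (hs.Dop a) t ht x
    calc _ = (as lam (t, x))^2 * ((1 + ‖x‖)^2 * (J m (Dop a f) (t, x))^2) := by ring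
      _ ≤ (as lam (t, x))^2 * (C * ∫ x : E3, (J (m + 2) (Dop a f) (t, x))^2) := by gcongr
      _ = C * ∫ y : E3, (as lam (t, x))^2 * (J (m + 2) (Dop a f) (t, y))^2 := by rw [integral_const_mul]; ring
      _ ≤ C * I := by
        refine mul_le_mul_of_nonneg_left ?_ hC
        refine imono (fun _ => by positivity) iE fun y => ?_
        rw [← mul_pow]
        exact pow_le_pow_left₀ (mul_nonneg hA.le (J_nonneg _ _ _)) (JD_le_EE lam _ f (p := (t, y)) ht a) 2
  have a3 := Finset.sum_le_card_nsmul _ _ _ a2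
  rw [← Finset.mul_sum] at a3
  simp only [Finset.card_univ, Fintype.card_fin, nsmul_eq_mul] at a3
  have a4 : (∑ a, J m (Dop a f) (t, x))^2 ≤ 4 * ∑ a, (J m (Dop a f) (t, x))^2 := by
    have := sq_sum_le_card_mul_sum_sq (s := Finset.univ) (f := fun a : Fin 4 => J m (Dop a f) (t, x))
    simpa using this
  have a5 := mul_le_mul_of_nonneg_left a4 (show 0 ≤ (1 + ‖x‖)^2 * (as lam (t, x))^2 by positivity)
  have a6 : (EE lam m f (t, x))^2 ≤ 2 * (J m f (t, x))^2 + 2 * ((as lam (t, x))^2 * (∑ a, J m (Dop a f) (t, x))^2) := by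
    unfold EE
    nlinarith [sq_nonneg (J m f (t, x) - as lam (t, x) * ∑ a, J m (Dop a f) (t, x))]
  have a7 := mul_le_mul_of_nonneg_left a6 (show 0 ≤ (1 + ‖x‖)^2 by positivity)
  push_cast at a3
  nlinarith

lemma keyT {t : ℝ} (ht : 0 < t) (x : E3) : (1+t)^2 ≤ 8 * ((1 + ‖x‖)^2 + (ww (t, x) / (1 + t))^2) := by
  have key : (1+t)^2 * (1+t)^2 ≤ 8 * ((1+t)^2 * (1 + ‖x‖)^2 + (ww (t, x))^2) := by
    rw [ww_norm]
    simp only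
    have hx := norm_nonneg x
    rcases le_total ‖x‖ (t/2) with h | h
    · have : 3/4 * t^2 ≤ t^2 - ‖x‖^2 := by nlinarith
      have h5 : (3/4 * t^2)^2 ≤ (t^2 - ‖x‖^2)^2 := by gcongr
      have h6 : 1 ≤ (1 + ‖x‖)^2 := by nlinarith
      have h7 : (1+t)^2 ≤ (1+t)^2 * (1 + ‖x‖)^2 := by nlinarith [sq_nonneg (1+t)]
      have h8 : 8 * ((1+t)^2 + (3/4 * t^2)^2) - (1+t)^2*(1+t)^2 ≥ 0 := by nlinarith [sq_nonneg (t^2 - 1), sq_nonneg (t^2-t), sq_nonneg t, sq_nonneg (t-1)]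
      linarith
    · have : ((1+t)/2)^2 ≤ (1 + ‖x‖)^2 := by gcongr; linarith
      nlinarith [sq_nonneg (1+t), sq_nonneg (t^2 - ‖x‖^2), mul_nonneg (sq_nonneg (1+t)) (sub_nonneg.2 this)]
  have hT : 0 < 1 + t := by linarith
  refine le_of_mul_le_mul_left (key.trans (le_of_eq ?_)) (show 0 < (1 + t)^2 by positivity)
  field_simp

lemma TE {t : ℝ} (ht : 0 < t) (x : E3) {e B : ℝ} (h : (1 + ‖x‖)^2 * e^2 ≤ B) :
    (1 + t)^2 * e^2 ≤ 8 * B * W t x := by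
  have k := mul_le_mul_of_nonneg_right (keyT ht x) (sq_nonneg e)
  have h1 : e^2 ≤ B := by
    refine le_trans ?_ h
    have : 1 ≤ (1 + ‖x‖)^2 := by nlinarith [norm_nonneg x]
    nlinarith [sq_nonneg e]
  unfold W
  nlinarith [mul_le_mul_of_nonneg_left h1 (sq_nonneg (ww (t, x) / (1 + t)))]

lemma wDD (M : ℝ) (hM : 0 < M) (n : ℕ) : ∃ C : ℝ, 0 ≤ C ∧ ∀ f, Sm f → Sp M f → ∀ t, 0 < t → ∀ x : E3,
    ∀ ij, ∀ l : List (Fin 8), l.length ≤ n →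
    (1 + t)^2 * (DD ij (GamWord l f) (t, x))^2 ≤ C * ∫ x : E3, W t x * (GG (n + 2) f (t, x))^2 := by
  obtain ⟨C1, hC1, h1⟩ := wsob M hM
  obtain ⟨C2, hC2, h2⟩ := famB fam_DD n
  refine ⟨C1 * ((words 2).card * C2)^2, by positivity, fun f hf hs t ht x ij l hl => ?_⟩
  refine (h1 _ ((hf.GamWord l).DD ij) ((hs.GamWord l).DD ij) t ht x).trans ?_
  rw [mul_assoc]
  refine mul_le_mul_of_nonneg_left ?_ hC1
  rw [← integral_const_mul]
  have iG := hs.intG hf (n + 2) ht _ (W_cont t)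
  refine imono (fun y => mul_nonneg (zero_le_one.trans (W_one t y)) (sq_nonneg _)) (iG.const_mul _) fun y => ?_
  have q : J 2 (DD ij (GamWord l f)) (t, y) ≤ (words 2).card * C2 * GG (n + 2) f (t, y) := by
    rw [mul_assoc]
    refine J_le fun w hw => ?_
    refine (h2 f hf (t, y) ht ij l w hl).trans (mul_le_mul_of_nonneg_left ?_ hC2)
    exact Finset.sum_le_sum fun i _ => J_mono (by omega) _ _
  have := pow_le_pow_left₀ (J_nonneg _ _ _) q 2
  have := mul_le_mul_of_nonneg_left this (zero_le_one.trans (W_one t y))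
  calc _ ≤ _ := this
    _ = _ := by ring

lemma J0_le (f : Pt → ℝ) (p : Pt) : J 0 f p ≤ (words 0).card * |f p| := by
  refine J_le fun w hw => ?_
  rw [List.length_eq_zero_iff.1 (Nat.le_zero.1 hw)]; rfl

lemma wGG0 (M : ℝ) (hM : 0 < M) (n : ℕ) : ∃ C : ℝ, 0 ≤ C ∧ ∀ f, Sm f → Sp M f → ∀ t, 0 < t → ∀ x : E3,
    (1 + t)^2 * (GG 0 f (t, x))^2 ≤ C * ∫ x : E3, W t x * (GG (n + 2) f (t, x))^2 := by
  obtain ⟨C, hC, h⟩ := wDD M hM n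
  refine ⟨12 * (12 * (((words 0).card : ℝ)^2 * C)), by positivity, fun f hf hs t ht x => ?_⟩
  set X := ∫ x : E3, W t x * (GG (n + 2) f (t, x))^2 with hX
  have h1 : ∀ ij ∈ (Finset.univ : Finset (Fin 3 × Fin 4)), (1 + t)^2 * (J 0 (DD ij f) (t, x))^2 ≤ ((words 0).card : ℝ)^2 * (C * X) := by
    intro ij _
    have := pow_le_pow_left₀ (J_nonneg _ _ _) (J0_le (DD ij f) (t, x)) 2
    rw [mul_pow, sq_abs] at this
    have h3 := h f hf hs t ht x ij [] (by simp)
    calc _ ≤ (1 + t)^2 * (((words 0).card : ℝ)^2 * (DD ij f (t, x))^2) := by gcongr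
      _ = ((words 0).card : ℝ)^2 * ((1 + t)^2 * (DD ij f (t, x))^2) := by ring
      _ ≤ _ := mul_le_mul_of_nonneg_left h3 (sq_nonneg _)
  have h2 := Finset.sum_le_card_nsmul _ _ _ h1
  rw [← Finset.mul_sum] at h2
  have h3 : (GG 0 f (t, x))^2 ≤ 12 * ∑ ij, (J 0 (DD ij f) (t, x))^2 := by
    have := sq_sum_le_card_mul_sum_sq (s := Finset.univ) (f := fun ij : Fin 3 × Fin 4 => J 0 (DD ij f) (t, x))
    simpa [GG] using this
  simp only [Finset.card_univ, Fintype.card_prod, Fintype.card_fin, nsmul_eq_mul] at h2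
  push_cast at h2
  have h4 := mul_le_mul_of_nonneg_left h3 (sq_nonneg (1 + t))
  nlinarith

lemma DD_le_GD (u : Pt → ℝ) (p : Pt) (ij : Fin 3 × Fin 4) : |DD ij u p| ≤ GD u p := by
  obtain ⟨i, j⟩ := ij
  fin_cases i
  · exact le_GD u p 1 j
  · exact le_GD u p 2 j
  · exact le_GD u p 3 j

lemma ellu {M : ℝ} (hM : 0 < M) {u : Pt → ℝ} (hu : Sm u) (hs : Sp M u) {t : ℝ} (ht : 0 < t) (b : E3 → ℝ)
    (b0 : ∀ x, 0 ≤ b x) (bi : Integrable fun x => (b x)^2) (h1 : ∀ x, (1 + t) * |box u (t, x)| ≤ b x)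
    (h2 : ∀ x, GD u (t, x) ≤ b x) (h3 : ∀ x a, |Dop a u (t, x)| ≤ b x) (h4 : ∀ x, |u (t, x)| ≤ (1 + t) * b x) (ij : Fin 3 × Fin 4) :
    ∫ x : E3, W t x * (DD ij u (t, x))^2 ≤ (1 + 4 * (20 * (1 + M)^2 + 12 * (1 + M) + 6)^2) * ∫ x : E3, (b x)^2 := by
  set K1 : ℝ := 20 * (1 + M)^2 + 12 * (1 + M) + 6 with hK
  have hT : 0 < 1 + t := by linarith
  have hK1 : 0 ≤ K1 := by positivity
  have ks : ∀ x : E3, ‖x‖ ≤ t + M → (∀ i : Fin 3, |ww (t, x) * DD (i, 0) u (t, x)| ≤ 20 * (1 + M)^2 * ((1 + t) * b x)) ∧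
    |ww (t, x) * ∑ i : Fin 3, DD (i, i.succ) u (t, x)| ≤ 20 * (1 + M)^2 * ((1 + t) * b x) := by
    intro x hx
    obtain ⟨k1, k2⟩ := ks_bd hM hu (p := (t, x)) ht hx
    have : 10 * (1 + M)^2 * ((1 + t)^2 * |box u (t, x)| + (1 + t) * GD u (t, x)) ≤ 20 * (1 + M)^2 * ((1 + t) * b x) := by
      have e1 := mul_le_mul_of_nonneg_left (h1 x) hT.le
      have e2 := mul_le_mul_of_nonneg_left (h2 x) hT.le
      have e3 : (1 + t)^2 * |box u (t, x)| + (1 + t) * GD u (t, x) ≤ 2 * ((1 + t) * b x) := by nlinarith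
      have e4 := mul_le_mul_of_nonneg_left e3 (show 0 ≤ 10 * (1 + M)^2 by positivity)
      linarith
    exact ⟨fun i => (k1 i).trans this, k2.trans this⟩
  have cx : ∀ x : E3, ‖x‖ ≤ t + M → ∀ i, |x i| ≤ (1 + M) * (1 + t) := fun x hx i =>
    (coord_le x i).trans (by nlinarith)
  have term : ∀ x : E3, ‖x‖ ≤ t + M → ∀ (i : Fin 3) (a : Fin 4), |x i * Dop a u (t, x)| ≤ (1 + M) * ((1 + t) * b x) := by
    intro x hx i a
    rw [abs_mul, ← mul_assoc]
    exact mul_le_mul (cx x hx i) (h3 x a) (abs_nonneg _) (by positivity)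
  have hW : ∀ x, W t x * (DD ij u (t, x))^2 = (DD ij u (t, x))^2 + (ww (t, x) * DD ij u (t, x))^2 / (1 + t)^2 := by
    intro x; unfold W; field_simp
  have hd : ∀ x, (DD ij u (t, x))^2 ≤ (b x)^2 := fun x => by
    rw [← sq_abs]; exact pow_le_pow_left₀ (abs_nonneg _) ((DD_le_GD u _ ij).trans (h2 x)) 2
  obtain ⟨i, j⟩ := ij
  rcases Fin.eq_zero_or_eq_succ j with rfl | ⟨j, rfl⟩
  · rw [← integral_const_mul]
    refine imono (fun x => mul_nonneg (zero_le_one.trans (W_one t x)) (sq_nonneg _)) (bi.const_mul _) fun x => ?_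
    by_cases hx : t + M < ‖x‖
    · rw [hs.DD _ (t, x) ht hx]; have := sq_nonneg (b x); simp only [ne_eq, OfNat.ofNat_ne_zero, not_false_eq_true, zero_pow, mul_zero]; positivity
    push Not at hx
    have e1 : |ww (t, x) * DD (i, 0) u (t, x)| ≤ K1 * ((1 + t) * b x) := by
      refine ((ks x hx).1 i).trans ?_
      have : 0 ≤ (1 + t) * b x := mul_nonneg hT.le (b0 x)
      rw [hK]
      refine mul_le_mul_of_nonneg_right ?_ this
      nlinarith
    have e2 := pow_le_pow_left₀ (abs_nonneg _) e1 2
    rw [sq_abs] at e2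
    have e3 : (ww (t, x) * DD (i, 0) u (t, x))^2 / (1 + t)^2 ≤ K1^2 * (b x)^2 := by
      rw [div_le_iff₀ (by positivity)]; nlinarith
    rw [hW]
    nlinarith [hd x, mul_nonneg (sq_nonneg K1) (sq_nonneg (b x))]
  · have hz : Sm (ww * u) := Sm.ww.mul hu
    have hzs : Sp M (ww * u) := hs.mulL ww
    have lap : ∀ x, (∑ i : Fin 3, DD (i, i.succ) (ww * u) (t, x))^2 ≤ (K1 * (1 + t))^2 * (b x)^2 := by
      intro x
      by_cases hx : t + M < ‖x‖
      · rw [Finset.sum_eq_zero fun i _ => hzs.DD _ (t, x) ht hx]; have := sq_nonneg (b x); simp only [ne_eq, OfNat.ofNat_ne_zero, not_false_eq_true, zero_pow]; positivity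
      push Not at hx
      have e1 := (ks x hx).2
      have s0 := term x hx 0 (Fin.succ 0)
      have s1 := term x hx 1 (Fin.succ 1)
      have s2 := term x hx 2 (Fin.succ 2)
      have e4 := h4 x
      have e5 : |∑ i : Fin 3, DD (i, i.succ) (ww * u) (t, x)| ≤ K1 * ((1 + t) * b x) := by
        have : ∑ i : Fin 3, DD (i, i.succ) (ww * u) (t, x) = ww (t, x) * (∑ i : Fin 3, DD (i, i.succ) u (t, x))
          - 4 * (x 0 * Dop (Fin.succ 0) u (t, x)) - 4 * (x 1 * Dop (Fin.succ 1) u (t, x)) - 4 * (x 2 * Dop (Fin.succ 2) u (t, x)) - 6 * u (t, x) := by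
          rw [Finset.sum_congr rfl fun i _ => DD_wu hu (p := (t, x)) ht i i]
          simp only [Fin.sum_univ_three, if_true]; ring
        rw [this]
        rw [abs_le] at *
        rw [hK]
        constructor <;> nlinarith
      have e6 := pow_le_pow_left₀ (abs_nonneg _) e5 2
      rw [sq_abs] at e6
      refine e6.trans (le_of_eq ?_); ring
    have L := (hess hzs hz ht i j).trans (imono (fun x => sq_nonneg _) (bi.const_mul _) lap)
    rw [integral_const_mul] at L
    have iz : Integrable fun x : E3 => (DD (i, j.succ) (ww * u) (t, x))^2 := by
      simp_rw [sq]; exact (hzs.DD _).int_mul (hz.DD _) (hz.DD _) ht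
    have pt : ∀ x, W t x * (DD (i, j.succ) u (t, x))^2 ≤ 2 / (1 + t)^2 * (DD (i, j.succ) (ww * u) (t, x))^2 + (1 + 2 * K1^2) * (b x)^2 := by
      intro x
      by_cases hx : t + M < ‖x‖
      · rw [hs.DD _ (t, x) ht hx]; have := sq_nonneg (b x); simp only [ne_eq, OfNat.ofNat_ne_zero, not_false_eq_true, zero_pow, mul_zero]; positivity
      push Not at hx
      have s1 := term x hx i j.succ
      have s2 := term x hx j i.succ
      have e4 := h4 x
      have e0 : 0 ≤ (1 + t) * b x := mul_nonneg hT.le (b0 x)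
      have e5 : |ww (t, x) * DD (i, j.succ) u (t, x) - DD (i, j.succ) (ww * u) (t, x)| ≤ K1 * ((1 + t) * b x) := by
        rw [DD_wu hu (p := (t, x)) ht i j]
        have e6 : |(if i = j then 2 * u (t, x) else 0)| ≤ 2 * ((1 + t) * b x) := by
          split_ifs
          · rw [abs_mul, abs_two]; linarith
          · simpa using e0
        have h20 : 0 ≤ 20 * (1 + M)^2 * ((1 + t) * b x) := by positivity
        simp only
        rw [abs_le] at *
        rw [hK]
        constructor <;> nlinarith
      have e6 := pow_le_pow_left₀ (abs_nonneg _) e5 2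
      rw [sq_abs] at e6
      have e7 : (ww (t, x) * DD (i, j.succ) u (t, x))^2 ≤ 2 * (DD (i, j.succ) (ww * u) (t, x))^2 + 2 * (K1^2 * (1 + t)^2 * (b x)^2) := by
        nlinarith [sq_nonneg (ww (t, x) * DD (i, j.succ) u (t, x) - 2 * DD (i, j.succ) (ww * u) (t, x))]
      have e8 : (ww (t, x) * DD (i, j.succ) u (t, x))^2 / (1 + t)^2 ≤ 2 / (1 + t)^2 * (DD (i, j.succ) (ww * u) (t, x))^2 + 2 * (K1^2 * (b x)^2) := by
        rw [div_le_iff₀ (by positivity)]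
        refine e7.trans (le_of_eq ?_); field_simp
      rw [hW]
      nlinarith [hd x]
    refine (imono (fun x => mul_nonneg (zero_le_one.trans (W_one t x)) (sq_nonneg _)) ((iz.const_mul _).add (bi.const_mul _)) pt).trans ?_
    rw [integral_add' (iz.const_mul _) (bi.const_mul _), integral_const_mul, integral_const_mul]
    have : 2 / (1 + t)^2 * ∫ x : E3, (DD (i, j.succ) (ww * u) (t, x))^2 ≤ 2 / (1 + t)^2 * ((K1 * (1 + t))^2 * ∫ x : E3, (b x)^2) :=
      mul_le_mul_of_nonneg_left L (by positivity)
    refine (add_le_add_left this _).trans (le_of_eq ?_)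
    field_simp; ring

lemma EE_mono (lam : ℝ) {m n : ℕ} (h : m ≤ n) (f : Pt → ℝ) {p : Pt} (hp : 0 < p.1) : EE lam m f p ≤ EE lam n f p := by
  unfold EE
  exact add_le_add (J_mono h f p) (mul_le_mul_of_nonneg_left (Finset.sum_le_sum fun a _ => J_mono h _ p) (as_pos lam hp).le)

lemma boxL2 (μ lam γ M : ℝ) (hlam0 : 0 ≤ lam) (hlam1 : lam ≤ 1) (hM : 0 < M) (n : ℕ) : ∃ c : ℝ, 0 ≤ c ∧
    ∀ f, Sm f → Sp M f → psiEq μ lam γ f → ∀ t, 0 < t → ∀ A B : ℝ, ∫ x : E3, (EE lam (n + 3) f (t, x))^2 ≤ A →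
    (∀ x : E3, (1 + ‖x‖)^2 * (EE lam (n + 1) f (t, x))^2 ≤ B) → B ≤ 1 →
    ∫ x : E3, ((1 + t) * J (n + 2) (box f) (t, x))^2 ≤
      c * ((1 + t)^2 * (as (-(2 * lam)) (t, 0))^2 * A + (A + B) * ∫ x : E3, W t x * (GG (n + 2) f (t, x))^2) := by
  obtain ⟨c, hc, h⟩ := box_bound μ lam γ hlam0 hlam1 (n + 1)
  obtain ⟨C, hC, h'⟩ := wGG0 M hM n
  refine ⟨3 * c^2 * (8 + C), by positivity, fun f hf hs he t ht A B hA hB hB1 => ?_⟩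
  set X := ∫ x : E3, W t x * (GG (n + 2) f (t, x))^2 with hX
  set a := as (-(2 * lam)) (t, 0) with ha
  have hT : 0 < 1 + t := by linarith
  have hX0 : 0 ≤ X := integral_nonneg fun x => mul_nonneg (zero_le_one.trans (W_one t x)) (sq_nonneg _)
  have iE : Integrable fun x : E3 => (EE lam (n + 3) f (t, x))^2 := by
    simpa using hs.intE hf lam (n + 3) ht (fun _ => 1) continuous_const
  have iG := hs.intG hf (n + 2) ht _ (W_cont t)
  have hA0 : 0 ≤ A := (integral_nonneg fun x => sq_nonneg _).trans hA
  have hB0 : 0 ≤ B := le_trans (by positivity) (hB 0)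
  have pt : ∀ x : E3, ((1 + t) * J (n + 2) (box f) (t, x))^2 ≤ (3 * c^2 * ((1 + t)^2 * a^2 + C * X)) * (EE lam (n + 3) f (t, x))^2
      + (3 * c^2 * (8 * B)) * (W t x * (GG (n + 2) f (t, x))^2) := by
    intro x
    have hp : (0:ℝ) < ((t, x) : Pt).1 := ht
    have e1 := EE_nonneg lam (n + 1) f hp
    have e2 := EE_nonneg lam (n + 2) f hp
    have e3 := EE_nonneg lam (n + 3) f hp
    have e23 := EE_mono lam (show n + 2 ≤ n + 3 by omega) f hp
    have g0 := GG_nonneg 0 f (t, x)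
    have g2 := GG_nonneg (n + 2) f (t, x)
    have le1 : EE lam (n + 1) f (t, x) ≤ 1 := by
      have h1 := hB x
      have h2 : 1 ≤ (1 + ‖x‖)^2 := by nlinarith [norm_nonneg x]
      have h3 : (EE lam (n + 1) f (t, x))^2 ≤ 1 := by nlinarith [sq_nonneg (EE lam (n + 1) f (t, x))]
      nlinarith
    have k1 := h f hf he (t, x) ht le1
    have k2 := TE ht x (hB x)
    have k3 := h' f hf hs t ht x
    have k4 : ((1 + t) * J (n + 2) (box f) (t, x))^2 ≤ ((1 + t) * (c * qq lam (n + 1) f (t, x)))^2 := by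
      have := J_nonneg (n + 2) (box f) (t, x)
      gcongr
    refine k4.trans ?_
    have k5 : (qq lam (n + 1) f (t, x))^2 ≤ 3 * (a^2 * (EE lam (n + 3) f (t, x))^2 + (EE lam (n + 1) f (t, x))^2 * (GG (n + 2) f (t, x))^2
        + (EE lam (n + 3) f (t, x))^2 * (GG 0 f (t, x))^2) := by
      have a0 : as (-(2 * lam)) (t, x) = a := rfl
      have s1 : 0 ≤ a * EE lam (n + 2) f (t, x) := mul_nonneg (as_pos _ hp).le e2
      have s2 := pow_le_pow_left₀ e2 e23 2
      have s3 := mul_le_mul_of_nonneg_left s2 (sq_nonneg a)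
      have s4 := mul_le_mul_of_nonneg_right s2 (sq_nonneg (GG 0 f (t, x)))
      unfold qq
      rw [a0]
      set u := a * EE lam (n + 2) f (t, x) with hu
      set v := EE lam (n + 1) f (t, x) * GG (n + 2) f (t, x) with hv
      set w := EE lam (n + 2) f (t, x) * GG 0 f (t, x) with hw
      have s5 : u^2 ≤ a^2 * (EE lam (n + 3) f (t, x))^2 := by rw [hu, mul_pow]; exact s3
      have s6 : w^2 ≤ (EE lam (n + 3) f (t, x))^2 * (GG 0 f (t, x))^2 := by rw [hw, mul_pow]; exact s4
      have s7 : v^2 = (EE lam (n + 1) f (t, x))^2 * (GG (n + 2) f (t, x))^2 := by rw [hv, mul_pow]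
      rw [← s7]
      nlinarith [sq_nonneg (u - v), sq_nonneg (v - w), sq_nonneg (u - w)]
    have k6 := mul_le_mul_of_nonneg_left k5 (show 0 ≤ (1 + t)^2 * c^2 by positivity)
    have k7 := mul_le_mul_of_nonneg_left (mul_le_mul_of_nonneg_right k2 (sq_nonneg (GG (n + 2) f (t, x)))) (show 0 ≤ 3 * c^2 by positivity)
    have k8 := mul_le_mul_of_nonneg_left (mul_le_mul_of_nonneg_right k3 (sq_nonneg (EE lam (n + 3) f (t, x)))) (show 0 ≤ 3 * c^2 by positivity)
    calc _ = (1 + t)^2 * c^2 * (qq lam (n + 1) f (t, x))^2 := by ring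
      _ ≤ _ := k6
      _ = 3 * c^2 * ((1 + t)^2 * a^2) * (EE lam (n + 3) f (t, x))^2 + 3 * c^2 * ((1 + t)^2 * (EE lam (n + 1) f (t, x))^2 * (GG (n + 2) f (t, x))^2)
          + 3 * c^2 * ((1 + t)^2 * (GG 0 f (t, x))^2 * (EE lam (n + 3) f (t, x))^2) := by ring
      _ ≤ 3 * c^2 * ((1 + t)^2 * a^2) * (EE lam (n + 3) f (t, x))^2 + 3 * c^2 * (8 * B * W t x * (GG (n + 2) f (t, x))^2)
          + 3 * c^2 * (C * X * (EE lam (n + 3) f (t, x))^2) := by linarith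
      _ = _ := by ring
  refine (imono (fun x => sq_nonneg _) ((iE.const_mul _).add (iG.const_mul _)) pt).trans ?_
  rw [integral_add' (iE.const_mul _) (iG.const_mul _), integral_const_mul, integral_const_mul]
  have hc2 : 0 ≤ 3 * c^2 := by positivity
  calc _ ≤ 3 * c^2 * ((1 + t)^2 * a^2 + C * X) * A + 3 * c^2 * (8 * B) * X := by gcongr
    _ = 3 * c^2 * ((1 + t)^2 * a^2 * A + C * (X * A) + 8 * (B * X)) := by ring
    _ ≤ 3 * c^2 * ((8 + C) * ((1 + t)^2 * a^2 * A) + (8 + C) * (X * A) + (8 + C) * (B * X)) := by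
      have p1 : 0 ≤ (1 + t)^2 * a^2 * A := by positivity
      have p2 : 0 ≤ X * A := by positivity
      have p3 : 0 ≤ B * X := by positivity
      refine mul_le_mul_of_nonneg_left ?_ hc2
      nlinarith [mul_nonneg hC p1, mul_nonneg hC p3]
    _ = _ := by ring

lemma ell (lam M : ℝ) (hlam1 : lam ≤ 1) (hM : 0 < M) (n : ℕ) : ∃ c : ℝ, 0 ≤ c ∧
    ∀ f, Sm f → Sp M f → ∀ t, 0 < t →
    ∫ x : E3, W t x * (GG (n + 2) f (t, x))^2 ≤ c * ((∫ x : E3, ((1 + t) * J (n + 2) (box f) (t, x))^2)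
      + (as (-lam) (t, 0))^2 * ∫ x : E3, (EE lam (n + 3) f (t, x))^2) := by
  obtain ⟨C1, hC1, h1⟩ := famB fam_box (n + 2)
  obtain ⟨C2, hC2, h2⟩ := famB fam_Dop (n + 2)
  obtain ⟨C3, hC3, h3⟩ := famA' fam_DD (n + 2)
  set k : ℝ := 1 + 4 * (20 * (1 + M)^2 + 12 * (1 + M) + 6)^2 with hk
  set C : ℝ := 1 + C1 + 32 * C2 with hCd
  set w : ℝ := ((words (n + 2)).card : ℝ) with hw
  refine ⟨(12 * C3)^2 * (12 * w) * (12 * w) * (k * (C^2 * 2)), by positivity, fun f hf hs t ht => ?_⟩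
  have hT : 0 < 1 + t := by linarith
  have iE : Integrable fun x : E3 => (EE lam (n + 3) f (t, x))^2 := by
    simpa using hs.intE hf lam (n + 3) ht (fun _ => 1) continuous_const
  have sbox : Sp M (box f) := by
    intro p hp hp2
    have h0 : ∑ i : Fin 3, DD (i, i.succ) f p = 0 := Finset.sum_eq_zero fun i _ => hs.DD _ p hp hp2
    rw [box_eq]
    simp [((hs.Dop _).Dop _) p hp hp2, h0]
  have iJ : Integrable fun x : E3 => ((1 + t) * J (n + 2) (box f) (t, x))^2 := by
    simpa [mul_pow] using sbox.intJ hf.box (n + 2) ht (fun _ => (1 + t)^2) continuous_const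
  set q := as (-lam) (t, 0) with hq
  have q0 : 0 < q := as_pos _ (p := (t, 0)) ht
  have aq : as lam (t, 0) * q = 1 := by
    rw [hq]; unfold as; rw [← rpow_add (by exact hT)]; simp
  have Tq : 1 ≤ (1 + t) * q := by
    have : as lam (t, 0) ≤ 1 + t := by
      unfold as
      have := rpow_le_rpow_of_exponent_le (show (1:ℝ) ≤ 1 + t by linarith) hlam1
      simpa using this
    nlinarith
  set b : E3 → ℝ := fun x => C * ((1 + t) * J (n + 2) (box f) (t, x) + q * EE lam (n + 3) f (t, x)) with hb
  have jj : ∀ x, 0 ≤ (1 + t) * J (n + 2) (box f) (t, x) := fun x => mul_nonneg hT.le (J_nonneg _ _ _)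
  have qe : ∀ x, 0 ≤ q * EE lam (n + 3) f (t, x) := fun x => mul_nonneg q0.le (EE_nonneg lam _ f (p := (t, x)) ht)
  have hC0 : 0 ≤ C := by positivity
  have b0 : ∀ x, 0 ≤ b x := fun x => mul_nonneg hC0 (add_nonneg (jj x) (qe x))
  have ble : ∀ x, (b x)^2 ≤ (C^2 * 2) * (((1 + t) * J (n + 2) (box f) (t, x))^2 + q^2 * (EE lam (n + 3) f (t, x))^2) := by
    intro x
    have e : ((1 + t) * J (n + 2) (box f) (t, x) + q * EE lam (n + 3) f (t, x))^2 ≤ 2 * (((1 + t) * J (n + 2) (box f) (t, x))^2 + q^2 * (EE lam (n + 3) f (t, x))^2) := by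
      nlinarith [sq_nonneg ((1 + t) * J (n + 2) (box f) (t, x) - q * EE lam (n + 3) f (t, x))]
    have := mul_le_mul_of_nonneg_left e (sq_nonneg C)
    rw [hb]; simp only; rw [mul_pow]; linarith
  have bi : Integrable fun x => (b x)^2 := by
    refine int_supp (B := t + M) ?_ fun x hx => ?_
    · exact ((((hf.box.contJ (n + 2) ht).const_mul _).add ((EE_cont hf lam (n + 3) ht).const_mul _)).const_mul _).pow 2
    · rw [hb]; simp only
      rw [sbox.J _ (t, x) ht hx, hs.EE _ _ (t, x) ht hx]; simp
  have intb : ∫ x, (b x)^2 ≤ (C^2 * 2) * ((∫ x : E3, ((1 + t) * J (n + 2) (box f) (t, x))^2)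
      + q^2 * ∫ x : E3, (EE lam (n + 3) f (t, x))^2) := by
    rw [← integral_const_mul (q^2), ← integral_add iJ (iE.const_mul _), ← integral_const_mul]
    exact imono (fun x => sq_nonneg _) ((iJ.add (iE.const_mul _)).const_mul _) ble
  have sumD : ∀ x, ∑ i, J (n + 3) (Dop i f) (t, x) ≤ q * EE lam (n + 3) f (t, x) := by
    intro x
    have e1 : as lam (t, 0) * ∑ i, J (n + 3) (Dop i f) (t, x) ≤ EE lam (n + 3) f (t, x) := by
      have := J_nonneg (n + 3) f (t, x)
      have a0 : as lam (t, x) = as lam (t, 0) := rfl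
      unfold EE; rw [a0]; linarith
    have e2 := mul_le_mul_of_nonneg_left e1 q0.le
    calc _ = (as lam (t, 0) * q) * ∑ i, J (n + 3) (Dop i f) (t, x) := by rw [aq, one_mul]
      _ = q * (as lam (t, 0) * ∑ i, J (n + 3) (Dop i f) (t, x)) := by ring
      _ ≤ _ := e2
  have main : ∀ l ∈ words (n + 2), ∀ ij, ∫ x : E3, W t x * (DD ij (GamWord l f) (t, x))^2 ≤ k * ∫ x, (b x)^2 := by
    intro l hl ij
    have hl' := mem_words.1 hl
    refine ellu hM (hf.GamWord l) (hs.GamWord l) ht b b0 bi (fun x => ?_) (fun x => ?_) (fun x a => ?_) (fun x => ?_) ij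
    · have e := h1 f hf (t, x) ht () l [] hl'
      have e' : |box (GamWord l f) (t, x)| ≤ C1 * J (n + 2) (box f) (t, x) := by simpa [GamWord] using e
      have := mul_le_mul_of_nonneg_left e' hT.le
      have t1 : C1 * ((1 + t) * J (n + 2) (box f) (t, x)) ≤ C * ((1 + t) * J (n + 2) (box f) (t, x)) :=
        mul_le_mul_of_nonneg_right (by rw [hCd]; linarith) (jj x)
      have t2 := mul_nonneg hC0 (qe x)
      rw [hb]; simp only; nlinarith
    · have e : ∀ k' ∈ (Finset.univ : Finset (Fin 8)), ∑ a, |Gam k' (Dop a (GamWord l f)) (t, x)| ≤ 4 * (C2 * (q * EE lam (n + 3) f (t, x))) := by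
        intro k' _
        refine (Finset.sum_le_card_nsmul _ _ (C2 * (q * EE lam (n + 3) f (t, x))) fun a _ => ?_).trans (by simp)
        refine (h2 f hf (t, x) ht a l [k'] hl').trans (mul_le_mul_of_nonneg_left ?_ hC2)
        refine le_trans (Finset.sum_le_sum fun i _ => J_mono ?_ _ _) (sumD x)
        simp; omega
      have e2 := Finset.sum_le_card_nsmul _ _ _ e
      have e3 : GD (GamWord l f) (t, x) ≤ 32 * C2 * (q * EE lam (n + 3) f (t, x)) := by
        refine e2.trans (le_of_eq ?_); simp; ring
      have t1 : 32 * C2 * (q * EE lam (n + 3) f (t, x)) ≤ C * (q * EE lam (n + 3) f (t, x)) :=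
        mul_le_mul_of_nonneg_right (by rw [hCd]; linarith) (qe x)
      have t2 := mul_nonneg hC0 (jj x)
      rw [hb]; simp only; nlinarith
    · have e : |Dop a (GamWord l f) (t, x)| ≤ C2 * (q * EE lam (n + 3) f (t, x)) := by
        refine (h2 f hf (t, x) ht a l [] hl').trans (mul_le_mul_of_nonneg_left ?_ hC2)
        refine le_trans (Finset.sum_le_sum fun i _ => J_mono ?_ _ _) (sumD x)
        simp
      have t1 : C2 * (q * EE lam (n + 3) f (t, x)) ≤ C * (q * EE lam (n + 3) f (t, x)) :=
        mul_le_mul_of_nonneg_right (by rw [hCd]; linarith) (qe x)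
      have t2 := mul_nonneg hC0 (jj x)
      rw [hb]; simp only; nlinarith
    · have e : |GamWord l f (t, x)| ≤ EE lam (n + 3) f (t, x) :=
        (le_J (m := n + 3) (by omega) f (t, x)).trans (J_le_EE lam _ f (p := (t, x)) ht)
      have e0 := EE_nonneg lam (n + 3) f (p := (t, x)) ht
      have t0 : EE lam (n + 3) f (t, x) ≤ (1 + t) * (q * EE lam (n + 3) f (t, x)) := by nlinarith
      have t1 : q * EE lam (n + 3) f (t, x) ≤ b x := by
        have t2 := mul_nonneg hC0 (jj x)
        have t3 : 1 * (q * EE lam (n + 3) f (t, x)) ≤ C * (q * EE lam (n + 3) f (t, x)) :=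
          mul_le_mul_of_nonneg_right (by rw [hCd]; linarith) (qe x)
        rw [hb]; simp only; nlinarith
      have := mul_le_mul_of_nonneg_left t1 hT.le
      linarith
  have iD : ∀ ij l, Integrable fun x : E3 => W t x * (DD ij (GamWord l f) (t, x))^2 := by
    intro ij l
    refine int_supp (B := t + M) ((W_cont t).mul ((((hf.GamWord l).DD ij).contx ht).pow 2)) fun x hx => ?_
    rw [(hs.GamWord l).DD ij (t, x) ht hx]; simp
  have gp : ∀ x : E3, W t x * (GG (n + 2) f (t, x))^2 ≤ ((12 * C3)^2 * (12 * w)) * ∑ z ∈ (Finset.univ : Finset (Fin 3 × Fin 4)) ×ˢ words (n + 2),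
      W t x * (DD z.1 (GamWord z.2 f) (t, x))^2 := by
    intro x
    have e1 : GG (n + 2) f (t, x) ≤ 12 * C3 * BD DD (n + 2) f (t, x) := by
      refine (Finset.sum_le_card_nsmul _ _ _ fun ij _ => h3 f hf (t, x) ht ij).trans (le_of_eq ?_)
      simp; ring
    have e2 := pow_le_pow_left₀ (GG_nonneg _ _ _) e1 2
    have e3 : (BD DD (n + 2) f (t, x))^2 ≤ 12 * w * ∑ z ∈ (Finset.univ : Finset (Fin 3 × Fin 4)) ×ˢ words (n + 2), (DD z.1 (GamWord z.2 f) (t, x))^2 := by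
      unfold BD
      rw [← Finset.sum_product']
      refine sq_sum_le_card_mul_sum_sq.trans (le_of_eq ?_)
      simp [Finset.card_product, hw]
    rw [← Finset.mul_sum]
    have w0 : 0 ≤ W t x := zero_le_one.trans (W_one t x)
    calc _ ≤ W t x * (12 * C3 * BD DD (n + 2) f (t, x))^2 := by gcongr
      _ = (12 * C3)^2 * W t x * (BD DD (n + 2) f (t, x))^2 := by ring
      _ ≤ (12 * C3)^2 * W t x * (12 * w * ∑ z ∈ (Finset.univ : Finset (Fin 3 × Fin 4)) ×ˢ words (n + 2), (DD z.1 (GamWord z.2 f) (t, x))^2) := by gcongr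
      _ = _ := by ring
  refine (imono (fun x => mul_nonneg (zero_le_one.trans (W_one t x)) (sq_nonneg _))
    ((integrable_finsetSum _ fun z _ => iD z.1 z.2).const_mul _) gp).trans ?_
  rw [integral_const_mul, integral_finsetSum _ fun z _ => iD z.1 z.2]
  have s1 : ∑ z ∈ (Finset.univ : Finset (Fin 3 × Fin 4)) ×ˢ words (n + 2), ∫ x : E3, W t x * (DD z.1 (GamWord z.2 f) (t, x))^2 ≤ 12 * w * (k * ∫ x, (b x)^2) := by
    refine (Finset.sum_le_card_nsmul _ _ _ fun z hz => main z.2 (Finset.mem_product.1 hz).2 z.1).trans (le_of_eq ?_)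
    simp [Finset.card_product, hw]
  have k0 : 0 ≤ k := by positivity
  have w0 : 0 ≤ w := by positivity
  calc _ ≤ (12 * C3)^2 * (12 * w) * (12 * w * (k * ((C^2 * 2) * ((∫ x : E3, ((1 + t) * J (n + 2) (box f) (t, x))^2)
      + q^2 * ∫ x : E3, (EE lam (n + 3) f (t, x))^2)))) := by
        refine mul_le_mul_of_nonneg_left (s1.trans ?_) (by positivity)
        exact mul_le_mul_of_nonneg_left (mul_le_mul_of_nonneg_left intb k0) (by positivity)
    _ = _ := by ring

lemma cd_Dop {f : Pt → ℝ} (hf : ContDiff ℝ (⊤ : ℕ∞) f) (a : Fin 4) : ContDiff ℝ (⊤ : ℕ∞) (Dop a f) := by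
  have h : (Dop a f) = fun q => fderiv ℝ f q (e4 a) := by ext q; exact Dop_eq a f q
  rw [h]
  exact (hf.fderiv_right (m := (⊤ : ℕ∞)) (by simp)).clm_apply contDiff_const

lemma cd_Gam {f : Pt → ℝ} (hf : ContDiff ℝ (⊤ : ℕ∞) f) (k : Fin 8) : ContDiff ℝ (⊤ : ℕ∞) (Gam k f) := by
  have h : (Gam k f) = fun q => ∑ b, coef k b q * Dop b f q := by ext q; exact Gam_eq k f q
  rw [h]
  refine ContDiff.sum fun b _ => ContDiff.mul ?_ (cd_Dop hf b)
  unfold coef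
  exact contDiff_const.add (ContDiff.sum fun g _ => contDiff_const.mul (y4_cd g))

lemma cd_GamWord {f : Pt → ℝ} (hf : ContDiff ℝ (⊤ : ℕ∞) f) (l : List (Fin 8)) : ContDiff ℝ (⊤ : ℕ∞) (GamWord l f) := by
  induction l with
  | nil => exact hf
  | cons k l ih => exact cd_Gam ih k

lemma DD_dxi (i : Fin 3) (a : Fin 4) (f : Pt → ℝ) (p : Pt) : dxi i (Dop a f) p = DD (i, a) f p := by
  fin_cases i <;> rfl

lemma core (μ lam γ M : ℝ) (hlam0 : 0 ≤ lam) (hlam1 : lam ≤ 1) (hM : 0 < M) (n : ℕ) :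
    ∃ C ≥ 0, ∃ δ > 0, ∀ (f : Pt → ℝ) (D : ℝ), Sm f → Sp M f → psiEq μ lam γ f → 0 < D → D ≤ δ →
      (∀ t : ℝ, 0 ≤ t → energy lam (n + 3) f t ≤ D^2) →
      ∀ l : List (Fin 8), l.length ≤ n → ∀ t, 0 < t → ∀ (x : E3) ij, |DD ij (GamWord l f) (t, x)| ≤ C * D * (1 + t)^(-(2 * lam)) := by
  obtain ⟨Ce, hCe, he⟩ := enL2 lam (n + 3)
  obtain ⟨Cs, hCs, hsup⟩ := supE lam (n + 1)
  obtain ⟨c1, hc1, h1⟩ := ell lam M hlam1 hM n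
  obtain ⟨c2, hc2, h2⟩ := boxL2 μ lam γ M hlam0 hlam1 hM n
  obtain ⟨C3, hC3, h3⟩ := wDD M hM n
  set R : ℝ := c1 * c2 * (Ce + Cs * Ce) + Cs * Ce with hR
  have hR0 : 0 ≤ R := by positivity
  refine ⟨√(C3 * (2 * c1 * (c2 + 1) * Ce)), sqrt_nonneg _, 1 / (2 * (R + 1)), by positivity, fun f D hf hs hpde hD hDδ hen l hl t ht x ij => ?_⟩
  have hT : 0 < 1 + t := by linarith
  have hRD : R * D^2 ≤ 1 / 2 := by
    have e1 : D * (2 * (R + 1)) ≤ 1 := by rwa [le_div_iff₀ (by positivity)] at hDδ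
    have e2 : D ≤ 1 / 2 := by nlinarith
    have e3 : R * D ≤ 1 / 2 := by nlinarith
    nlinarith
  set A := Ce * D^2 with hA
  have hA0 : 0 ≤ A := by positivity
  have iA : ∫ x : E3, (EE lam (n + 3) f (t, x))^2 ≤ A := he M f hf hs t ht _ (hen t ht.le)
  have iB : ∀ x : E3, (1 + ‖x‖)^2 * (EE lam (n + 1) f (t, x))^2 ≤ Cs * A := fun x =>
    (hsup M f hf hs t ht x).trans (mul_le_mul_of_nonneg_left iA hCs)
  have P1 : 0 ≤ c1 * c2 * (Ce + Cs * Ce) * D^2 := by positivity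
  have P2 : 0 ≤ Cs * Ce * D^2 := by positivity
  have hB1 : Cs * A ≤ 1 := by rw [hA]; rw [hR] at hRD; nlinarith
  have hx2 := h2 f hf hs hpde t ht A (Cs * A) iA iB hB1
  have hx1 := h1 f hf hs t ht
  set X := ∫ x : E3, W t x * (GG (n + 2) f (t, x))^2 with hX
  have hX0 : 0 ≤ X := integral_nonneg fun x => mul_nonneg (zero_le_one.trans (W_one t x)) (sq_nonneg _)
  set q := as (-lam) (t, 0) with hq
  have q0 : 0 < q := as_pos _ (p := (t, 0)) ht
  have qa : as (-(2 * lam)) (t, 0) = q^2 := by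
    rw [hq, as_sq (-lam) (p := (t, 0)) ht]; unfold as; congr 1; ring
  have Tq : 1 ≤ (1 + t) * q := by
    have aq : as lam (t, 0) * q = 1 := by
      rw [hq]; unfold as; rw [← rpow_add (by exact hT)]; simp
    have : as lam (t, 0) ≤ 1 + t := by
      unfold as
      have := rpow_le_rpow_of_exponent_le (show (1:ℝ) ≤ 1 + t by linarith) hlam1
      simpa using this
    nlinarith
  rw [qa] at hx2
  have q2 : q^2 ≤ (1 + t)^2 * (q^2)^2 := by
    have : 1 ≤ ((1 + t) * q)^2 := one_le_pow₀ Tq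
    nlinarith [sq_nonneg q]
  have Xb : X ≤ 2 * c1 * (c2 + 1) * ((1 + t)^2 * (q^2)^2 * A) := by
    have e1 : q^2 * ∫ x : E3, (EE lam (n + 3) f (t, x))^2 ≤ (1 + t)^2 * (q^2)^2 * A :=
      mul_le_mul q2 iA (integral_nonneg fun _ => sq_nonneg _) (by positivity)
    have e2 := hx1.trans (mul_le_mul_of_nonneg_left (add_le_add hx2 e1) hc1)
    have e3 : c1 * c2 * (A + Cs * A) ≤ 1 / 2 := by rw [hA]; rw [hR] at hRD; nlinarith
    have e4 := mul_le_mul_of_nonneg_right e3 hX0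
    nlinarith
  have fin := (h3 f hf hs t ht x ij l hl).trans (mul_le_mul_of_nonneg_left Xb hC3)
  have fin2 : (DD ij (GamWord l f) (t, x))^2 ≤ (C3 * (2 * c1 * (c2 + 1) * Ce)) * (D * q^2)^2 := by
    refine le_of_mul_le_mul_left (fin.trans (le_of_eq ?_)) (show 0 < (1 + t)^2 by positivity)
    rw [hA]; ring
  have fin3 := abs_le_sqrt fin2
  rw [sqrt_mul (by positivity), sqrt_sq (by positivity)] at fin3
  have a2 : (1 + t)^(-(2 * lam)) = q^2 := by rw [← qa]; rfl
  rw [a2, mul_assoc]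
  exact fin3

/-- **Pointwise decay of second derivatives under the bootstrap assumption**
(Lemma 2.3, (2.11)): for `0 ≤ λ ≤ 1` there are `C, δ > 0` independent of `K, ε, t` such
that if `ψ` solves the equation, is supported in `{|x| ≤ t+M}`, and satisfies
`E_N(ψ)(t) ≤ K²ε²` for all `t ≥ 0` with `Kε ≤ δ`, then for all `|a| ≤ N-3`,
`‖∇∂Γ^aψ(t,·)‖_{L^∞} ≤ C K ε (1+t)^{-2λ}`. -/
theorem pointwise_decay_second_derivatives
    (μ lam γ M : ℝ) (N : ℕ) (hμ : 0 < μ) (hlam0 : 0 ≤ lam) (hlam1 : lam ≤ 1)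
    (hγ : 1 < γ) (hM : 0 < M) (hN : 8 ≤ N) :
    ∃ C > 0, ∃ δ > 0, ∀ (ψ : Pt → ℝ) (K ε : ℝ),
      ContDiff ℝ (⊤ : ℕ∞) ψ →
      (∀ t : ℝ, 0 ≤ t → ∀ x : E3, t + M < ‖x‖ → ψ (t, x) = 0) →
      psiEq μ lam γ ψ →
      0 < K → 0 < ε →
      (∀ t : ℝ, 0 ≤ t → energy lam N ψ t ≤ K ^ 2 * ε ^ 2) →
      K * ε ≤ δ →
      ∀ n : ℕ, n ≤ N - 3 → ∀ a : Fin n → Fin 8, ∀ t : ℝ, 0 ≤ t → ∀ x : E3,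
        ∑ i : Fin 3, ∑ α : Fin 4, |dxi i (Dop α (GamWord (List.ofFn a) ψ)) (t, x)|
          ≤ C * K * ε * (1 + t) ^ (-(2 * lam)) := by
  obtain ⟨C, hC, δ, hδ, h⟩ := core μ lam γ M hlam0 hlam1 hM (N - 3)
  refine ⟨12 * C + 1, by positivity, δ, hδ, fun ψ K ε hψ hsupp hpde hK hε hen hKε n hn a => ?_⟩
  have hN3 : N - 3 + 3 = N := by omega
  rw [hN3] at h
  have hsm : Sm ψ := fun p _ => hψ.contDiffAt
  have hsp : Sp M ψ := fun p hp hp2 => hsupp p.1 hp.le p.2 hp2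
  have hKe : 0 < K * ε := mul_pos hK hε
  have h' := h ψ (K * ε) hsm hsp hpde hKe hKε (fun t ht => by rw [mul_pow]; exact hen t ht) (List.ofFn a) (by simpa using hn)
  have pos : ∀ t : ℝ, 0 < t → ∀ x : E3, ∑ i : Fin 3, ∑ α : Fin 4, |dxi i (Dop α (GamWord (List.ofFn a) ψ)) (t, x)|
          ≤ (12 * C + 1) * K * ε * (1 + t) ^ (-(2 * lam)) := by
    intro t ht x
    have r0 : 0 < (1 + t) ^ (-(2 * lam)) := rpow_pos_of_pos (by linarith) _
    calc _ ≤ ∑ i : Fin 3, ∑ α : Fin 4, C * (K * ε) * (1 + t) ^ (-(2 * lam)) :=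
        Finset.sum_le_sum fun i _ => Finset.sum_le_sum fun α _ => by rw [DD_dxi]; exact h' t ht x (i, α)
      _ = 12 * C * K * ε * (1 + t) ^ (-(2 * lam)) := by simp; ring
      _ ≤ _ := by
        have : 0 < K * ε * (1 + t) ^ (-(2 * lam)) := mul_pos hKe r0
        nlinarith
  intro t ht x
  rcases ht.lt_or_eq with ht | rfl
  · exact pos t ht x
  have c1 : Continuous fun t : ℝ => ∑ i : Fin 3, ∑ α : Fin 4, |dxi i (Dop α (GamWord (List.ofFn a) ψ)) (t, x)| := by
    refine continuous_finsetSum _ fun i _ => continuous_finsetSum _ fun α _ => ?_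
    simp_rw [DD_dxi]
    have := (cd_Dop (cd_Dop (cd_GamWord hψ (List.ofFn a)) α) i.succ).continuous
    exact (this.comp (f := fun t : ℝ => ((t, x) : Pt)) (by fun_prop)).abs
  have c2 : ContinuousAt (fun t : ℝ => (12 * C + 1) * K * ε * (1 + t) ^ (-(2 * lam))) 0 := by
    refine continuousAt_const.mul (ContinuousAt.rpow_const (by fun_prop) (Or.inl (by norm_num)))
  exact le_of_tendsto_of_tendsto (c1.continuousAt.tendsto.mono_left nhdsWithin_le_nhds)
    (c2.tendsto.mono_left nhdsWithin_le_nhds)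
    (Filter.eventually_of_mem (self_mem_nhdsWithin (s := Ioi (0:ℝ))) fun t ht => pos t ht x)
end
end

section
/- Let λ > 1, C₁ > 0, c > 0, M > 0 and ε > 0, and let F ∈ C²([0,∞)) satisfy F(0) = F′(0) = 0 and F″(t) + (C₁/(1+t)^λ) F′(t) ≥ cε/(t+M) for all t ≥ 0. Then there exists a constant C > 0, depending only on λ, C₁, c and M (not on ε or t), such that F′(t) ≥ Cε log(t/M + 1) for all t ≥ 0, and F(t) ≥ Cε (t+M) log(t/M + 1) for all t ≥ M e². -/
noncomputable section
open Real Set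

theorem nonneg_of_hasDerivAt_aux (f f' : ℝ → ℝ) (h0 : f 0 = 0)
    (hd : ∀ t, 0 ≤ t → HasDerivAt f (f' t) t) (hp : ∀ t, 0 ≤ t → 0 ≤ f' t)
    (t : ℝ) (ht : 0 ≤ t) : 0 ≤ f t := by
  have hm : MonotoneOn f (Set.Ici 0) := by
    apply monotoneOn_of_deriv_nonneg (convex_Ici 0)
    · intro x hx
      exact (hd x hx).continuousAt.continuousWithinAt
    · intro x hx
      rw [interior_Ici] at hx
      exact (hd x (le_of_lt hx)).differentiableAt.differentiableWithinAt
    · intro x hx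
      rw [interior_Ici] at hx
      rw [(hd x (le_of_lt hx)).deriv]
      exact hp x (le_of_lt hx)
  have := hm (Set.mem_Ici.2 le_rfl) (Set.mem_Ici.2 ht) ht
  linarith

/-- **Lower bounds from the damped differential inequality** ((3.25)-(3.26)): if `λ > 1`,
`C₁, c, M > 0` and `F ∈ C²` satisfies `F(0) = F'(0) = 0` and
`F'' + (C₁/(1+t)^λ) F' ≥ cε/(t+M)` for `t ≥ 0`, then there is `C > 0`, depending only on
`λ, C₁, c, M`, with `F'(t) ≥ Cε log(t/M + 1)` for `t ≥ 0` and
`F(t) ≥ Cε(t+M) log(t/M + 1)` for `t ≥ M e²`. -/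
theorem damped_ode_log_lower_bound
    (lam C₁ c M : ℝ) (hlam : 1 < lam) (hC₁ : 0 < C₁) (hc : 0 < c) (hM : 0 < M) :
    ∃ C > 0, ∀ ε : ℝ, 0 < ε → ∀ F : ℝ → ℝ, ContDiff ℝ 2 F →
      F 0 = 0 → deriv F 0 = 0 →
      (∀ t : ℝ, 0 ≤ t →
        c * ε / (t + M) ≤ deriv (deriv F) t + C₁ / (1 + t) ^ lam * deriv F t) →
      (∀ t : ℝ, 0 ≤ t → C * ε * Real.log (t / M + 1) ≤ deriv F t) ∧
      (∀ t : ℝ, M * Real.exp 2 ≤ t →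
        C * ε * (t + M) * Real.log (t / M + 1) ≤ F t) := by
  have hl : 0 < lam - 1 := by linarith
  set K := C₁ / (lam - 1) with hK
  have hKpos : 0 < K := div_pos hC₁ hl
  set A := Real.exp (-K) * c with hA
  have hApos : 0 < A := mul_pos (Real.exp_pos _) hc
  refine ⟨A / 2, by positivity, ?_⟩
  intro ε hε F hF hF0 hF'0 hineq
  have hFd : Differentiable ℝ F := hF.differentiable (by norm_num)
  have hF'd : Differentiable ℝ (deriv F) := by
    have h2 : ContDiff ℝ (1 + 1) F := by simpa [one_add_one_eq_two] using hF
    exact (contDiff_succ_iff_deriv.1 h2).2.2.differentiable (by norm_num)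
  have hlog : ∀ t : ℝ, 0 ≤ t →
      HasDerivAt (fun s => Real.log (s / M + 1)) (1 / (t + M)) t := by
    intro t ht
    have hpos : 0 < t / M + 1 := by positivity
    have h := (((hasDerivAt_id t).div_const M).add_const 1).log hpos.ne'
    refine HasDerivAt.congr_deriv h ?_
    change 1 / M / (t / M + 1) = 1 / (t + M)
    field_simp
  have hlognn : ∀ t : ℝ, 0 ≤ t → 0 ≤ Real.log (t / M + 1) := by
    intro t ht
    apply Real.log_nonneg
    have : 0 ≤ t / M := by positivity
    linarith
  let G : ℝ → ℝ := fun t => K * (1 - (1 + t) ^ (1 - lam))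
  have hGd : ∀ t : ℝ, 0 ≤ t → HasDerivAt G (C₁ / (1 + t) ^ lam) t := by
    intro t ht
    have hpos : 0 < 1 + t := by linarith
    have h := ((((hasDerivAt_id t).const_add 1).rpow_const (p := 1 - lam)
      (Or.inl hpos.ne')).const_sub 1).const_mul K
    refine HasDerivAt.congr_deriv h ?_
    have e : (1 - lam - 1) = -lam := by ring
    change K * -(1 * (1 - lam) * (1 + t) ^ (1 - lam - 1)) = C₁ / (1 + t) ^ lam
    rw [e, Real.rpow_neg hpos.le, hK]
    have := (Real.rpow_pos_of_pos hpos lam).ne'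
    field_simp
    ring
  have hG0 : ∀ t : ℝ, 0 ≤ t → 0 ≤ G t := by
    intro t ht
    have : (1 + t) ^ (1 - lam) ≤ 1 :=
      Real.rpow_le_one_of_one_le_of_nonpos (by linarith) (by linarith)
    exact mul_nonneg hKpos.le (by linarith)
  have hGK : ∀ t : ℝ, 0 ≤ t → G t ≤ K := by
    intro t ht
    have : 0 < (1 + t) ^ (1 - lam) := Real.rpow_pos_of_pos (by linarith) _
    change K * (1 - (1 + t) ^ (1 - lam)) ≤ K
    nlinarith
  have h1 : ∀ t : ℝ, 0 ≤ t → c * ε * Real.log (t / M + 1) ≤ Real.exp (G t) * deriv F t := by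
    intro t ht
    have := nonneg_of_hasDerivAt_aux
      (fun s => Real.exp (G s) * deriv F s - c * ε * Real.log (s / M + 1))
      (fun s => (Real.exp (G s) * (C₁ / (1 + s) ^ lam) * deriv F s
        + Real.exp (G s) * deriv (deriv F) s) - c * ε * (1 / (s + M)))
      (by simp [hF'0])
      (fun s hs => (((hGd s hs).exp).mul (hF'd s).hasDerivAt).sub ((hlog s hs).const_mul (c * ε)))
      (by
        intro s hs
        have h := hineq s hs
        have he : 1 ≤ Real.exp (G s) := Real.one_le_exp (hG0 s hs)
        have hq : 0 ≤ c * ε / (s + M) := by positivity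
        have h3 := mul_le_mul_of_nonneg_left h (Real.exp_pos (G s)).le
        have h4 := mul_le_mul_of_nonneg_right he hq
        have h5 : c * ε * (1 / (s + M)) = c * ε / (s + M) := by ring
        rw [h5]
        linarith)
      t ht
    linarith
  have h2 : ∀ t : ℝ, 0 ≤ t → A * ε * Real.log (t / M + 1) ≤ deriv F t := by
    intro t ht
    have h := h1 t ht
    have hL := hlognn t ht
    have hB : 0 ≤ c * ε * Real.log (t / M + 1) := by positivity
    have he : Real.exp (-K) ≤ Real.exp (-G t) := Real.exp_le_exp.2 (neg_le_neg (hGK t ht))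
    calc A * ε * Real.log (t / M + 1) = Real.exp (-K) * (c * ε * Real.log (t / M + 1)) := by
          rw [hA]; ring
      _ ≤ Real.exp (-G t) * (c * ε * Real.log (t / M + 1)) :=
          mul_le_mul_of_nonneg_right he hB
      _ ≤ Real.exp (-G t) * (Real.exp (G t) * deriv F t) :=
          mul_le_mul_of_nonneg_left h (Real.exp_pos _).le
      _ = deriv F t := by
          rw [← mul_assoc, ← Real.exp_add]; simp
  refine ⟨?_, ?_⟩
  · intro t ht
    have h := h2 t ht
    have hL := hlognn t ht
    have : 0 ≤ A * ε * Real.log (t / M + 1) := by positivity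
    linarith
  · intro t ht
    have ht0 : 0 ≤ t := le_trans (by positivity) ht
    have h3 := nonneg_of_hasDerivAt_aux
      (fun s => F s - A * ε * ((s + M) * Real.log (s / M + 1) - s))
      (fun s => deriv F s - A * ε * ((1 * Real.log (s / M + 1) + (s + M) * (1 / (s + M))) - 1))
      (by simp [hF0])
      (fun s hs => (hFd s).hasDerivAt.sub
        (((((hasDerivAt_id s).add_const M).mul (hlog s hs)).sub (hasDerivAt_id s)).const_mul
          (A * ε)))
      (by
        intro s hs
        have h := h2 s hs
        have : (s + M) * (1 / (s + M)) = 1 := mul_one_div_cancel (by positivity)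
        rw [this]
        linarith)
      t ht0
    have hL2 : 2 ≤ Real.log (t / M + 1) := by
      rw [Real.le_log_iff_exp_le (by positivity)]
      have : Real.exp 2 ≤ t / M := by
        rw [le_div_iff₀ hM]; linarith
      linarith
    have h4 : t ≤ (t + M) * Real.log (t / M + 1) / 2 := by nlinarith
    have h5 := mul_le_mul_of_nonneg_left h4 (mul_pos hApos hε).le
    linarith
end
end

section
/- Let λ > 1 and C₁ > 0, and let F ∈ C²([0,∞)) satisfy F(0) = 0, F′(t) ≥ 0 for all t ≥ 0, and F″(t) + (C₁/(1+t)^λ) F′(t) ≥ 0 for all t ≥ 0. Then: (i) for all 0 ≤ t ≤ τ, F′(t) ≤ exp((C₁/(λ−1))[(1+t)^{1−λ} − (1+τ)^{1−λ}]) F′(τ); and (ii) F(t) ≤ C₄ t F′(t) for all t > 0, where C₄ = exp(C₁/(λ−1)). -/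
noncomputable section
open Real Set

/-- **Gronwall-type bounds for the damped inequality** ((3.31)-(3.32)): if `λ > 1`,
`C₁ > 0` and `F ∈ C²` satisfies `F(0) = 0`, `F' ≥ 0` and `F'' + (C₁/(1+t)^λ) F' ≥ 0` on
`[0,∞)`, then (i) `F'(t) ≤ exp((C₁/(λ-1))[(1+t)^{1-λ} - (1+τ)^{1-λ}]) F'(τ)` for
`0 ≤ t ≤ τ`, and (ii) `F(t) ≤ C₄ t F'(t)` for `t > 0`, with `C₄ = exp(C₁/(λ-1))`. -/
theorem damped_ode_gronwall
    (lam C₁ : ℝ) (hlam : 1 < lam) (hC₁ : 0 < C₁)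
    (F : ℝ → ℝ) (hF : ContDiff ℝ 2 F) (h0 : F 0 = 0)
    (hF' : ∀ t : ℝ, 0 ≤ t → 0 ≤ deriv F t)
    (hode : ∀ t : ℝ, 0 ≤ t →
      0 ≤ deriv (deriv F) t + C₁ / (1 + t) ^ lam * deriv F t) :
    (∀ t τ : ℝ, 0 ≤ t → t ≤ τ →
      deriv F t ≤ Real.exp (C₁ / (lam - 1) *
        ((1 + t) ^ (1 - lam) - (1 + τ) ^ (1 - lam))) * deriv F τ) ∧
    (∀ t : ℝ, 0 < t → F t ≤ Real.exp (C₁ / (lam - 1)) * t * deriv F t) := by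
  have hdF : ContDiff ℝ 1 (deriv F) := hF.deriv'
  have hd1 : Differentiable ℝ F := hF.differentiable (by norm_num)
  have hd2 : Differentiable ℝ (deriv F) := hdF.differentiable (by norm_num)
  have hl : 0 < lam - 1 := by linarith
  have hder : ∀ x : ℝ, 0 ≤ x → HasDerivAt
      (fun t => Real.exp (-(C₁ / (lam - 1)) * (1 + t) ^ (1 - lam)) * deriv F t)
      (Real.exp (-(C₁ / (lam - 1)) * (1 + x) ^ (1 - lam)) *
        (deriv (deriv F) x + C₁ / (1 + x) ^ lam * deriv F x)) x := by
    intro x hx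
    have hx1 : 0 < 1 + x := by linarith
    have h1 : HasDerivAt (fun t : ℝ => 1 + t) 1 x := (hasDerivAt_id x).const_add 1
    have h2 := h1.rpow_const (p := 1 - lam) (Or.inl hx1.ne')
    have h3 := ((h2.const_mul (-(C₁ / (lam - 1)))).exp).mul (hd2 x).hasDerivAt
    refine h3.congr_deriv ?_
    have e : (1 + x) ^ (1 - lam - 1) = ((1 + x) ^ lam)⁻¹ := by
      rw [← Real.rpow_neg hx1.le]; congr 1; ring
    have e2 : -(C₁ / (lam - 1)) * (1 * (1 - lam) * ((1 + x) ^ lam)⁻¹)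
        = C₁ / (1 + x) ^ lam := by
      have : (1 + x) ^ lam ≠ 0 := (Real.rpow_pos_of_pos hx1 _).ne'
      field_simp
      ring
    rw [e, e2]
    ring
  have hmono : MonotoneOn
      (fun t => Real.exp (-(C₁ / (lam - 1)) * (1 + t) ^ (1 - lam)) * deriv F t) (Ici 0) := by
    apply monotoneOn_of_deriv_nonneg (convex_Ici 0)
    · exact fun x hx => (hder x hx).continuousAt.continuousWithinAt
    · intro x hx
      rw [interior_Ici] at hx
      exact (hder x (le_of_lt hx)).differentiableAt.differentiableWithinAt
    · intro x hx
      rw [interior_Ici] at hx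
      rw [(hder x (le_of_lt hx)).deriv]
      exact mul_nonneg (Real.exp_pos _).le (hode x (le_of_lt hx))
  have hi : ∀ t τ : ℝ, 0 ≤ t → t ≤ τ →
      deriv F t ≤ Real.exp (C₁ / (lam - 1) *
        ((1 + t) ^ (1 - lam) - (1 + τ) ^ (1 - lam))) * deriv F τ := by
    intro t τ ht hτ
    have h := hmono (mem_Ici.2 ht) (mem_Ici.2 (ht.trans hτ)) hτ
    have h' := mul_le_mul_of_nonneg_left h
      (Real.exp_pos (C₁ / (lam - 1) * (1 + t) ^ (1 - lam))).le
    simp only [← mul_assoc, ← Real.exp_add] at h'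
    rw [neg_mul, add_neg_cancel, Real.exp_zero, one_mul, neg_mul, ← sub_eq_add_neg,
      ← mul_sub] at h'
    exact h'
  refine ⟨hi, ?_⟩
  intro t ht
  obtain ⟨c, hc, hce⟩ := exists_deriv_eq_slope F ht hd1.continuous.continuousOn
    hd1.differentiableOn
  rw [h0, sub_zero, sub_zero, eq_div_iff ht.ne'] at hce
  have h1 := hi c t hc.1.le hc.2.le
  have hk : 0 < C₁ / (lam - 1) := div_pos hC₁ hl
  have h2 : (1 + c) ^ (1 - lam) ≤ 1 :=
    Real.rpow_le_one_of_one_le_of_nonpos (by linarith [hc.1]) (by linarith)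
  have h3 : 0 ≤ (1 + t) ^ (1 - lam) := Real.rpow_nonneg (by linarith) _
  have h4 : Real.exp (C₁ / (lam - 1) * ((1 + c) ^ (1 - lam) - (1 + t) ^ (1 - lam)))
      ≤ Real.exp (C₁ / (lam - 1)) := by
    apply Real.exp_le_exp.2
    nlinarith
  have h5 := h1.trans (mul_le_mul_of_nonneg_right h4 (hF' t ht.le))
  have h6 := mul_le_mul_of_nonneg_right h5 ht.le
  rw [← hce]
  linarith
end
end
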